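/- Let ℓ > 1 be an integer and G a nontrivial finite nilpotent group such that for every prime p dividing |G|, the Sylow p-subgroup of G is non-cyclic and not isomorphic to any generalized quaternion group. Then there exists δ > 0 such that for every ε > 0 there is a constant C > 0 with |Cl_F[ℓ]| ≤ C · Disc(F)^{1/2 − δ + ε} for every Galois number field F over ℚ with Gal(F/ℚ) ≅ G. -/

import Mathlib

open NumberField

/-- The number of `ℓ`-torsion elements in the class group of a number field `F`. -/
noncomputable def ellTorsion (F : Type*) [Field F] [NumberField F] (ℓ : ℕ) : ℕ :=
  Nat.card {x : ClassGroup (𝓞 F) // x ^ ℓ = 1}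

section GroupTheory

open Subgroup

/-- All subgroups of order `p` coincide. -/
def UniqueOrder (p : ℕ) (P : Type*) [Group P] : Prop :=
  ∀ x y : P, orderOf x = p → orderOf y = p → y ∈ zpowers x

lemma UniqueOrder.subgroup {p : ℕ} {P : Type*} [Group P] (h : UniqueOrder p P) (A : Subgroup P) :
    UniqueOrder p A := by
  intro x y hx hy
  have := h x y (by simpa using hx) (by simpa using hy)
  rw [mem_zpowers_iff] at this ⊢
  obtain ⟨k, hk⟩ := this
  exact ⟨k, by ext; simpa using hk⟩

/-- An element of prime-power order outside a subgroup has a power outside whose `p`-th power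
lies inside. -/
lemma exists_notMem_pow_mem {p : ℕ} {P : Type*} [Group P] (hP : IsPGroup p P) (A : Subgroup P)
    {g : P} (hg : g ∉ A) : ∃ n : ℕ, g ^ p ^ n ∉ A ∧ (g ^ p ^ n) ^ p ∈ A := by
  classical
  have hex : ∃ n : ℕ, g ^ p ^ n ∈ A := by
    obtain ⟨k, hk⟩ := hP g
    exact ⟨k, by rw [hk]; exact A.one_mem⟩
  have h0 : Nat.find hex ≠ 0 := by
    intro h
    have := Nat.find_spec hex
    rw [h] at this
    exact hg (by simpa using this)
  obtain ⟨n, hn⟩ := Nat.exists_eq_succ_of_ne_zero h0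
  refine ⟨n, Nat.find_min hex (by omega), ?_⟩
  have := Nat.find_spec hex
  rw [hn] at this
  rwa [← pow_mul, ← pow_succ]

lemma exists_orderOf_eq_prime_of_nontrivial {p : ℕ} [hp : Fact p.Prime] {P : Type*} [Group P]
    [Finite P] (hP : IsPGroup p P) [Nontrivial P] : ∃ x : P, orderOf x = p := by
  apply exists_prime_orderOf_dvd_card' p
  obtain ⟨n, hn⟩ := (IsPGroup.iff_card).1 hP
  have : Nat.card P ≠ 1 := by
    have := Finite.one_lt_card (α := P)
    omega
  rw [hn]
  exact dvd_pow_self _ (by rintro rfl; simp_all)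

lemma isCyclic_of_uniqueOrder_of_comm {p : ℕ} [hp : Fact p.Prime] {A : Type*} [CommGroup A]
    [Finite A] (hA : IsPGroup p A) (hU : UniqueOrder p A) : IsCyclic A := by
  obtain ⟨a, ha⟩ := Monoid.exists_orderOf_eq_exponent (G := A)
    (Monoid.ExponentExists.of_finite)
  refine ⟨a, ?_⟩
  by_contra hne
  obtain ⟨b₀, hb₀⟩ : ∃ b, b ∉ zpowers a := by
    by_contra h
    push Not at h
    exact hne h
  obtain ⟨n, hb, hbp⟩ := exists_notMem_pow_mem hA (zpowers a) hb₀
  generalize b₀ ^ p ^ n = b at hb hbp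
  have hnt : Nontrivial A := ⟨b, 1, fun h => hb (h ▸ one_mem _)⟩
  have ha1 : a ≠ 1 := by
    rintro rfl
    rw [orderOf_one] at ha
    have := Monoid.exp_eq_one_iff.1 ha.symm
    exact not_subsingleton A this
  have hant : Nontrivial (zpowers a) :=
    ⟨⟨a, mem_zpowers a⟩, 1, by simpa [Subtype.ext_iff] using ha1⟩
  obtain ⟨⟨z, hz⟩, hzo⟩ := exists_orderOf_eq_prime_of_nontrivial (hA.to_subgroup (zpowers a))
  rw [orderOf_mk] at hzo
  obtain ⟨j, hj⟩ := mem_zpowers_iff.1 hbp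
  by_cases hpj : (p : ℤ) ∣ j
  · obtain ⟨i, rfl⟩ := hpj
    have hc : orderOf (b * (a ^ i)⁻¹) = p := by
      apply orderOf_eq_prime
      · rw [mul_pow, ← hj, inv_pow, ← zpow_natCast (a ^ i), ← zpow_mul, mul_comm i, mul_inv_cancel]
      · intro h
        apply hb
        rw [mul_inv_eq_one] at h
        rw [h]
        exact zpow_mem (mem_zpowers a) _
    have := hU z _ hzo hc
    have h2 : b * (a ^ i)⁻¹ ∈ zpowers a := (zpowers_le.2 hz) this
    exact hb ((mul_mem_cancel_right (inv_mem (zpow_mem (mem_zpowers a) _))).1 h2)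
  · obtain ⟨k, hk⟩ := (IsPGroup.iff_orderOf.1 hA) a
    have hcop : IsCoprime j ((p ^ k : ℕ) : ℤ) := by
      push_cast
      apply IsCoprime.pow_right
      rw [isCoprime_comm]
      exact (Int.isCoprime_iff_gcd_eq_one.2
        (by
          rw [Int.gcd_eq_natAbs_gcd_natAbs]
          simpa using (Nat.Prime.coprime_iff_not_dvd hp.out).2 (by
            intro h; exact hpj (Int.natCast_dvd.2 h))))
    have hab : a ∈ zpowers b := by
      obtain ⟨u, v, huv⟩ := hcop
      have : a = (a ^ j) ^ u := by
        rw [← zpow_mul]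
        conv_lhs => rw [← zpow_one a, ← huv]
        rw [zpow_add, mul_comm u, mul_comm v, zpow_mul a _ v, zpow_natCast, ← hk,
          pow_orderOf_eq_one, one_zpow, mul_one]
      rw [this, hj]
      exact zpow_mem (pow_mem (mem_zpowers b) _) _
    have hdvd : orderOf b ∣ orderOf a := ha ▸ Monoid.order_dvd_exponent b
    have hle : zpowers a ≤ zpowers b := zpowers_le.2 hab
    have : zpowers a = zpowers b := by
      apply Subgroup.eq_of_le_of_card_ge hle
      rw [Nat.card_zpowers, Nat.card_zpowers]
      exact Nat.le_of_dvd (orderOf_pos a) hdvd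
    exact hb (this ▸ mem_zpowers b)

/-- A nontrivial normal subgroup of a finite `p`-group contains a nontrivial central element. -/
lemma exists_mem_center_of_normal {p : ℕ} [hp : Fact p.Prime] {P : Type*} [Group P] [Finite P]
    (hP : IsPGroup p P) (N : Subgroup P) [N.Normal] (hN : N ≠ ⊥) :
    ∃ z ∈ N, z ∈ center P ∧ z ≠ 1 := by
  have hP' : IsPGroup p (ConjAct P) := hP
  have : Nontrivial N := (nontrivial_iff_ne_bot N).2 hN
  have hdvd : p ∣ Nat.card N := by
    obtain ⟨x, hx⟩ := exists_orderOf_eq_prime_of_nontrivial (hP.to_subgroup N)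
    exact hx ▸ orderOf_dvd_natCard x
  have h1 : (1 : N) ∈ MulAction.fixedPoints (ConjAct P) N := by
    intro g
    exact smul_one g
  obtain ⟨b, hb, hb1⟩ := hP'.exists_fixed_point_of_prime_dvd_card_of_fixed_point N hdvd h1
  refine ⟨b, b.2, ?_, fun h => hb1 (by ext; simpa using h.symm)⟩
  rw [mem_center_iff]
  intro g
  have h := congrArg Subtype.val (hb (ConjAct.toConjAct g))
  rw [ConjAct.Subgroup.val_conj_smul, ConjAct.smul_def] at h
  simp only [ConjAct.ofConjAct_toConjAct] at h
  exact mul_inv_eq_iff_eq_mul.1 h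

/-- A finite `p`-group has a normal subgroup equal to its own centralizer. -/
lemma exists_normal_centralizer_eq {p : ℕ} [hp : Fact p.Prime] {P : Type*} [Group P] [Finite P]
    (hP : IsPGroup p P) : ∃ A : Subgroup P, A.Normal ∧ centralizer (A : Set P) = A := by
  obtain ⟨A, hA⟩ := (Set.toFinite
    {A : Subgroup P | A.Normal ∧ A ≤ centralizer (A : Set P)}).exists_maximal
    ⟨⊥, inferInstance, bot_le⟩
  obtain ⟨⟨hAn, hAc⟩, hmax⟩ := hA
  refine ⟨A, hAn, le_antisymm ?_ hAc⟩
  by_contra hlt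
  have hN : (centralizer (A : Set P)).map (QuotientGroup.mk' A) ≠ ⊥ := by
    intro h
    rw [Subgroup.map_eq_bot_iff, QuotientGroup.ker_mk'] at h
    exact hlt h
  have : ((centralizer (A : Set P)).map (QuotientGroup.mk' A)).Normal :=
    Normal.map inferInstance _ (QuotientGroup.mk'_surjective A)
  obtain ⟨z, hzN, hzc, hz1⟩ := exists_mem_center_of_normal (hP.to_quotient A) _ hN
  obtain ⟨g, hg, rfl⟩ := hzN
  have hgA : g ∉ A := fun h => hz1 ((QuotientGroup.eq_one_iff g).2 h)
  have hgc : ∀ a ∈ A, a * g = g * a := fun a ha => mem_centralizer_iff.1 hg a ha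
  have hle : A ≤ A ⊔ zpowers g := le_sup_left
  have hmem : A ⊔ zpowers g ∈ {A : Subgroup P | A.Normal ∧ A ≤ centralizer (A : Set P)} := by
    refine ⟨⟨?_⟩, ?_⟩
    · have key : ∀ h : P, h * g * h⁻¹ ∈ A ⊔ zpowers g := by
        intro h
        have h1 : (QuotientGroup.mk' A) (h * g * h⁻¹ * g⁻¹) = 1 := by
          have := mem_center_iff.1 hzc (QuotientGroup.mk' A h)
          simp only [map_mul, map_inv]
          rw [this]; group
        have h2 : h * g * h⁻¹ * g⁻¹ ∈ A := (QuotientGroup.eq_one_iff _).1 h1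
        have h3 := mul_mem (hle h2) (mem_sup_right (mem_zpowers g) : g ∈ A ⊔ zpowers g)
        simpa using h3
      have : ∀ h : P, A ⊔ zpowers g ≤ (A ⊔ zpowers g).comap (MulAut.conj h).toMonoidHom := by
        intro h
        refine sup_le ?_ (zpowers_le.2 ?_)
        · intro a ha
          exact hle (hAn.conj_mem a ha h)
        · exact key h
      intro n hn h
      exact this h hn
    · have hgg : A ⊔ zpowers g ≤ centralizer (A : Set P) :=
        sup_le hAc (zpowers_le.2 hg)
      refine sup_le (le_centralizer_iff.1 hgg) ?_
      rw [zpowers_le, mem_centralizer_iff]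
      intro h hh
      have : A ⊔ zpowers g ≤ centralizer ({g} : Set P) := by
        refine sup_le ?_ (zpowers_le.2 ?_)
        · intro a ha
          rw [mem_centralizer_singleton_iff]
          exact hgc a ha
        · rw [mem_centralizer_singleton_iff]
      exact mem_centralizer_singleton_iff.1 (this hh)
  exact hgA (hmax hmem hle (mem_sup_right (mem_zpowers g)))

lemma mul_zpow_conj {P : Type*} [Group P] {x g : P} {r : ℤ} (h : g * x * g⁻¹ = x ^ r) (s : ℤ)
    (n : ℕ) : (x ^ s * g) ^ n = x ^ (s * ∑ i ∈ Finset.range n, r ^ i) * g ^ n := by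
  have hc : ∀ (t : ℤ), g * x ^ t = x ^ (r * t) * g := by
    intro t
    rw [zpow_mul, ← h, conj_zpow]
    group
  induction n with
  | zero => simp
  | succ n ih =>
    rw [pow_succ', ih, Finset.sum_range_succ', pow_succ' g]
    have := hc (s * ∑ i ∈ Finset.range n, r ^ i)
    calc x ^ s * g * (x ^ (s * ∑ i ∈ Finset.range n, r ^ i) * g ^ n)
        = x ^ s * (g * x ^ (s * ∑ i ∈ Finset.range n, r ^ i)) * g ^ n := by group
      _ = x ^ s * (x ^ (r * (s * ∑ i ∈ Finset.range n, r ^ i)) * g) * g ^ n := by rw [this]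
      _ = x ^ (s + r * (s * ∑ i ∈ Finset.range n, r ^ i)) * (g * g ^ n) := by
          rw [zpow_add]; group
      _ = _ := by
          congr 2
          rw [pow_zero, mul_add, Finset.mul_sum, Finset.mul_sum, Finset.mul_sum, add_comm, mul_one]
          congr 1
          exact Finset.sum_congr rfl fun i _ => by ring

lemma exists_dvd_mul_add {p : ℕ} (hp : p.Prime) (k : ℕ) {σ u j : ℤ} (hσ : σ = p * u)
    (hu : ¬ (p : ℤ) ∣ u) (hj : (p : ℤ) ∣ j) : ∃ s : ℤ, ((p : ℤ) ^ k) ∣ s * σ + j := by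
  obtain ⟨i, rfl⟩ := hj
  have hcop : IsCoprime u ((p : ℤ) ^ k) := by
    apply IsCoprime.pow_right
    rw [isCoprime_comm]
    exact (Int.prime_iff_natAbs_prime.2 (by simpa using hp)).coprime_iff_not_dvd.2 hu
  obtain ⟨a, b, hab⟩ := hcop
  refine ⟨-a * i, p * i * b, ?_⟩
  rw [hσ]
  linear_combination (-(p : ℤ) * i) * hab

/-- The number-theoretic core: if `j` and `r` describe an extension of a cyclic `p`-group by an
element acting nontrivially, then either there are new elements of order `p` or we are in the
quaternion situation. -/
lemma exists_dvd_or_quaternion {p : ℕ} (hp : p.Prime) {k : ℕ} (hk : 1 ≤ k) {r j : ℤ}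
    (hr : ((p : ℤ) ^ k) ∣ r ^ p - 1) (hjr : ((p : ℤ) ^ k) ∣ j * (r - 1))
    (hr1 : ¬ ((p : ℤ) ^ k) ∣ r - 1)
    (hs : ∀ s : ℤ, ¬ ((p : ℤ) ^ k) ∣ s * (∑ i ∈ Finset.range p, r ^ i) + j) :
    p = 2 ∧ ((p : ℤ) ^ k) ∣ r + 1 ∧ 2 ≤ k ∧ (p : ℤ) ^ k ∣ j - p ^ (k - 1) := by
  have hpZ : Prime (p : ℤ) := Nat.prime_iff_prime_int.1 hp
  have := Fact.mk hp
  have hr0 : (p : ℤ) ∣ r - 1 := by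
    have h1 : (p : ℤ) ∣ r ^ p - 1 := (dvd_pow_self _ (by omega)).trans hr
    have h2 : ((r ^ p - 1 : ℤ) : ZMod p) = 0 := (ZMod.intCast_zmod_eq_zero_iff_dvd _ p).2 h1
    push_cast at h2
    rw [ZMod.pow_card] at h2
    exact (ZMod.intCast_zmod_eq_zero_iff_dvd _ p).1 (by push_cast; exact h2)
  have hpj : (p : ℤ) ∣ j := by
    by_contra hpj
    have : IsCoprime ((p : ℤ) ^ k) j := IsCoprime.pow_left (hpZ.coprime_iff_not_dvd.2 hpj)
    exact hr1 (this.dvd_of_dvd_mul_left hjr)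
  have hu : ∀ u : ℤ, (∑ i ∈ Finset.range p, r ^ i) = p * u → (p : ℤ) ∣ u := by
    intro u hu
    by_contra hnd
    obtain ⟨s, h⟩ := exists_dvd_mul_add hp k hu hnd hpj
    exact hs s h
  rcases hp.eq_two_or_odd' with rfl | hodd
  · refine ⟨rfl, ?_⟩
    push_cast at *
    simp only [Finset.sum_range_succ, Finset.sum_range_zero, pow_zero, pow_one, zero_add] at hu hs
    obtain ⟨a, ha⟩ := hr0
    have h4 := hu (a + 1) (by linear_combination ha)
    obtain ⟨b, hb⟩ := h4
    have ha2 : r - 1 = 2 * (2 * b - 1) := by linear_combination ha + 2 * hb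
    obtain ⟨k, rfl⟩ := Nat.exists_eq_add_of_le' hk
    have hcop' : IsCoprime ((2 : ℤ) ^ k) (2 * b - 1) := IsCoprime.pow_left ⟨b, -1, by ring⟩
    have hj2 : (2 : ℤ) ^ k ∣ j := by
      rw [ha2, pow_succ] at hjr
      have : (2 : ℤ) ^ k * 2 ∣ (j * (2 * b - 1)) * 2 := by convert hjr using 1; ring
      exact hcop'.dvd_of_dvd_mul_right (Int.dvd_of_mul_dvd_mul_right (by norm_num) this)
    have hrr : (2 : ℤ) ^ k ∣ r + 1 := by
      have h1 : r ^ 2 - 1 = ((r + 1) * (2 * b - 1)) * 2 := by linear_combination (r + 1) * ha2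
      rw [h1, pow_succ] at hr
      exact hcop'.dvd_of_dvd_mul_right (Int.dvd_of_mul_dvd_mul_right (by norm_num) hr)
    have hj0 := hs 0
    have hj1 := hs 1
    obtain ⟨c, hc⟩ := hj2
    obtain ⟨e, he⟩ := hrr
    have hcodd : Odd c := by
      by_contra h
      rw [Int.not_odd_iff_even] at h
      obtain ⟨f, rfl⟩ := h
      exact hj0 ⟨f, by rw [hc]; ring⟩
    obtain ⟨c', rfl⟩ := hcodd
    have heeven : Even e := by
      by_contra h
      rw [Int.not_even_iff_odd] at h
      obtain ⟨f, rfl⟩ := h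
      exact hj1 ⟨f + c' + 1, by rw [hc]; rw [pow_succ]; linear_combination he⟩
    obtain ⟨f, rfl⟩ := heeven
    refine ⟨⟨f, by rw [he]; ring⟩, ?_, ⟨c', by rw [hc]; simp; ring⟩⟩
    by_contra hk2
    obtain rfl : k = 0 := by omega
    exact hr1 ⟨2 * b - 1, by rw [ha2]; ring⟩
  · exfalso
    have h2 := odd_sq_dvd_geom_sum₂_sub (p := p) (a := (1 : ℤ)) (b := (r - 1) / p) hodd
    obtain ⟨a, ha⟩ := hr0
    have hdiv : ((p : ℤ) * a) / p = a := Int.mul_ediv_cancel_left _ (by exact_mod_cast hp.ne_zero)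
    rw [ha, hdiv] at h2
    have h4 : (1 : ℤ) + p * a = r := by linear_combination -ha
    rw [h4] at h2
    simp only [one_pow, mul_one] at h2
    obtain ⟨c, hc⟩ := h2
    have := hu (1 + p * c) (by linear_combination hc)
    exact hpZ.not_dvd_one ((Int.dvd_add_left (dvd_mul_right _ _)).1 this)


lemma exists_mulEquiv_quaternionGroup {P : Type*} [Group P] {x y : P} {k : ℕ} (hk : 2 ≤ k)
    (hx : orderOf x = 2 ^ k) (hy : y ∉ zpowers x) (hyx : y * x * y⁻¹ = x⁻¹)
    (hyy : y ^ 2 = x ^ 2 ^ (k - 1)) (hcov : ∀ h : P, h ∉ zpowers x → y⁻¹ * h ∈ zpowers x) :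
    Nonempty (P ≃* QuaternionGroup (2 ^ (k - 1))) := by
  set N := 2 * 2 ^ (k - 1) with hN
  have hN' : N = 2 ^ k := by rw [hN, ← pow_succ']; congr 1; omega
  have hNx : orderOf x = N := by rw [hx, hN']
  have hNZ : NeZero N := ⟨by positivity⟩
  let ξ : ZMod N → P := fun i => x ^ i.val
  have hξ : ∀ z : ℤ, ξ z = x ^ z := by
    intro z
    have : ((z : ZMod N).val : ℤ) = z % N := ZMod.val_intCast z
    simp only [ξ]
    rw [← zpow_natCast, this, ← hNx, zpow_mod_orderOf]
  have hadd : ∀ i j, ξ (i + j) = ξ i * ξ j := by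
    intro i j
    obtain ⟨i, rfl⟩ := ZMod.intCast_surjective i
    obtain ⟨j, rfl⟩ := ZMod.intCast_surjective j
    rw [← Int.cast_add, hξ, hξ, hξ, zpow_add]
  have hneg : ∀ i, ξ (-i) = (ξ i)⁻¹ := by
    intro i
    obtain ⟨i, rfl⟩ := ZMod.intCast_surjective i
    rw [← Int.cast_neg, hξ, hξ, zpow_neg]
  have hinj : ∀ i j, ξ i = ξ j → i = j := by
    intro i j h
    have := pow_injOn_Iio_orderOf (by simpa [hNx] using ZMod.val_lt i)
      (by simpa [hNx] using ZMod.val_lt j) h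
    exact ZMod.val_injective N this
  have hmem : ∀ i, ξ i ∈ zpowers x := fun i => pow_mem (mem_zpowers x) _
  have hsurj : ∀ h ∈ zpowers x, ∃ i, ξ i = h := by
    rintro _ ⟨z, rfl⟩
    exact ⟨z, hξ z⟩
  have hcomm : ∀ i, ξ i * y = y * ξ (-i) := by
    intro i
    rw [hneg]
    have : y * (ξ i)⁻¹ * y⁻¹ = ξ i := by
      simp only [ξ]
      rw [← inv_pow, ← conj_pow, ← conj_inv, hyx, inv_inv]
    nth_rw 1 [← this]
    group
  have hyy' : y * y = ξ ((2 ^ (k - 1) : ℕ) : ZMod N) := by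
    rw [← Int.cast_natCast, hξ, ← sq, hyy, zpow_natCast]
  let f : QuaternionGroup (2 ^ (k - 1)) → P := fun q => match q with
    | .a i => ξ i
    | .xa i => y * ξ i
  have hmul : ∀ u v, f (u * v) = f u * f v := by
    rintro (i | i) (j | j)
    · rw [QuaternionGroup.a_mul_a]; exact hadd i j
    · rw [QuaternionGroup.a_mul_xa]
      change y * ξ (j - i) = ξ i * (y * ξ j)
      rw [← mul_assoc, hcomm, mul_assoc, ← hadd, neg_add_eq_sub]
    · rw [QuaternionGroup.xa_mul_a]
      change y * ξ (i + j) = y * ξ i * ξ j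
      rw [hadd, mul_assoc]
    · rw [QuaternionGroup.xa_mul_xa]
      change ξ (((2 ^ (k - 1) : ℕ) : ZMod N) + j - i) = y * ξ i * (y * ξ j)
      rw [mul_assoc, ← mul_assoc (ξ i), hcomm, mul_assoc y (ξ (-i)), ← mul_assoc, hyy',
        ← hadd, ← hadd]
      congr 1; ring
  have hbij : Function.Bijective (MonoidHom.mk' f hmul) := by
    constructor
    · rintro (i | i) (j | j) h
      · exact congrArg _ (hinj i j h)
      · exact absurd ((mul_mem_cancel_right (hmem j)).1
          ((show ξ i = y * ξ j from h) ▸ hmem i)) hy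
      · exact absurd ((mul_mem_cancel_right (hmem i)).1
          ((show y * ξ i = ξ j from h) ▸ hmem j)) hy
      · exact congrArg _ (hinj i j (mul_left_cancel (show y * ξ i = y * ξ j from h)))
    · intro h
      by_cases hh : h ∈ zpowers x
      · obtain ⟨i, hi⟩ := hsurj h hh
        exact ⟨.a i, hi⟩
      · obtain ⟨i, hi⟩ := hsurj _ (hcov h hh)
        refine ⟨.xa i, ?_⟩
        change y * ξ i = h
        rw [hi]; group
  exact ⟨(MulEquiv.ofBijective _ hbij).symm⟩

/-- A finite `p`-group with a unique subgroup of order `p` is cyclic or generalized quaternion. -/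
theorem isCyclic_or_quaternionGroup {p : ℕ} [hp : Fact p.Prime] {P : Type*} [Group P] [Finite P]
    (hP : IsPGroup p P) (hU : UniqueOrder p P) :
    IsCyclic P ∨ ∃ m : ℕ, 1 ≤ m ∧ Nonempty (P ≃* QuaternionGroup (2 ^ m)) := by
  obtain ⟨A, hAn, hAc⟩ := exists_normal_centralizer_eq hP
  have hcomm : ∀ a ∈ A, ∀ b ∈ A, a * b = b * a := by
    intro a ha b hb
    rw [← hAc] at hb
    exact mem_centralizer_iff.1 hb a ha
  have hAcyc : IsCyclic A := by
    let _ : CommGroup A := { (inferInstance : Group A) with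
      mul_comm := fun a b => Subtype.ext (hcomm a a.2 b b.2) }
    exact isCyclic_of_uniqueOrder_of_comm (hP.to_subgroup A) (hU.subgroup A)
  obtain ⟨x, rfl⟩ := (Subgroup.isCyclic_iff_exists_zpowers_eq_top A).1 hAcyc
  by_cases htop : zpowers x = ⊤
  · left
    exact ⟨x, fun y => by
      change y ∈ zpowers x
      rw [htop]
      trivial⟩
  right
  obtain ⟨k, hk⟩ := (IsPGroup.iff_orderOf.1 hP) x
  have hdvd : ∀ z : ℤ, x ^ z = 1 ↔ (p : ℤ) ^ k ∣ z := by
    intro z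
    rw [← orderOf_dvd_iff_zpow_eq_one, hk]
    push_cast
    rfl
  have hcent : ∀ g, g * x * g⁻¹ = x → g ∈ zpowers x := by
    intro g hg
    rw [← hAc, mem_centralizer_iff]
    rintro _ ⟨z, rfl⟩
    have h1 : Commute g x := mul_inv_eq_iff_eq_mul.1 hg
    exact (h1.zpow_right z).symm.eq
  have hk1 : 1 ≤ k := by
    by_contra h
    obtain rfl : k = 0 := by omega
    rw [pow_zero, orderOf_eq_one_iff] at hk
    subst hk
    exact htop (eq_top_iff.2 fun g _ => hcent g (by group))
  have hact : ∀ g, ∃ r : ℤ, g * x * g⁻¹ = x ^ r := by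
    intro g
    obtain ⟨r, hr⟩ := hAn.conj_mem x (mem_zpowers x) g
    exact ⟨r, hr.symm⟩
  have hzx : ∃ z ∈ zpowers x, orderOf z = p := by
    have : Nontrivial (zpowers x) := ⟨⟨x, mem_zpowers x⟩, 1, by
      rw [Ne, Subtype.ext_iff]
      intro h
      have := (hdvd 1).1 (by simpa using h)
      have h2 := (dvd_pow_self (p : ℤ) (by omega : k ≠ 0)).trans this
      exact (Nat.prime_iff_prime_int.1 hp.out).not_dvd_one h2⟩
    obtain ⟨z, hz⟩ := exists_orderOf_eq_prime_of_nontrivial (hP.to_subgroup (zpowers x))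
    exact ⟨z, z.2, by rwa [← orderOf_coe] at hz⟩
  obtain ⟨z, hzA, hz⟩ := hzx
  have hcore : ∀ g, g ∉ zpowers x → g ^ p ∈ zpowers x →
      p = 2 ∧ g * x * g⁻¹ = x⁻¹ ∧ 2 ≤ k ∧ g ^ 2 = x ^ 2 ^ (k - 1) := by
    intro g hg hgp
    obtain ⟨r, hr⟩ := hact g
    obtain ⟨j, hj⟩ := hgp
    simp only at hj
    have hpow : ∀ (z : ℤ) (n : ℕ), g ^ n * x ^ z * (g ^ n)⁻¹ = x ^ (z * r ^ n) := by
      intro z n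
      induction n with
      | zero => simp
      | succ n ih =>
        have : g ^ (n + 1) * x ^ z * (g ^ (n + 1))⁻¹ = g * (g ^ n * x ^ z * (g ^ n)⁻¹) * g⁻¹ := by
          rw [pow_succ']; group
        rw [this, ih, ← conj_zpow, hr, ← zpow_mul, pow_succ]
        congr 1; ring
    have h1 : (p : ℤ) ^ k ∣ r ^ p - 1 := by
      rw [← hdvd, zpow_sub, zpow_one, mul_inv_eq_one]
      have := hpow 1 p
      rw [← hj, one_mul, zpow_one] at this
      rw [← this]
      group
    have h2 : (p : ℤ) ^ k ∣ j * (r - 1) := by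
      rw [mul_sub, mul_one, ← hdvd, zpow_sub, mul_inv_eq_one]
      have := hpow j 1
      rw [pow_one, pow_one, hj] at this
      rw [← this, hj, ← pow_succ', pow_succ]
      group
    have h3 : ¬ (p : ℤ) ^ k ∣ r - 1 := by
      rw [← hdvd, zpow_sub, zpow_one, mul_inv_eq_one, ← hr]
      exact fun h => hg (hcent g h)
    have h4 : ∀ s : ℤ, ¬ (p : ℤ) ^ k ∣ s * (∑ i ∈ Finset.range p, r ^ i) + j := by
      intro s hs
      rw [← hdvd, zpow_add, hj, ← mul_zpow_conj hr] at hs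
      have hne : x ^ s * g ∉ zpowers x := fun h =>
        hg ((mul_mem_cancel_left (zpow_mem (mem_zpowers x) s)).1 h)
      have ho : orderOf (x ^ s * g) = p :=
        orderOf_eq_prime hs fun h => hne (h ▸ one_mem _)
      exact hne (zpowers_le.2 hzA (hU z _ hz ho))
    obtain ⟨rfl, h5, h6, h7⟩ := exists_dvd_or_quaternion hp.out hk1 h1 h2 h3 h4
    refine ⟨rfl, ?_, h6, ?_⟩
    · rw [hr, ← mul_eq_one_iff_eq_inv, ← zpow_add_one, hdvd]
      exact h5
    · rw [← hj]
      have := (hdvd _).2 h7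
      rw [zpow_sub, mul_inv_eq_one] at this
      rw [this, ← zpow_natCast]
      push_cast
      rfl
  obtain ⟨g₀, hg₀⟩ : ∃ g, g ∉ zpowers x := by
    by_contra h
    push Not at h
    exact htop (eq_top_iff.2 fun g _ => h g)
  obtain ⟨n, hg, hgp⟩ := exists_notMem_pow_mem hP (zpowers x) hg₀
  obtain ⟨rfl, hgx, hk2, hgg⟩ := hcore _ hg hgp
  have hsq : ∀ h, h ∉ zpowers x → h ^ 2 ∈ zpowers x := by
    intro h hh
    obtain ⟨n, hn, hn2⟩ := exists_notMem_pow_mem hP (zpowers x) hh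
    rcases n with _ | n
    · simpa using hn2
    · exfalso
      obtain ⟨-, hx1, -⟩ := hcore _ hn hn2
      obtain ⟨r, hr⟩ := hact (h ^ 2 ^ n)
      rw [pow_succ, pow_mul] at hx1
      generalize h ^ 2 ^ n = u at hx1 hr
      have : u ^ 2 * x * (u ^ 2)⁻¹ = x ^ (r * r) := by
        rw [zpow_mul, ← hr, conj_zpow, ← hr, sq]; group
      rw [this, ← mul_eq_one_iff_eq_inv, ← zpow_add_one, hdvd] at hx1
      have h4 : (4 : ℤ) ∣ r * r + 1 := by
        refine Dvd.dvd.trans ?_ hx1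
        have := pow_dvd_pow (2 : ℤ) hk2
        exact_mod_cast this
      rcases Int.even_or_odd' r with ⟨c, rfl | rfl⟩
      · ring_nf at h4; omega
      · ring_nf at h4; omega
  refine ⟨k - 1, by omega, exists_mulEquiv_quaternionGroup hk2 hk hg hgx hgg ?_⟩
  intro h hh
  apply hcent
  obtain ⟨-, hhx, -⟩ := hcore h hh (hsq h hh)
  generalize g₀ ^ 2 ^ n = y at hg hgx
  have h1 : y⁻¹ * x⁻¹ * y = x := by
    rw [← hgx]; group
  calc y⁻¹ * h * x * (y⁻¹ * h)⁻¹ = y⁻¹ * (h * x * h⁻¹) * y := by group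
    _ = x := by rw [hhx, h1]

/-- In a finite cyclic group, every element killed by the order of `a` is a power of `a`. -/
lemma mem_zpowers_of_pow_orderOf {N : Type*} [Group N] [Finite N] [IsCyclic N] {a b : N}
    (h : b ^ orderOf a = 1) : b ∈ zpowers a := by
  classical
  have := Fintype.ofFinite N
  have hle := IsCyclic.card_pow_eq_one_le (α := N) (orderOf_pos a)
  have hsub : (Finset.univ.filter fun c : N => c ∈ zpowers a) ⊆
      Finset.univ.filter fun c : N => c ^ orderOf a = 1 := by
    intro c hc
    simp only [Finset.mem_filter, Finset.mem_univ, true_and] at hc ⊢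
    obtain ⟨z, rfl⟩ := hc
    simp only
    rw [← zpow_natCast, ← zpow_mul, mul_comm, zpow_mul, zpow_natCast, pow_orderOf_eq_one, one_zpow]
  have hcard : (Finset.univ.filter fun c : N => c ∈ zpowers a).card = orderOf a := by
    rw [← Nat.card_zpowers, Nat.card_eq_fintype_card, Fintype.card_subtype]
  have heq := Finset.eq_of_subset_of_card_le hsub (by rw [hcard]; exact hle)
  have : b ∈ Finset.univ.filter fun c : N => c ∈ zpowers a := by
    rw [heq]; simpa using h
  simpa using this

/-- If no Sylow subgroup of `G` is cyclic or generalized quaternion, then for every nontrivial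
cyclic subgroup `N` there is a subgroup of prime order, of order dividing that of `N`, that is not
contained in `N`. -/
theorem exists_prime_order_notMem {G : Type*} [Group G] [Finite G]
    (hSylow : ∀ (p : ℕ), p.Prime → p ∣ Nat.card G → ∀ P : Sylow p G,
      ¬ IsCyclic P ∧ ∀ n : ℕ, 1 ≤ n → IsEmpty (P ≃* QuaternionGroup (2 ^ n)))
    (N : Subgroup G) [hN : IsCyclic N] (hN1 : N ≠ ⊥) :
    ∃ (p : ℕ) (c : G), p.Prime ∧ p ∣ Nat.card N ∧ orderOf c = p ∧ c ∉ N := by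
  have hcard : Nat.card N ≠ 1 := by rwa [Ne, Subgroup.card_eq_one]
  obtain ⟨p, hp, hpN⟩ := Nat.exists_prime_and_dvd hcard
  have := Fact.mk hp
  by_contra hcon
  push Not at hcon
  have hmem : ∀ c : G, orderOf c = p → c ∈ N := fun c hc => hcon p c hp hpN hc
  have hU : UniqueOrder p G := by
    intro x y hx hy
    have hxN := hmem x hx
    have hyN := hmem y hy
    have h2 : (⟨y, hyN⟩ : N) ∈ zpowers (⟨x, hxN⟩ : N) := by
      apply mem_zpowers_of_pow_orderOf
      rw [orderOf_mk, hx, ← hy]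
      ext
      simp [pow_orderOf_eq_one]
    rw [mem_zpowers_iff] at h2 ⊢
    obtain ⟨k, hk⟩ := h2
    exact ⟨k, by simpa using congrArg Subtype.val hk⟩
  have P : Sylow p G := default
  obtain ⟨h1, h2⟩ := hSylow p hp (hpN.trans (Subgroup.card_subgroup_dvd_card N)) P
  rcases isCyclic_or_quaternionGroup P.isPGroup' (hU.subgroup P) with h | ⟨m, hm, ⟨e⟩⟩
  · exact h1 h
  · exact (h2 m hm).false e

lemma relIndex_sup_zpowers {G : Type*} [Group G] [Finite G] (N : Subgroup G) [N.Normal] {p : ℕ}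
    (hp : p.Prime) {c : G} (hc : orderOf c = p) (hcN : c ∉ N) :
    N.relIndex (zpowers c ⊔ N) = p := by
  rw [relIndex_sup_right]
  have h1 : N.relIndex (zpowers c) ∣ p := by
    have := Subgroup.relIndex_dvd_card N (zpowers c)
    rwa [Nat.card_zpowers, hc] at this
  refine ((Nat.dvd_prime hp).1 h1).resolve_left ?_
  rw [relIndex_eq_one, zpowers_le]
  exact hcN

lemma eq_of_isCyclic_of_le_sup {G : Type*} [Group G] [Finite G] (N : Subgroup G) [N.Normal] {p : ℕ}
    (hp : p.Prime) {c : G} (hc : orderOf c = p) (hcN : c ∉ N) (hpN : p ∣ Nat.card N)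
    (D : Subgroup G) [hD : IsCyclic D] (hDH : D ≤ zpowers c ⊔ N) (hND : N ≤ D) : D = N := by
  have h := relIndex_sup_zpowers N hp hc hcN
  have h1 := relIndex_mul_relIndex N D _ hND hDH
  rw [h] at h1
  rcases (Nat.dvd_prime hp).1 (Dvd.intro _ h1) with h2 | h2
  · exact le_antisymm (relIndex_eq_one.1 h2) hND
  · exfalso
    rw [h2, Nat.mul_eq_left hp.ne_zero, relIndex_eq_one] at h1
    have hcD : c ∈ D := h1 (mem_sup_left (mem_zpowers c))
    have := Fact.mk hp
    obtain ⟨⟨z, hz⟩, hzo⟩ := exists_prime_orderOf_dvd_card' p hpN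
    rw [orderOf_mk] at hzo
    have h3 : (⟨c, hcD⟩ : D) ∈ zpowers (⟨z, hND hz⟩ : D) := by
      apply mem_zpowers_of_pow_orderOf
      rw [orderOf_mk, hzo, ← hc]
      ext
      simp [pow_orderOf_eq_one]
    obtain ⟨k, hk⟩ := mem_zpowers_iff.1 h3
    have : z ^ k = c := by simpa using congrArg Subtype.val hk
    exact hcN (this ▸ zpow_mem hz k)

end GroupTheory

section Beurling

open Real Filter MeasureTheory Topology

/-- A nonnegative system of logarithms of norms, with finitely many values in bounded ranges. -/
structure LogSystem {I : Type*} (lam : I → ℝ) : Prop where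
  nonneg : ∀ i, 0 ≤ lam i
  fin : ∀ X : ℝ, {i | lam i ≤ X}.Finite

/-- The averaging operator `φ ↦ ∑ e^{-λ} φ(· + λ)`, acting on sequences of functions. -/
noncomputable def dirT {I : Type*} (lam : I → ℝ) (φ : ℕ → ℝ → ℝ) : ℕ → ℝ → ℝ :=
  fun j v => ∑' i, exp (-lam i) * φ j (v + lam i)

/-- A function together with its successive derivatives, vanishing beyond `β` and decaying
exponentially towards `-∞`. -/
structure Jet (β θ a : ℝ) (C : ℕ → ℝ) (φ : ℕ → ℝ → ℝ) : Prop where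
  deriv : ∀ j v, HasDerivAt (φ j) (φ (j + 1) v) v
  vanish : ∀ j v, β ≤ v → φ j v = 0
  bound : ∀ j v, v ≤ β → |φ j v| ≤ a * C j * exp (θ * (v - β))

lemma LogSystem.dirT_eq_sum {I : Type*} {lam : I → ℝ} (hl : LogSystem lam) {φ : ℕ → ℝ → ℝ} {β : ℝ}
    (hφ : ∀ j v, β ≤ v → φ j v = 0) {b v : ℝ} (hb : β - v ≤ b) (j : ℕ) :
    dirT lam φ j v = ∑ i ∈ (hl.fin b).toFinset, exp (-lam i) * φ j (v + lam i) := by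
  refine tsum_eq_sum fun i hi => ?_
  simp only [Set.Finite.mem_toFinset, Set.mem_ofPred_eq, not_le] at hi
  rw [hφ j _ (by linarith), mul_zero]

lemma LogSystem.dirT_vanish {I : Type*} {lam : I → ℝ} (hl : LogSystem lam) {φ : ℕ → ℝ → ℝ} {β : ℝ}
    (hφ : ∀ j v, β ≤ v → φ j v = 0) (j : ℕ) (v : ℝ) (hv : β ≤ v) : dirT lam φ j v = 0 := by
  have : ∀ i, exp (-lam i) * φ j (v + lam i) = 0 := fun i => by
    rw [hφ j _ (by linarith [hl.nonneg i]), mul_zero]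
  simp [dirT, this]

lemma LogSystem.dirT_hasDerivAt {I : Type*} {lam : I → ℝ} (hl : LogSystem lam) {φ : ℕ → ℝ → ℝ}
    {β : ℝ} (hφ : ∀ j v, β ≤ v → φ j v = 0) (hd : ∀ j v, HasDerivAt (φ j) (φ (j + 1) v) v)
    (j : ℕ) (v : ℝ) : HasDerivAt (dirT lam φ j) (dirT lam φ (j + 1) v) v := by
  rw [hl.dirT_eq_sum hφ (show β - v ≤ β - v + 1 by linarith)]
  have h1 : HasDerivAt (fun w => ∑ i ∈ (hl.fin (β - v + 1)).toFinset,
      exp (-lam i) * φ j (w + lam i))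
      (∑ i ∈ (hl.fin (β - v + 1)).toFinset, exp (-lam i) * φ (j + 1) (v + lam i)) v := by
    apply HasDerivAt.fun_sum
    intro i _
    exact ((hd j (v + lam i)).comp_add_const v (lam i)).const_mul _
  refine h1.congr_of_eventuallyEq ?_
  filter_upwards [eventually_ge_nhds (show v - 1 < v by linarith)] with w hw
  exact hl.dirT_eq_sum hφ (by linarith) j

lemma LogSystem.dirT_dirT {I J : Type*} {lam : I → ℝ} {mu : J → ℝ} (hl : LogSystem lam)
    (hm : LogSystem mu) {φ : ℕ → ℝ → ℝ} {β : ℝ} (hφ : ∀ j v, β ≤ v → φ j v = 0) :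
    dirT lam (dirT mu φ) = dirT (fun x : I × J => lam x.1 + mu x.2) φ := by
  ext j v
  rw [hl.dirT_eq_sum (hm.dirT_vanish hφ) le_rfl]
  have h1 : ∀ i ∈ (hl.fin (β - v)).toFinset, exp (-lam i) * dirT mu φ j (v + lam i) =
      ∑ k ∈ (hm.fin (β - v)).toFinset, exp (-(lam i + mu k)) * φ j (v + (lam i + mu k)) := by
    intro i _
    rw [hm.dirT_eq_sum hφ (b := β - v) (by linarith [hl.nonneg i]), Finset.mul_sum]
    refine Finset.sum_congr rfl fun k _ => ?_
    rw [← mul_assoc, ← exp_add, add_assoc]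
    congr 2; ring
  rw [Finset.sum_congr rfl h1, ← Finset.sum_product']
  refine (tsum_eq_sum fun x hx => ?_).symm
  simp only [Finset.mem_product, Set.Finite.mem_toFinset, Set.mem_ofPred_eq, not_and_or,
    not_le] at hx
  have h2 := hl.nonneg x.1
  have h3 := hm.nonneg x.2
  rw [hφ j _ (by rcases hx with h | h <;> linarith), mul_zero]

lemma dirT_equiv {I J : Type*} (e : I ≃ J) (mu : J → ℝ) (φ : ℕ → ℝ → ℝ) :
    dirT (fun i => mu (e i)) φ = dirT mu φ := by
  ext j v
  exact e.tsum_eq (fun i => exp (-mu i) * φ j (v + mu i))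

lemma LogSystem.pi {I : Type*} {lam : I → ℝ} (hl : LogSystem lam) (m : ℕ) :
    LogSystem (fun f : Fin m → I => ∑ k, lam (f k)) where
  nonneg f := Finset.sum_nonneg fun k _ => hl.nonneg _
  fin X := by
    refine (Set.Finite.pi' (fun _ : Fin m => hl.fin X)).subset fun f hf k => ?_
    have := Finset.single_le_sum (f := fun k => lam (f k)) (fun k _ => hl.nonneg (f k))
      (Finset.mem_univ k)
    exact this.trans hf

lemma LogSystem.iterate_vanish {I : Type*} {lam : I → ℝ} (hl : LogSystem lam) {φ : ℕ → ℝ → ℝ}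
    {β : ℝ} (hφ : ∀ j v, β ≤ v → φ j v = 0) (m : ℕ) :
    ∀ j v, β ≤ v → ((dirT lam)^[m] φ) j v = 0 := by
  induction m with
  | zero => exact hφ
  | succ m ih =>
    rw [Function.iterate_succ_apply']
    exact hl.dirT_vanish ih

lemma LogSystem.dirT_pi {I : Type*} {lam : I → ℝ} (hl : LogSystem lam) {φ : ℕ → ℝ → ℝ} {β : ℝ}
    (hφ : ∀ j v, β ≤ v → φ j v = 0) (m : ℕ) :
    dirT (fun f : Fin m → I => ∑ k, lam (f k)) φ = (dirT lam)^[m] φ := by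
  induction m with
  | zero =>
    ext j v
    simp [dirT]
  | succ m ih =>
    rw [Function.iterate_succ_apply', ← ih, hl.dirT_dirT (hl.pi m) hφ]
    rw [← dirT_equiv (Fin.consEquiv fun _ => I)]
    congr 1
    ext x
    simp [Fin.consEquiv, Fin.sum_univ_succ]

/-- The kernel `t ↦ t₊ ^ r / r!` of Riesz means. -/
noncomputable def rieszKer (r : ℕ) (t : ℝ) : ℝ := if 0 ≤ t then t ^ r / (r.factorial : ℝ) else 0

/-- The Riesz mean of order `r` of a counting function. -/
noncomputable def rieszSum {I : Type*} (lam : I → ℝ) (r : ℕ) (u : ℝ) : ℝ :=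
  ∑' i, rieszKer r (u - lam i)

/-- The operator `1 - d/dv` on jets. -/
def jetD (φ : ℕ → ℝ → ℝ) : ℕ → ℝ → ℝ := fun j v => φ j v - φ (j + 1) v

/-- The effect of `jetD` on bounds. -/
def bdD (C : ℕ → ℝ) : ℕ → ℝ := fun j => C j + C (j + 1)

lemma Jet.jetD {β θ a : ℝ} {C : ℕ → ℝ} {φ : ℕ → ℝ → ℝ} (h : Jet β θ a C φ) :
    Jet β θ a (bdD C) (jetD φ) where
  deriv j v := (h.deriv j v).sub (h.deriv (j + 1) v)
  vanish j v hv := by simp [_root_.jetD, h.vanish _ v hv]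
  bound j v hv := by
    have h1 := h.bound j v hv
    have h2 := h.bound (j + 1) v hv
    have h3 := abs_sub (φ j v) (φ (j + 1) v)
    simp only [_root_.jetD, bdD]
    linarith

lemma Jet.jetD_iter {β θ a : ℝ} {C : ℕ → ℝ} {φ : ℕ → ℝ → ℝ} (h : Jet β θ a C φ) (r : ℕ) :
    Jet β θ a (bdD^[r] C) (_root_.jetD^[r] φ) := by
  induction r with
  | zero => exact h
  | succ r ih => rw [Function.iterate_succ_apply', Function.iterate_succ_apply']; exact ih.jetD

lemma Jet.continuous {β θ a : ℝ} {C : ℕ → ℝ} {φ : ℕ → ℝ → ℝ} (h : Jet β θ a C φ) (j : ℕ) :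
    Continuous (φ j) :=
  continuous_iff_continuousAt.2 fun v => (h.deriv j v).continuousAt

lemma integrable_indicator_exp {θ : ℝ} (hθ : 0 < θ) (β : ℝ) :
    Integrable (Set.indicator (Set.Iic β) fun v => exp (θ * (v - β))) := by
  rw [integrable_indicator_iff measurableSet_Iic]
  have := (integrableOn_exp_mul_Iic hθ β).mul_const (exp (-(θ * β)))
  refine IntegrableOn.congr_fun this (fun v _ => ?_) measurableSet_Iic
  rw [← exp_add]; congr 1; ring

lemma integral_indicator_exp {θ : ℝ} (hθ : 0 < θ) (β : ℝ) :
    ∫ v, Set.indicator (Set.Iic β) (fun v => exp (θ * (v - β))) v = 1 / θ := by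
  rw [integral_indicator measurableSet_Iic]
  have h : ∀ v, exp (θ * (v - β)) = exp (θ * v) * exp (-(θ * β)) := fun v => by
    rw [← exp_add]; congr 1; ring
  simp_rw [h]
  rw [integral_mul_const, integral_exp_mul_Iic hθ, div_mul_eq_mul_div, ← exp_add]
  simp

lemma Jet.abs_le {β θ a : ℝ} {C : ℕ → ℝ} {φ : ℕ → ℝ → ℝ} (h : Jet β θ a C φ) (j : ℕ) (v : ℝ) :
    |φ j v| ≤ a * C j * Set.indicator (Set.Iic β) (fun v => exp (θ * (v - β))) v := by
  by_cases hv : v ≤ β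
  · rw [Set.indicator_of_mem (by exact hv)]
    exact h.bound j v hv
  · rw [Set.indicator_of_notMem (by exact hv), h.vanish j v (by linarith)]
    simp

lemma Jet.integrable {β θ a : ℝ} (hθ : 0 < θ) {C : ℕ → ℝ} {φ : ℕ → ℝ → ℝ} (h : Jet β θ a C φ)
    (j : ℕ) : Integrable (φ j) :=
  ((integrable_indicator_exp hθ β).const_mul (a * C j)).mono'
    (h.continuous j).aestronglyMeasurable (Eventually.of_forall fun v => h.abs_le j v)

lemma tendsto_exp_mul_sub_atBot {θ : ℝ} (hθ : 0 < θ) (β : ℝ) :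
    Tendsto (fun v => exp (θ * (v - β))) atBot (𝓝 0) := by
  refine tendsto_exp_atBot.comp (Tendsto.const_mul_atBot hθ ?_)
  exact tendsto_atBot_add_const_right _ _ tendsto_id

lemma Jet.tendsto_atBot {β θ a : ℝ} (hθ : 0 < θ) {C : ℕ → ℝ} {φ : ℕ → ℝ → ℝ} (h : Jet β θ a C φ)
    (j : ℕ) : Tendsto (φ j) atBot (𝓝 0) := by
  have h1 : Tendsto (fun v => a * C j * exp (θ * (v - β))) atBot (𝓝 0) := by
    simpa using (tendsto_exp_mul_sub_atBot hθ β).const_mul (a * C j)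
  refine squeeze_zero_norm' ?_ h1
  filter_upwards [eventually_le_atBot β] with v hv
  exact h.bound j v hv

lemma Jet.tendsto_atTop {β θ a : ℝ} {C : ℕ → ℝ} {φ : ℕ → ℝ → ℝ} (h : Jet β θ a C φ)
    (j : ℕ) : Tendsto (φ j) atTop (𝓝 0) := by
  refine tendsto_const_nhds.congr' ?_
  filter_upwards [eventually_ge_atTop β] with v hv
  exact (h.vanish j v hv).symm

lemma Jet.integral_succ {β θ a : ℝ} (hθ : 0 < θ) {C : ℕ → ℝ} {φ : ℕ → ℝ → ℝ} (h : Jet β θ a C φ)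
    (j : ℕ) : ∫ v, φ (j + 1) v = 0 := by
  rw [integral_of_hasDerivAt_of_tendsto (h.deriv j) (h.integrable hθ (j + 1))
    (h.tendsto_atBot hθ j) (h.tendsto_atTop j), sub_zero]

lemma Jet.integral_jetD_iter {β θ a : ℝ} (hθ : 0 < θ) {C : ℕ → ℝ} {φ : ℕ → ℝ → ℝ}
    (h : Jet β θ a C φ) (r j : ℕ) : ∫ v, (_root_.jetD^[r] φ) j v = ∫ v, φ j v := by
  induction r with
  | zero => rfl
  | succ r ih =>
    rw [Function.iterate_succ_apply', ← ih]
    have h1 := h.jetD_iter r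
    simp only [_root_.jetD]
    rw [integral_sub (h1.integrable hθ j) (h1.integrable hθ (j + 1)), h1.integral_succ hθ, sub_zero]

lemma Jet.intervalIntegral_kernel {β θ a : ℝ} {C : ℕ → ℝ} {φ : ℕ → ℝ → ℝ} (h : Jet β θ a C φ)
    (r j : ℕ) {l v b : ℝ} (hb : β - v ≤ b) :
    ∫ u in l..b, (u - l) ^ r / (r.factorial : ℝ) * (exp (-u) * (_root_.jetD^[r + 1] φ) j (v + u)) =
      exp (-l) * φ j (v + l) := by
  have hder : ∀ (s : ℕ) (u : ℝ), HasDerivAt (fun u => -(exp (-u) * (_root_.jetD^[s] φ) j (v + u)))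
      (exp (-u) * (_root_.jetD^[s + 1] φ) j (v + u)) u := by
    intro s u
    have h1 := (((h.jetD_iter s).deriv j (v + u)).comp_const_add v u)
    have h2 : HasDerivAt (fun u : ℝ => exp (-u)) (exp (-u) * -1) u := (hasDerivAt_neg u).exp
    have h3 := (h2.mul h1).neg
    refine h3.congr_deriv ?_
    rw [Function.iterate_succ_apply']
    simp only [_root_.jetD]
    ring
  have hcont : ∀ s : ℕ, Continuous fun u => exp (-u) * (_root_.jetD^[s] φ) j (v + u) := by
    intro s
    have := (h.jetD_iter s).continuous j
    fun_prop
  have hbz : ∀ s : ℕ, (_root_.jetD^[s] φ) j (v + b) = 0 := fun s =>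
    (h.jetD_iter s).vanish j _ (by linarith)
  induction r with
  | zero =>
    have h1 : ∀ u, (u - l) ^ 0 / ((0 : ℕ).factorial : ℝ) *
        (exp (-u) * (_root_.jetD^[0 + 1] φ) j (v + u)) =
        exp (-u) * (_root_.jetD^[0 + 1] φ) j (v + u) := by intro u; simp
    simp_rw [h1]
    rw [intervalIntegral.integral_eq_sub_of_hasDerivAt (fun u _ => hder 0 u)
      ((hcont 1).intervalIntegrable _ _), hbz]
    simp
  | succ r ih =>
    rw [← ih]
    have hk : ∀ u : ℝ, HasDerivAt (fun u => (u - l) ^ (r + 1) / ((r + 1).factorial : ℝ))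
        ((u - l) ^ r / (r.factorial : ℝ)) u := by
      intro u
      have h1 := ((hasDerivAt_id u).sub_const l).pow (r + 1)
      have h2 := h1.div_const ((r + 1).factorial : ℝ)
      refine h2.congr_deriv ?_
      rw [Nat.factorial_succ]
      push_cast
      have : (r.factorial : ℝ) ≠ 0 := by positivity
      have : (r : ℝ) + 1 ≠ 0 := by positivity
      field_simp
      simp
    rw [intervalIntegral.integral_mul_deriv_eq_deriv_mul (fun u _ => hk u)
      (fun u _ => hder (r + 1) u) (by apply Continuous.intervalIntegrable; fun_prop)
      ((hcont _).intervalIntegrable _ _), hbz]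
    simp only [mul_neg, sub_self, mul_zero, neg_zero, ne_eq, Nat.add_eq_zero_iff, one_ne_zero,
      and_false, not_false_eq_true, zero_pow, zero_div, zero_mul, zero_sub]
    rw [intervalIntegral.integral_neg]
    ring

lemma Jet.kernel_eq_indicator {β θ a : ℝ} {C : ℕ → ℝ} {φ : ℕ → ℝ → ℝ} (h : Jet β θ a C φ)
    (r j s : ℕ) {l v b : ℝ} (hb : β - v ≤ b) :
    (fun u => rieszKer r (u - l) * (exp (-u) * (_root_.jetD^[s] φ) j (v + u))) =ᵐ[volume]
    Set.indicator (Set.Ioc l b)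
      fun u => (u - l) ^ r / (r.factorial : ℝ) * (exp (-u) * (_root_.jetD^[s] φ) j (v + u)) := by
  have : ∀ᵐ u : ℝ, u ≠ l := by
    simp [ae_iff, measure_singleton]
  filter_upwards [this] with u hu
  by_cases h1 : l < u
  · by_cases h2 : u ≤ b
    · rw [Set.indicator_of_mem (by exact ⟨h1, h2⟩), rieszKer, if_pos (by linarith)]
    · rw [Set.indicator_of_notMem (by rintro ⟨-, h⟩; exact h2 h),
        (h.jetD_iter s).vanish j _ (by linarith), mul_zero, mul_zero]
  · rw [Set.indicator_of_notMem (by rintro ⟨h, -⟩; exact h1 h), rieszKer,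
      if_neg (by rw [not_le, sub_neg]; exact lt_of_le_of_ne (not_lt.1 h1) hu), zero_mul]

lemma Jet.integrable_kernel {β θ a : ℝ} {C : ℕ → ℝ} {φ : ℕ → ℝ → ℝ} (h : Jet β θ a C φ)
    (r j s : ℕ) (l v : ℝ) :
    Integrable fun u => rieszKer r (u - l) * (exp (-u) * (_root_.jetD^[s] φ) j (v + u)) := by
  rw [integrable_congr (h.kernel_eq_indicator r j s (l := l) (v := v) le_rfl),
    integrable_indicator_iff measurableSet_Ioc]
  have := (h.jetD_iter s).continuous j
  have h2 : Continuous fun u => (u - l) ^ r / (r.factorial : ℝ) *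
    (exp (-u) * (_root_.jetD^[s] φ) j (v + u)) := by fun_prop
  exact h2.integrableOn_Ioc

lemma Jet.integral_kernel {β θ a : ℝ} {C : ℕ → ℝ} {φ : ℕ → ℝ → ℝ} (h : Jet β θ a C φ)
    (r j : ℕ) (l v : ℝ) :
    ∫ u, rieszKer r (u - l) * (exp (-u) * (_root_.jetD^[r + 1] φ) j (v + u)) =
      exp (-l) * φ j (v + l) := by
  rw [← h.intervalIntegral_kernel r j (le_max_left (β - v) l),
    integral_congr_ae (h.kernel_eq_indicator r j (r + 1) (le_max_left (β - v) l)),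
    integral_indicator measurableSet_Ioc, intervalIntegral.integral_of_le (le_max_right _ _)]

/-- Asymptotics with power saving for Riesz means. -/
def RieszAsymp {I : Type*} (lam : I → ℝ) (r : ℕ) (κ Q θ : ℝ) : Prop :=
  ∀ u, |rieszSum lam r u - κ * exp u| ≤ κ * Q * exp ((1 - θ) * u)

lemma Jet.dirT_eq_integral {I : Type*} {lam : I → ℝ} (hl : LogSystem lam) {β θ a : ℝ} {C : ℕ → ℝ}
    {φ : ℕ → ℝ → ℝ} (h : Jet β θ a C φ) (r j : ℕ) (v : ℝ) :
    Integrable (fun u => rieszSum lam r u * (exp (-u) * (_root_.jetD^[r + 1] φ) j (v + u))) ∧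
    ∫ u, rieszSum lam r u * (exp (-u) * (_root_.jetD^[r + 1] φ) j (v + u)) = dirT lam φ j v := by
  have heq : (fun u => rieszSum lam r u * (exp (-u) * (_root_.jetD^[r + 1] φ) j (v + u))) =
      fun u => ∑ i ∈ (hl.fin (β - v)).toFinset,
        rieszKer r (u - lam i) * (exp (-u) * (_root_.jetD^[r + 1] φ) j (v + u)) := by
    ext u
    by_cases hu : u < β - v
    · rw [← Finset.sum_mul]
      congr 1
      refine tsum_eq_sum fun i hi => ?_
      simp only [Set.Finite.mem_toFinset, Set.mem_ofPred_eq, not_le] at hi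
      exact if_neg (by linarith)
    · simp [(h.jetD_iter (r + 1)).vanish j (v + u) (by linarith)]
  rw [heq]
  have hI := fun i (_ : i ∈ (hl.fin (β - v)).toFinset) =>
    h.integrable_kernel r j (r + 1) (lam i) v
  refine ⟨integrable_finsetSum _ hI, ?_⟩
  rw [integral_finsetSum _ hI, hl.dirT_eq_sum h.vanish le_rfl]
  exact Finset.sum_congr rfl fun i _ => h.integral_kernel r j (lam i) v

lemma Jet.dirT_asymp {I : Type*} {lam : I → ℝ} (hl : LogSystem lam) {β θ₁ θ₂ a : ℝ} {C : ℕ → ℝ}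
    {φ : ℕ → ℝ → ℝ} (h : Jet β θ₁ a C φ) (h2 : 0 < θ₂) (h12 : θ₂ < θ₁) {r : ℕ} {κ Q : ℝ}
    (hS : RieszAsymp lam r κ Q θ₂) (hQ : 0 ≤ κ * Q) (j : ℕ) {v : ℝ} :
    |dirT lam φ j v - κ * ∫ w, φ j w| ≤
      κ * Q * a * ((bdD^[r + 1] C) j / (θ₁ - θ₂)) * exp (θ₂ * (v - β)) := by
  obtain ⟨hi, he⟩ := h.dirT_eq_integral hl r j v
  have hJ := h.jetD_iter (r + 1)
  have hθ₁ : 0 < θ₁ := h2.trans h12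
  have hmain : ∫ u, κ * exp u * (exp (-u) * (_root_.jetD^[r + 1] φ) j (v + u)) =
      κ * ∫ w, φ j w := by
    rw [← h.integral_jetD_iter hθ₁ (r + 1) j,
      ← integral_add_left_eq_self (fun u => (_root_.jetD^[r + 1] φ) j u) v, ← integral_const_mul]
    congr 1
    ext u
    rw [mul_assoc, ← mul_assoc (exp u), ← exp_add, add_neg_cancel, exp_zero, one_mul]
  have hmi : Integrable fun u => κ * exp u * (exp (-u) * (_root_.jetD^[r + 1] φ) j (v + u)) := by
    have := ((hJ.integrable hθ₁ j).comp_add_left v).const_mul κ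
    refine this.congr (Eventually.of_forall fun u => ?_)
    simp only
    rw [mul_assoc κ, ← mul_assoc (exp u), ← exp_add, add_neg_cancel, exp_zero, one_mul]
  rw [← he, ← hmain, ← integral_sub hi hmi]
  set B := (bdD^[r + 1] C) j with hB
  have hind := (integrable_indicator_exp (sub_pos.2 h12) (β - v)).const_mul
    (κ * Q * (a * B * exp (θ₂ * (v - β))))
  have hbd : ∀ u, ‖rieszSum lam r u * (exp (-u) * (_root_.jetD^[r + 1] φ) j (v + u)) -
      κ * exp u * (exp (-u) * (_root_.jetD^[r + 1] φ) j (v + u))‖ ≤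
      κ * Q * (a * B * exp (θ₂ * (v - β))) *
        Set.indicator (Set.Iic (β - v)) (fun u => exp ((θ₁ - θ₂) * (u - (β - v)))) u := by
    intro u
    by_cases hu : u ≤ β - v
    · rw [Set.indicator_of_mem (by exact hu), ← sub_mul, norm_mul, norm_mul, Real.norm_eq_abs,
        Real.norm_eq_abs, Real.norm_eq_abs, abs_of_pos (exp_pos _)]
      have h3 := hJ.bound j (v + u) (by linarith)
      calc _ ≤ (κ * Q * exp ((1 - θ₂) * u)) * (exp (-u) * (a * B * exp (θ₁ * (v + u - β)))) := by
            apply mul_le_mul (hS u) _ (by positivity) (by positivity)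
            exact mul_le_mul_of_nonneg_left h3 (exp_pos _).le
        _ = κ * Q * (a * B) * (exp ((1 - θ₂) * u) * exp (-u) * exp (θ₁ * (v + u - β))) := by ring
        _ = κ * Q * (a * B) * (exp (θ₂ * (v - β)) * exp ((θ₁ - θ₂) * (u - (β - v)))) := by
            congr 1
            rw [← exp_add, ← exp_add, ← exp_add]
            congr 1; ring
        _ = _ := by ring
    · rw [hJ.vanish j _ (by linarith), Set.indicator_of_notMem (by exact hu)]
      simp
  have := norm_integral_le_of_norm_le hind (Eventually.of_forall hbd)
  rw [integral_const_mul, integral_indicator_exp (sub_pos.2 h12)] at this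
  refine this.trans (le_of_eq ?_)
  ring

/-- One step of the iteration: apply the operator and differentiate. -/
lemma Jet.step {I : Type*} {lam : I → ℝ} (hl : LogSystem lam) {β θ₁ θ₂ a : ℝ} {C : ℕ → ℝ}
    {φ : ℕ → ℝ → ℝ} (h : Jet β θ₁ a C φ) (h2 : 0 < θ₂) (h12 : θ₂ < θ₁) {r : ℕ} {κ Q : ℝ}
    (hS : RieszAsymp lam r κ Q θ₂) (hQ : 0 ≤ κ * Q) :
    Jet β θ₂ (κ * Q * a) (fun j => (bdD^[r + 1] C) (j + 1) / (θ₁ - θ₂))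
      (fun j => dirT lam φ (j + 1)) ∧
    ∫ v, dirT lam φ 1 v = -κ * ∫ v, φ 0 v := by
  have hder := hl.dirT_hasDerivAt h.vanish h.deriv
  have hθ₁ : 0 < θ₁ := h2.trans h12
  have hJ : Jet β θ₂ (κ * Q * a) (fun j => (bdD^[r + 1] C) (j + 1) / (θ₁ - θ₂))
      (fun j => dirT lam φ (j + 1)) := by
    refine ⟨fun j => hder (j + 1), fun j => hl.dirT_vanish h.vanish (j + 1), fun j v hv => ?_⟩
    have := h.dirT_asymp hl h2 h12 hS hQ (j + 1) (v := v)
    rwa [h.integral_succ hθ₁, mul_zero, sub_zero] at this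
  refine ⟨hJ, ?_⟩
  have hbot : Tendsto (dirT lam φ 0) atBot (𝓝 (κ * ∫ v, φ 0 v)) := by
    rw [← tendsto_sub_nhds_zero_iff]
    refine squeeze_zero_norm (fun v => h.dirT_asymp hl h2 h12 hS hQ 0) ?_
    simpa using (tendsto_exp_mul_sub_atBot h2 β).const_mul
      (κ * Q * a * ((bdD^[r + 1] C) 0 / (θ₁ - θ₂)))
  have htop : Tendsto (dirT lam φ 0) atTop (𝓝 0) := by
    refine tendsto_const_nhds.congr' ?_
    filter_upwards [eventually_ge_atTop β] with v hv
    exact (hl.dirT_vanish h.vanish 0 v hv).symm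
  rw [integral_of_hasDerivAt_of_tendsto (hder 0) (hJ.integrable h2 0) hbot htop]
  ring

lemma RieszAsymp.mono {I : Type*} {lam : I → ℝ} (hl : LogSystem lam) {r : ℕ} {κ Q θ θ' : ℝ}
    (h : RieszAsymp lam r κ Q θ) (hκ : 0 ≤ κ) (hQ : 1 ≤ Q) (h0 : 0 ≤ θ') (hθ : θ' ≤ θ) :
    RieszAsymp lam r κ Q θ' := by
  intro u
  rcases le_or_gt 0 u with hu | hu
  · refine (h u).trans (mul_le_mul_of_nonneg_left (exp_le_exp.2 ?_) (by positivity))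
    nlinarith
  · have : rieszSum lam r u = 0 := by
      have : ∀ i, rieszKer r (u - lam i) = 0 := fun i => if_neg (by linarith [hl.nonneg i])
      simp [rieszSum, this]
    rw [this, zero_sub, abs_neg, abs_of_nonneg (by positivity), mul_assoc]
    refine mul_le_mul_of_nonneg_left ?_ hκ
    have : exp u ≤ exp ((1 - θ') * u) := exp_le_exp.2 (by nlinarith)
    nlinarith [exp_pos ((1 - θ') * u)]

lemma exists_iterate_jet (τ : ℕ → ℝ) (hτ0 : ∀ i, 0 < τ i) (hτ : ∀ i, τ (i + 1) < τ i) (r : ℕ)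
    (C : ℕ → ℝ) (m : ℕ) : ∃ C' : ℕ → ℝ, ∀ (I : Type) (lam : I → ℝ) (_ : LogSystem lam)
      (κ Q : ℝ) (_ : 0 ≤ κ * Q) (_ : ∀ i, RieszAsymp lam r κ Q (τ i)) (β : ℝ) (ψ : ℕ → ℝ → ℝ)
      (_ : Jet β (τ 0) 1 C ψ),
      Jet β (τ m) ((κ * Q) ^ m) C' (fun j => ((dirT lam)^[m] ψ) (j + m)) ∧
      ∫ v, ((dirT lam)^[m] ψ) m v = (-κ) ^ m * ∫ v, ψ 0 v := by
  induction m with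
  | zero =>
    refine ⟨C, fun I lam hl κ Q hQ hS β ψ hψ => ⟨by simpa using hψ, by simp⟩⟩
  | succ m ih =>
    obtain ⟨C', ih⟩ := ih
    refine ⟨fun j => (bdD^[r + 1] C') (j + 1) / (τ m - τ (m + 1)),
      fun I lam hl κ Q hQ hS β ψ hψ => ?_⟩
    obtain ⟨h1, h2⟩ := ih I lam hl κ Q hQ hS β ψ hψ
    obtain ⟨h3, h4⟩ := h1.step hl (hτ0 (m + 1)) (hτ m) (hS (m + 1)) hQ
    have h5 : ∀ j, dirT lam (fun j => ((dirT lam)^[m] ψ) (j + m)) (j + 1) =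
        ((dirT lam)^[m + 1] ψ) (j + (m + 1)) := by
      intro j
      rw [Function.iterate_succ_apply']
      ext v
      simp only [dirT]
      rw [show j + 1 + m = j + (m + 1) by ring]
    simp only [h5] at h3
    refine ⟨by rw [pow_succ']; exact h3, ?_⟩
    have h6 := h5 0
    rw [zero_add, zero_add] at h6
    rw [← h6, h4]
    simp only [zero_add]
    rw [h2, pow_succ']
    ring

/-- The value of the `p`-fold iterate on the `(p-1)`-st derivative. -/
lemma exists_iterate_asymp {θ : ℝ} (hθ : 0 < θ) (r : ℕ) (C : ℕ → ℝ) (m : ℕ) :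
    ∃ A : ℝ, 0 ≤ A ∧ ∀ (I : Type) (lam : I → ℝ) (_ : LogSystem lam) (κ Q : ℝ)
      (_ : 0 ≤ κ) (_ : 1 ≤ Q) (_ : RieszAsymp lam r κ Q θ) (β : ℝ) (ψ : ℕ → ℝ → ℝ)
      (_ : Jet β θ 1 C ψ) (v : ℝ) (_ : v ≤ β),
      |((dirT lam)^[m + 1] ψ) m v - κ * ((-κ) ^ m * ∫ w, ψ 0 w)| ≤
        (κ * Q) ^ (m + 1) * A * exp (θ / 2 * (v - β)) := by
  set τ : ℕ → ℝ := fun i => θ * (1 / 2 + 1 / (2 * (i + 1))) with hτdef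
  have hτ0 : ∀ i, 0 < τ i := fun i => by positivity
  have hτ : ∀ i, τ (i + 1) < τ i := fun i => by
    simp only [hτdef]
    push_cast
    gcongr
    linarith
  have hτθ : ∀ i, τ i ≤ θ := by
    intro i
    have : 1 / (2 * ((i : ℝ) + 1)) ≤ 1 / 2 := by
      apply one_div_le_one_div_of_le (by norm_num)
      have : (0 : ℝ) ≤ i := Nat.cast_nonneg i
      linarith
    simp only [hτdef]
    nlinarith
  have hτz : τ 0 = θ := by simp [hτdef]; norm_num
  have hτh : ∀ i, θ / 2 ≤ τ i := by
    intro i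
    have : 0 ≤ 1 / (2 * ((i : ℝ) + 1)) := by positivity
    simp only [hτdef]
    nlinarith
  obtain ⟨C', h⟩ := exists_iterate_jet τ hτ0 hτ r C m
  set A := (bdD^[r + 1] C') 0 / (τ m - τ (m + 1))
  refine ⟨|A|, abs_nonneg _, fun I lam hl κ Q hκ hQ hS β ψ hψ v hv => ?_⟩
  have hS' : ∀ i, RieszAsymp lam r κ Q (τ i) := fun i => hS.mono hl hκ hQ (hτ0 i).le (hτθ i)
  have hκQ : 0 ≤ κ * Q := by positivity
  obtain ⟨h1, h2⟩ := h I lam hl κ Q hκQ hS' β ψ (by rwa [hτz])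
  have h3 := h1.dirT_asymp hl (hτ0 (m + 1)) (hτ m) (hS' (m + 1)) hκQ 0 (v := v)
  simp only [zero_add] at h3
  rw [h2] at h3
  have h5 : dirT lam (fun j => ((dirT lam)^[m] ψ) (j + m)) 0 v = ((dirT lam)^[m + 1] ψ) m v := by
    rw [Function.iterate_succ_apply']
    simp only [dirT, zero_add]
  rw [h5] at h3
  refine h3.trans ?_
  rw [pow_succ']
  apply mul_le_mul _ (exp_le_exp.2 _) (exp_pos _).le (by positivity)
  · exact mul_le_mul_of_nonneg_left (le_abs_self A) (by positivity)
  · have := hτh (m + 1)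
    nlinarith

/-- A fixed nonnegative bump jet. -/
lemma exists_bump : ∃ (ψ : ℕ → ℝ → ℝ) (C : ℕ → ℝ), 0 < ∫ v, ψ 0 v ∧
    ∀ θ : ℝ, 0 ≤ θ → θ ≤ 1 → Jet 0 θ 1 C ψ := by
  let f : ContDiffBump (-1 : ℝ) := ⟨1 / 4, 1 / 2, by norm_num, by norm_num⟩
  have hf' : ∀ n : ℕ, ContDiff ℝ n (f : ℝ → ℝ) := fun n => f.contDiff
  have hsupp : ∀ j : ℕ, tsupport (iteratedDeriv j (f : ℝ → ℝ)) ⊆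
      Metric.closedBall (-1) (1 / 2) := by
    intro j
    rw [← f.tsupport_eq]
    refine closure_minimal (fun x hx => ?_) (isClosed_tsupport _)
    refine support_iteratedFDeriv_subset (𝕜 := ℝ) (f := (f : ℝ → ℝ)) j fun h => hx ?_
    rw [iteratedDeriv_eq_iteratedFDeriv, h]
    rfl
  have hz : ∀ (j : ℕ) v, v ∉ Metric.closedBall (-1 : ℝ) (1 / 2) →
      iteratedDeriv j (f : ℝ → ℝ) v = 0 :=
    fun j v hv => image_eq_zero_of_notMem_tsupport fun h => hv (hsupp j h)
  have hcont : ∀ j : ℕ, Continuous (iteratedDeriv j (f : ℝ → ℝ)) := fun j =>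
    (hf' j).continuous_iteratedDeriv j le_rfl
  have hbd : ∀ j : ℕ, ∃ C, ∀ v, ‖iteratedDeriv j (f : ℝ → ℝ) v‖ ≤ C := by
    intro j
    apply HasCompactSupport.exists_bound_of_continuous _ (hcont j)
    exact (isCompact_closedBall _ _).of_isClosed_subset (isClosed_tsupport _) (hsupp j)
  choose C hC using hbd
  refine ⟨fun j => iteratedDeriv j f, fun j => C j * exp 2, ?_, ?_⟩
  · simp only [iteratedDeriv_zero]
    exact f.integral_pos
  · intro θ h0 h1
    refine ⟨fun j v => ?_, fun j v hv => ?_, fun j v hv => ?_⟩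
    · have := ((hf' (j + 1)).differentiable_iteratedDeriv j
        (by exact_mod_cast Nat.lt_succ_self j)) v
      simpa [iteratedDeriv_succ] using this.hasDerivAt
    · apply hz
      rw [Metric.mem_closedBall, Real.dist_eq, abs_le]
      intro h
      linarith [h.2]
    · by_cases hv2 : v ∈ Metric.closedBall (-1 : ℝ) (1 / 2)
      · rw [Metric.mem_closedBall, Real.dist_eq, abs_le] at hv2
        have h3 := hC j v
        have h4 : 1 ≤ exp 2 * exp (θ * (v - 0)) := by
          rw [← exp_add]
          apply one_le_exp
          nlinarith [hv2.1, hv2.2]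
        have h5 : 0 ≤ C j := (norm_nonneg _).trans h3
        rw [← Real.norm_eq_abs]
        calc _ ≤ C j * 1 := by rw [mul_one]; exact h3
          _ ≤ C j * (exp 2 * exp (θ * (v - 0))) := mul_le_mul_of_nonneg_left h4 h5
          _ = _ := by ring
      · rw [hz j v hv2, abs_zero]
        have : 0 ≤ C j := (norm_nonneg _).trans (hC j 0)
        positivity

lemma Jet.translate {θ a : ℝ} {C : ℕ → ℝ} {φ : ℕ → ℝ → ℝ} (h : Jet 0 θ a C φ) (β : ℝ) :
    Jet β θ a C (fun j v => φ j (v - β)) where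
  deriv j v := (h.deriv j (v - β)).comp_sub_const v β
  vanish j v hv := h.vanish j _ (by linarith)
  bound j v hv := by simpa using h.bound j (v - β) (by linarith)

/-- The truncated Dirichlet sum `∑_{λ ≤ β} e^{-s λ}`. -/
noncomputable def truncSum {I : Type*} {lam : I → ℝ} (hl : LogSystem lam) (s β : ℝ) : ℝ :=
  ∑ i ∈ (hl.fin β).toFinset, exp (-(s * lam i))

lemma truncSum_le_of_injective {I J : Type*} {lam : I → ℝ} {mu : J → ℝ} (hl : LogSystem lam)
    (hm : LogSystem mu) {ι : I → J} (hι : Function.Injective ι) (h : ∀ i, mu (ι i) ≤ lam i)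
    {s : ℝ} (hs : 0 ≤ s) (β : ℝ) : truncSum hl s β ≤ truncSum hm s β := by
  classical
  have h1 : (hl.fin β).toFinset.image ι ⊆ (hm.fin β).toFinset := by
    intro j hj
    obtain ⟨i, hi, rfl⟩ := Finset.mem_image.1 hj
    simp only [Set.Finite.mem_toFinset, Set.mem_ofPred_eq] at hi ⊢
    exact (h i).trans hi
  calc truncSum hl s β ≤ ∑ i ∈ (hl.fin β).toFinset, exp (-(s * mu (ι i))) :=
        Finset.sum_le_sum fun i _ => exp_le_exp.2 (by nlinarith [h i])
    _ = ∑ j ∈ (hl.fin β).toFinset.image ι, exp (-(s * mu j)) := by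
        rw [Finset.sum_image fun a _ b _ hab => hι hab]
    _ ≤ _ := Finset.sum_le_sum_of_subset_of_nonneg h1 fun _ _ _ => (exp_pos _).le

lemma truncSum_pi_le {I : Type*} {lam : I → ℝ} (hl : LogSystem lam) (p : ℕ) (s β : ℝ) :
    truncSum (hl.pi p) s β ≤ truncSum hl s β ^ p := by
  classical
  have h1 : truncSum hl s β ^ p = ∑ f ∈ Fintype.piFinset (fun _ : Fin p => (hl.fin β).toFinset),
      exp (-(s * ∑ k, lam (f k))) := by
    have : truncSum hl s β ^ p =
        ∏ k : Fin p, ∑ i ∈ (hl.fin β).toFinset, exp (-(s * lam i)) := by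
      simp [truncSum]
    rw [this, Finset.prod_univ_sum]
    refine Finset.sum_congr rfl fun f _ => ?_
    rw [← exp_sum, Finset.mul_sum, Finset.sum_neg_distrib]
  rw [h1]
  refine Finset.sum_le_sum_of_subset_of_nonneg (fun f hf => ?_) fun _ _ _ => (exp_pos _).le
  simp only [Set.Finite.mem_toFinset, Set.mem_ofPred_eq] at hf
  simp only [Fintype.mem_piFinset, Set.Finite.mem_toFinset, Set.mem_ofPred_eq]
  intro k
  exact (Finset.single_le_sum (f := fun k => lam (f k)) (fun k _ => hl.nonneg (f k))
    (Finset.mem_univ k)).trans hf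

/-- A system dominated pointwise yields a bound of its average. -/
lemma LogSystem.abs_dirT_sub_le {I : Type*} {lam : I → ℝ} (hl : LogSystem lam) {φ : ℕ → ℝ → ℝ}
    {β : ℝ} (hφ : ∀ j v, β ≤ v → φ j v = 0) (j : ℕ) {c B s : ℝ}
    (hb : ∀ v, v ≤ β → |φ j v - c| ≤ B * exp (s * (v - β))) :
    |dirT lam φ j 0 - c * truncSum hl 1 β| ≤ B * exp (-(s * β)) * truncSum hl (1 - s) β := by
  rw [hl.dirT_eq_sum hφ (b := β) (by simp), truncSum, truncSum, Finset.mul_sum, Finset.mul_sum,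
    ← Finset.sum_sub_distrib]
  refine (Finset.abs_sum_le_sum_abs _ _).trans (Finset.sum_le_sum fun i hi => ?_)
  simp only [Set.Finite.mem_toFinset, Set.mem_ofPred_eq] at hi
  rw [one_mul, show exp (-lam i) * φ j (0 + lam i) - c * exp (-lam i) =
    exp (-lam i) * (φ j (lam i) - c) by rw [zero_add]; ring, abs_mul, abs_of_pos (exp_pos _)]
  refine (mul_le_mul_of_nonneg_left (hb _ hi) (exp_pos _).le).trans (le_of_eq ?_)
  rw [mul_left_comm, ← exp_add, mul_assoc, ← exp_add]
  congr 2
  ring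

/-- Comparison of two factorisations of the same arithmetic system. -/
theorem beurling {θ : ℝ} (hθ : 0 < θ) (hθ1 : θ ≤ 1) (m : ℕ) (hm : 1 ≤ m) (rL rE : ℕ) :
    ∃ C : ℝ, 0 < C ∧ ∀ (IL IE IU IU' : Type) (lamL : IL → ℝ) (lamE : IE → ℝ) (lamU : IU → ℝ)
      (lamU' : IU' → ℝ) (_ : LogSystem lamL) (_ : LogSystem lamE) (hU : LogSystem lamU)
      (_ : LogSystem lamU') (κL κE Q : ℝ) (_ : 0 < κL) (_ : 0 < κE) (_ : 1 ≤ Q)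
      (_ : RieszAsymp lamL rL κL Q θ) (_ : RieszAsymp lamE rE κE Q θ)
      (e : ((Fin (m + 1) → IU) × IE) ≃ (IU' × (Fin (m + 1) → IL)))
      (_ : ∀ x, lamU' (e x).1 + ∑ k, lamL ((e x).2 k) = ∑ k, lamU (x.1 k) + lamE x.2)
      (ι : IU' → IU) (_ : Function.Injective ι) (_ : ∀ i, lamU (ι i) ≤ lamU' i)
      (i0 : IU') (_ : lamU' i0 = 0) (β : ℝ) (_ : 0 ≤ β),
      κL ^ (m + 1) ≤ C * Q ^ (m + 1) * exp (-(θ / 2 * β)) *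
        (κL ^ (m + 1) * truncSum hU (1 - θ / 2) β +
          κE * truncSum hU (1 - θ / 2) β ^ (m + 1)) := by
  obtain ⟨ψ₀, C, hJ, hψ₀⟩ := exists_bump
  obtain ⟨A, hA, hAL⟩ := exists_iterate_asymp hθ rL C m
  set A' := (bdD^[rE + 1] C) m / (θ - θ / 2)
  set J := ∫ v, ψ₀ 0 v
  refine ⟨(A + |A'| + 1) / J, by positivity, ?_⟩
  intro IL IE IU IU' lamL lamE lamU lamU' hL hE hU hU' κL κE Q hκL hκE hQ hSL hSE e he ι hι hιl
    i0 hi0 β hβ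
  set ψ : ℕ → ℝ → ℝ := fun j v => ψ₀ j (v - β) with hψdef
  have hψ : Jet β θ 1 C ψ := (hψ₀ θ hθ.le hθ1).translate β
  have hψJ : ∫ v, ψ 0 v = J := integral_sub_right_eq_self (ψ₀ 0) β
  set Θ := truncSum hU (1 - θ / 2) β
  have hv := hψ.vanish
  have hkey : dirT lamU' ((dirT lamL)^[m + 1] ψ) m 0 =
      dirT (fun f : Fin (m + 1) → IU => ∑ k, lamU (f k)) (dirT lamE ψ) m 0 := by
    rw [← hL.dirT_pi hv, hU'.dirT_dirT (hL.pi _) hv, (hU.pi _).dirT_dirT hE hv, ← dirT_equiv e]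
    simp only [he]
  have h1 := hU'.abs_dirT_sub_le (hL.iterate_vanish hv (m + 1)) m
    (fun v hv => hAL IL lamL hL κL Q hκL.le hQ hSL β ψ hψ v hv)
  have h2 := (hU.pi (m + 1)).abs_dirT_sub_le (hE.dirT_vanish hv) m (c := 0) (s := θ / 2)
    (B := κE * Q * |A'|) (β := β) (fun v _ => by
      have h3 := hψ.dirT_asymp hE (half_pos hθ) (by linarith : θ / 2 < θ)
        (hSE.mono hE hκE.le hQ (by linarith) (by linarith)) (by positivity) m (v := v)
      obtain ⟨k, rfl⟩ : ∃ k, m = k + 1 := ⟨m - 1, by omega⟩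
      rw [hψ.integral_succ hθ, mul_zero] at h3
      refine h3.trans (mul_le_mul_of_nonneg_right ?_ (exp_pos _).le)
      rw [mul_one]
      exact mul_le_mul_of_nonneg_left (le_abs_self _) (by positivity))
  rw [zero_mul, sub_zero, ← hkey] at h2
  have hW : 1 ≤ truncSum hU' 1 β := by
    rw [truncSum]
    have := Finset.single_le_sum (f := fun i => exp (-(1 * lamU' i))) (fun _ _ => (exp_pos _).le)
      (show i0 ∈ (hU'.fin β).toFinset by simp [hi0, hβ])
    simpa [hi0] using this
  have hΘ' : truncSum hU' (1 - θ / 2) β ≤ Θ :=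
    truncSum_le_of_injective hU' hU hι hιl (by linarith) β
  have hΘp : truncSum (hU.pi (m + 1)) (1 - θ / 2) β ≤ Θ ^ (m + 1) := truncSum_pi_le hU _ _ _
  have hΘ0 : 0 ≤ Θ := Finset.sum_nonneg fun _ _ => (exp_pos _).le
  set E := exp (-(θ / 2 * β))
  have hE0 : 0 < E := exp_pos _
  have habs : |κL * ((-κL) ^ m * J) * truncSum hU' 1 β| = κL ^ (m + 1) * J * truncSum hU' 1 β := by
    rw [abs_mul, abs_mul, abs_mul, abs_pow, abs_neg, abs_of_pos hκL, abs_of_pos hJ,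
      abs_of_nonneg (by linarith : 0 ≤ truncSum hU' 1 β)]
    ring
  rw [hψJ] at h1
  have h3 : κL ^ (m + 1) * J * truncSum hU' 1 β ≤
      (κL * Q) ^ (m + 1) * A * E * Θ + κE * Q * |A'| * E * Θ ^ (m + 1) := by
    rw [← habs]
    have h4 : (κL * Q) ^ (m + 1) * A * E * truncSum hU' (1 - θ / 2) β ≤
      (κL * Q) ^ (m + 1) * A * E * Θ := mul_le_mul_of_nonneg_left hΘ' (by positivity)
    have h5 : κE * Q * |A'| * E * truncSum (hU.pi (m + 1)) (1 - θ / 2) β ≤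
      κE * Q * |A'| * E * Θ ^ (m + 1) := mul_le_mul_of_nonneg_left hΘp (by positivity)
    have h6 := abs_sub_abs_le_abs_sub (κL * ((-κL) ^ m * J) * truncSum hU' 1 β)
      (dirT lamU' ((dirT lamL)^[m + 1] ψ) m 0)
    rw [abs_sub_comm] at h6
    linarith
  have h7 : κL ^ (m + 1) * J ≤ κL ^ (m + 1) * J * truncSum hU' 1 β :=
    le_mul_of_one_le_right (by positivity) hW
  have hQp : Q ≤ Q ^ (m + 1) := le_self_pow₀ hQ (by omega)
  have hQ0 : 0 < Q := by linarith
  rw [div_mul_eq_mul_div, div_mul_eq_mul_div, div_mul_eq_mul_div, le_div_iff₀ hJ]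
  refine h7.trans (h3.trans ?_)
  have h8 : (κL * Q) ^ (m + 1) * A * E * Θ ≤
      (A + |A'| + 1) * Q ^ (m + 1) * E * (κL ^ (m + 1) * Θ) := by
    rw [mul_pow, show κL ^ (m + 1) * Q ^ (m + 1) * A * E * Θ =
      A * (Q ^ (m + 1) * E * (κL ^ (m + 1) * Θ)) by ring, mul_assoc (A + |A'| + 1),
      mul_assoc (A + |A'| + 1)]
    refine mul_le_mul_of_nonneg_right (by linarith [abs_nonneg A']) (by positivity)
  have h9 : κE * Q * |A'| * E * Θ ^ (m + 1) ≤
      (A + |A'| + 1) * Q ^ (m + 1) * E * (κE * Θ ^ (m + 1)) := by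
    rw [show κE * Q * |A'| * E * Θ ^ (m + 1) = (|A'| * Q) * (E * (κE * Θ ^ (m + 1))) by ring,
      mul_assoc ((A + |A'| + 1) * Q ^ (m + 1))]
    refine mul_le_mul_of_nonneg_right (mul_le_mul (by linarith) hQp hQ0.le
      (by linarith [abs_nonneg A'])) (by positivity)
  rw [mul_add]
  linarith

end Beurling

section FinsuppSystems

open Real

/-- The additive extension of a weight on primes to formal products of primes. -/
noncomputable def wt {P : Type*} (w : P → ℝ) (e : P →₀ ℕ) : ℝ := e.sum fun v n => (n : ℝ) * w v

lemma wt_zero {P : Type*} (w : P → ℝ) : wt w 0 = 0 := Finsupp.sum_zero_index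

lemma wt_add {P : Type*} (w : P → ℝ) (e f : P →₀ ℕ) : wt w (e + f) = wt w e + wt w f :=
  Finsupp.sum_add_index' (by simp) (by intros; push_cast; ring)

lemma wt_nonneg {P : Type*} {w : P → ℝ} (hw : ∀ v, 0 ≤ w v) (e : P →₀ ℕ) : 0 ≤ wt w e :=
  Finset.sum_nonneg fun v _ => mul_nonneg (Nat.cast_nonneg _) (hw v)

lemma wt_eq_sum {P : Type*} (w : P → ℝ) {e : P →₀ ℕ} {S : Finset P} (h : e.support ⊆ S) :
    wt w e = ∑ v ∈ S, (e v : ℝ) * w v :=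
  Finsupp.sum_of_support_subset _ h _ (by simp)

lemma mul_le_wt {P : Type*} {w : P → ℝ} (hw : ∀ v, 0 ≤ w v) (e : P →₀ ℕ) (v : P) :
    (e v : ℝ) * w v ≤ wt w e := by
  classical
  rw [wt_eq_sum w (Finset.subset_insert v e.support)]
  exact Finset.single_le_sum (f := fun v => (e v : ℝ) * w v)
    (fun v _ => mul_nonneg (Nat.cast_nonneg _) (hw v)) (Finset.mem_insert_self _ _)

lemma wt_equiv {P R : Type*} (b : P ≃ R) (w : R → ℝ) (e : P →₀ ℕ) :
    wt w (Finsupp.equivMapDomain b e) = wt (fun v => w (b v)) e := by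
  rw [wt, Finsupp.sum_equivMapDomain, wt]

lemma wt_sumElim {P R : Type*} (w : P ⊕ R → ℝ) (e : P ⊕ R →₀ ℕ) :
    wt w e = wt (fun v => w (.inl v)) (Finsupp.sumFinsuppEquivProdFinsupp e).1 +
      wt (fun v => w (.inr v)) (Finsupp.sumFinsuppEquivProdFinsupp e).2 := by
  classical
  induction e using Finsupp.induction_linear with
  | zero =>
    simp [wt]
  | add f g hf hg =>
    rw [wt_add, hf, hg]
    have h1 : Finsupp.sumFinsuppEquivProdFinsupp (f + g) =
      Finsupp.sumFinsuppEquivProdFinsupp f + Finsupp.sumFinsuppEquivProdFinsupp g :=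
      map_add Finsupp.sumFinsuppAddEquivProdFinsupp f g
    rw [h1, Prod.fst_add, Prod.snd_add, wt_add, wt_add]
    ring
  | single a b =>
    rcases a with a | a
    · have h1 : Finsupp.sumFinsuppEquivProdFinsupp (Finsupp.single (Sum.inl a : P ⊕ R) b) =
          (Finsupp.single a b, 0) := by
        refine Prod.ext (Finsupp.ext fun x => ?_) (Finsupp.ext fun x => ?_) <;>
        simp [Finsupp.single_apply]
      rw [h1]
      simp [wt]
    · have h1 : Finsupp.sumFinsuppEquivProdFinsupp (Finsupp.single (Sum.inr a : P ⊕ R) b) =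
          (0, Finsupp.single a b) := by
        refine Prod.ext (Finsupp.ext fun x => ?_) (Finsupp.ext fun x => ?_) <;>
        simp [Finsupp.single_apply]
      rw [h1]
      simp [wt]

/-- Tuples of formal products are formal products over a product. -/
noncomputable def piFinsuppEquiv (p : ℕ) (P : Type*) : (Fin p → (P →₀ ℕ)) ≃ (Fin p × P →₀ ℕ) :=
  Finsupp.equivFunOnFinite.symm.trans Finsupp.curryEquiv.symm

lemma wt_piFinsuppEquiv {p : ℕ} {P : Type*} (w : P → ℝ) (f : Fin p → (P →₀ ℕ)) :
    wt (fun x : Fin p × P => w x.2) (piFinsuppEquiv p P f) = ∑ k, wt w (f k) := by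
  have h1 : piFinsuppEquiv p P f = (Finsupp.equivFunOnFinite.symm f).uncurry := rfl
  rw [wt, h1, Finsupp.sum_uncurry_index (g := fun (x : Fin p × P) (n : ℕ) => (n : ℝ) * w x.2),
    Finsupp.sum_fintype _ _ (by simp)]
  rfl

lemma LogSystem.wt {P : Type*} {w : P → ℝ} (hl : LogSystem w) (h2 : ∀ v, log 2 ≤ w v) :
    LogSystem (wt w) where
  nonneg := wt_nonneg hl.nonneg
  fin X := by
    classical
    refine ((hl.fin X).toFinset.finsupp
      fun _ => Finset.range (⌊X / log 2⌋₊ + 1)).finite_toSet.subset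
      fun e he => ?_
    have he : _root_.wt w e ≤ X := he
    have hlog : 0 < log 2 := log_pos one_lt_two
    rw [Finset.mem_coe, Finset.mem_finsupp_iff]
    refine ⟨fun v hv => ?_, fun v hv => ?_⟩
    · rw [Set.Finite.mem_toFinset]
      have h1 : (1 : ℝ) ≤ e v := by
        exact_mod_cast Nat.one_le_iff_ne_zero.2 (Finsupp.mem_support_iff.1 hv)
      have := mul_le_wt hl.nonneg e v
      change w v ≤ X
      nlinarith [hl.nonneg v]
    · rw [Finset.mem_range, Nat.lt_succ_iff]
      apply Nat.le_floor
      rw [le_div_iff₀ hlog]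
      have := mul_le_wt hl.nonneg e v
      have h3 : (0 : ℝ) ≤ e v := Nat.cast_nonneg _
      nlinarith [h2 v]

lemma sum_exp_wt_le {P : Type*} {w : P → ℝ} (hw : ∀ v, 0 < w v) {s : ℝ} (hs : 0 < s)
    (T : Finset (P →₀ ℕ)) (S : Finset P) (hT : ∀ e ∈ T, e.support ⊆ S) :
    ∑ e ∈ T, exp (-(s * wt w e)) ≤ ∏ v ∈ S, (1 - exp (-(s * w v)))⁻¹ := by
  classical
  set B := T.sup fun e => e.support.sup e
  have hB : T ⊆ S.finsupp fun _ => Finset.range (B + 1) := by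
    intro e he
    rw [Finset.mem_finsupp_iff]
    refine ⟨hT e he, fun v hv => ?_⟩
    rw [Finset.mem_range, Nat.lt_succ_iff]
    by_cases h : v ∈ e.support
    · exact (Finset.le_sup (f := e) h).trans
        (Finset.le_sup (f := fun e : P →₀ ℕ => e.support.sup e) he)
    · rw [Finsupp.notMem_support_iff.1 h]; exact Nat.zero_le _
  have h1 : ∑ e ∈ S.finsupp (fun _ => Finset.range (B + 1)), exp (-(s * wt w e)) =
      ∏ v ∈ S, ∑ n ∈ Finset.range (B + 1), exp (-(s * w v)) ^ n := by
    rw [Finset.prod_sum, Finset.finsupp, Finset.sum_map]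
    refine Finset.sum_congr rfl fun f hf => ?_
    have h2 : (Finsupp.indicator S f).support ⊆ S := Finsupp.support_indicator_subset _ _
    change exp (-(s * wt w (Finsupp.indicator S f))) = _
    rw [wt_eq_sum w h2, Finset.mul_sum, ← Finset.sum_neg_distrib, exp_sum,
      ← Finset.prod_attach]
    refine Finset.prod_congr rfl fun v _ => ?_
    rw [Finsupp.indicator_of_mem v.2, ← exp_nat_mul]
    congr 1
    ring
  refine (Finset.sum_le_sum_of_subset_of_nonneg hB fun _ _ _ => (exp_pos _).le).trans ?_
  rw [h1]
  refine Finset.prod_le_prod (fun _ _ => Finset.sum_nonneg fun _ _ => by positivity) fun v _ => ?_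
  have h3 : exp (-(s * w v)) < 1 := Real.exp_lt_one_iff.2 (by have := mul_pos hs (hw v); linarith)
  rw [← tsum_geometric_of_lt_one (exp_pos _).le h3]
  exact (summable_geometric_of_lt_one (exp_pos _).le h3).sum_le_tsum _ fun _ _ => by positivity

end FinsuppSystems

section PrimeSystems

open Real

/-- A weight on primes lying over rational primes, at most `d` over each. -/
structure PrimeSystem {P : Type*} (d : ℕ) (w : P → ℝ) (ρ : P → ℕ) : Prop where
  prime : ∀ v, (ρ v).Prime
  le : ∀ v, log (ρ v) ≤ w v
  card_fiber : ∀ (S : Finset P) (q : ℕ), (∀ v ∈ S, ρ v = q) → S.card ≤ d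

lemma PrimeSystem.log_two_le {P : Type*} {d : ℕ} {w : P → ℝ} {ρ : P → ℕ} (h : PrimeSystem d w ρ)
    (v : P) : log 2 ≤ w v :=
  (log_le_log two_pos (by exact_mod_cast (h.prime v).two_le)).trans (h.le v)

lemma PrimeSystem.pos {P : Type*} {d : ℕ} {w : P → ℝ} {ρ : P → ℕ} (h : PrimeSystem d w ρ)
    (v : P) : 0 < w v := (log_pos one_lt_two).trans_le (h.log_two_le v)

lemma inv_one_sub_le_exp {x b : ℝ} (hxb : x ≤ b) (hb : b < 1) (hx : 0 ≤ x) :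
    (1 - x)⁻¹ ≤ exp ((1 - b)⁻¹ * x) := by
  have h1 : 0 < 1 - x := by linarith
  have h2 : (1 - x)⁻¹ = (1 - x)⁻¹ * x + 1 := by field_simp; ring
  rw [h2]
  refine (add_one_le_exp _).trans (exp_le_exp.2 (mul_le_mul_of_nonneg_right ?_ hx))
  exact inv_anti₀ (by linarith) (by linarith)

lemma PrimeSystem.prod_le {P : Type*} {d : ℕ} {w : P → ℝ} {ρ : P → ℕ} (h : PrimeSystem d w ρ)
    {s : ℝ} (hs : 0 < s) (S : Finset P) :
    ∏ v ∈ S, (1 - exp (-(s * w v)))⁻¹ ≤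
      exp (d * (1 - exp (-(s * log 2)))⁻¹ * ∑ q ∈ S.image ρ, (q : ℝ) ^ (-s)) := by
  classical
  have hb : exp (-(s * log 2)) < 1 :=
    exp_lt_one_iff.2 (neg_lt_zero.2 (mul_pos hs (log_pos one_lt_two)))
  have hb' : 0 < (1 - exp (-(s * log 2)))⁻¹ := inv_pos.2 (by linarith)
  have h1 : ∏ v ∈ S, (1 - exp (-(s * w v)))⁻¹ ≤
      ∏ v ∈ S, exp ((1 - exp (-(s * log 2)))⁻¹ * (ρ v : ℝ) ^ (-s)) := by
    refine Finset.prod_le_prod (fun v _ => inv_nonneg.2 ?_) fun v _ => ?_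
    · have := mul_pos hs (h.pos v)
      linarith [exp_le_one_iff.2 (by linarith : -(s * w v) ≤ 0)]
    · refine (inv_one_sub_le_exp (exp_le_exp.2 ?_) hb (exp_pos _).le).trans (exp_le_exp.2 ?_)
      · nlinarith [h.log_two_le v]
      · refine mul_le_mul_of_nonneg_left ?_ hb'.le
        rw [rpow_def_of_pos (by exact_mod_cast (h.prime v).pos)]
        refine exp_le_exp.2 ?_
        nlinarith [h.le v]
  refine h1.trans ?_
  rw [← exp_sum, ← Finset.mul_sum, Finset.sum_comp (fun q : ℕ => (q : ℝ) ^ (-s)) ρ]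
  refine exp_le_exp.2 ?_
  rw [mul_comm (d : ℝ), mul_assoc]
  refine mul_le_mul_of_nonneg_left ?_ hb'.le
  rw [Finset.mul_sum]
  refine Finset.sum_le_sum fun q _ => ?_
  rw [nsmul_eq_mul]
  refine mul_le_mul_of_nonneg_right ?_ (by positivity)
  exact_mod_cast h.card_fiber _ q (by simp)

/-- Uniform bound for formal zeta functions to the right of `1`. -/
lemma exists_prime_system_sum_le (d : ℕ) {s : ℝ} (hs : 1 < s) : ∃ C : ℝ, 0 < C ∧
    ∀ (P : Type) (w : P → ℝ) (ρ : P → ℕ), PrimeSystem d w ρ → ∀ T : Finset (P →₀ ℕ),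
      ∑ e ∈ T, exp (-(s * wt w e)) ≤ C := by
  classical
  have hsum : Summable fun n : ℕ => (n : ℝ) ^ (-s) := by
    rw [summable_nat_rpow]; linarith
  have hs0 : 0 < s := by linarith
  have hb : exp (-(s * log 2)) < 1 :=
    exp_lt_one_iff.2 (neg_lt_zero.2 (mul_pos hs0 (log_pos one_lt_two)))
  have hb' : 0 < (1 - exp (-(s * log 2)))⁻¹ := inv_pos.2 (by linarith)
  refine ⟨exp (d * (1 - exp (-(s * log 2)))⁻¹ * ∑' n : ℕ, (n : ℝ) ^ (-s)), exp_pos _, ?_⟩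
  intro P w ρ h T
  refine (sum_exp_wt_le h.pos hs0 T (T.sup Finsupp.support)
    fun e he => Finset.le_sup (f := Finsupp.support) he).trans ((h.prod_le hs0 _).trans ?_)
  refine exp_le_exp.2 (mul_le_mul_of_nonneg_left ?_ (by positivity))
  exact hsum.sum_le_tsum _ fun _ _ => by positivity

/-- Formal products bounded by `Z` number at most `C Z^s`. -/
lemma exists_prime_system_card_le (d : ℕ) {s : ℝ} (hs : 1 < s) : ∃ C : ℝ, 0 < C ∧
    ∀ (P : Type) (w : P → ℝ) (ρ : P → ℕ), PrimeSystem d w ρ → ∀ (u : ℝ) (T : Finset (P →₀ ℕ)),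
      (∀ e ∈ T, wt w e ≤ u) → (T.card : ℝ) ≤ C * exp (s * u) := by
  obtain ⟨C, hC, h⟩ := exists_prime_system_sum_le d hs
  refine ⟨C, hC, fun P w ρ hP u T hT => ?_⟩
  have h1 : ∑ e ∈ T, exp (-(s * u)) ≤ C :=
    (Finset.sum_le_sum fun e he => exp_le_exp.2 (by nlinarith [hT e he])).trans (h P w ρ hP T)
  rw [Finset.sum_const, nsmul_eq_mul, exp_neg, ← div_eq_mul_inv, div_le_iff₀ (exp_pos _)] at h1
  exact h1

/-- Formal products of primes dividing a fixed integer. -/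
lemma exists_prime_system_ramified_le (d : ℕ) {s ε : ℝ} (hs : 0 < s) (hε : 0 < ε) :
    ∃ C : ℝ, 0 < C ∧
    ∀ (P : Type) (w : P → ℝ) (ρ : P → ℕ), PrimeSystem d w ρ → ∀ (D : ℕ), D ≠ 0 → (∀ v, ρ v ∣ D) →
      ∀ T : Finset (P →₀ ℕ), ∑ e ∈ T, exp (-(s * wt w e)) ≤ C * (D : ℝ) ^ ε := by
  classical
  set c := d * (1 - exp (-(s * log 2)))⁻¹
  have hb : exp (-(s * log 2)) < 1 :=
    exp_lt_one_iff.2 (neg_lt_zero.2 (mul_pos hs (log_pos one_lt_two)))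
  have hb' : 0 < (1 - exp (-(s * log 2)))⁻¹ := inv_pos.2 (by linarith)
  have hc : 0 ≤ c := by positivity
  obtain ⟨M, hM⟩ := exists_nat_gt (exp (c / ε))
  refine ⟨exp (M * c), exp_pos _, ?_⟩
  intro P w ρ h D hD hρ T
  refine (sum_exp_wt_le h.pos hs T (T.sup Finsupp.support)
    fun e he => Finset.le_sup (f := Finsupp.support) he).trans ((h.prod_le hs _).trans ?_)
  rw [rpow_def_of_pos (by positivity), ← exp_add]
  refine exp_le_exp.2 ?_
  have h1 : ∀ q ∈ (T.sup Finsupp.support).image ρ, c * (q : ℝ) ^ (-s) ≤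
      (if q < M then c else 0) + ε * log q := by
    intro q hq
    obtain ⟨v, -, rfl⟩ := Finset.mem_image.1 hq
    have h2 : (1 : ℝ) ≤ ρ v := by exact_mod_cast (h.prime v).one_le
    have h3 : (ρ v : ℝ) ^ (-s) ≤ 1 := rpow_le_one_of_one_le_of_nonpos h2 (by linarith)
    split_ifs with hlt
    · nlinarith [log_nonneg h2]
    · have h4 : c / ε ≤ log (ρ v) := by
        rw [le_log_iff_exp_le (by linarith)]
        exact hM.le.trans (by exact_mod_cast not_lt.1 hlt)
      rw [div_le_iff₀ hε] at h4
      nlinarith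
  rw [Finset.mul_sum]
  refine (Finset.sum_le_sum h1).trans ?_
  rw [Finset.sum_add_distrib, ← Finset.mul_sum]
  refine add_le_add ?_ ?_
  · rw [← Finset.sum_filter, Finset.sum_const, nsmul_eq_mul]
    refine mul_le_mul_of_nonneg_right ?_ hc
    have : ((T.sup Finsupp.support).image ρ).filter (· < M) ⊆ Finset.range M := fun q hq =>
      Finset.mem_range.2 (Finset.mem_filter.1 hq).2
    exact_mod_cast (Finset.card_le_card this).trans (Finset.card_range M).le
  · rw [mul_comm (log _)]
    refine mul_le_mul_of_nonneg_left ?_ hε.le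
    rw [← log_prod (fun q hq => by
      obtain ⟨v, -, rfl⟩ := Finset.mem_image.1 hq
      exact_mod_cast (h.prime v).ne_zero)]
    refine log_le_log (Finset.prod_pos fun q hq => ?_) ?_
    · obtain ⟨v, -, rfl⟩ := Finset.mem_image.1 hq
      exact_mod_cast (h.prime v).pos
    · rw [← Nat.cast_prod]
      have : ∏ q ∈ (T.sup Finsupp.support).image ρ, q ∣ D := by
        refine Finset.prod_primes_dvd _ (fun q hq => ?_) fun q hq => ?_
        · obtain ⟨v, -, rfl⟩ := Finset.mem_image.1 hq
          exact (h.prime v).prime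
        · obtain ⟨v, -, rfl⟩ := Finset.mem_image.1 hq
          exact hρ v
      exact_mod_cast Nat.le_of_dvd (Nat.pos_of_ne_zero hD) this

end PrimeSystems

section BeurlingPrimes

open Real

lemma exists_finsupp_equiv {p : ℕ} {A B A' B' : Type*} (b : (Fin p × A) ⊕ B ≃ A' ⊕ (Fin p × B'))
    (wA : A → ℝ) (wB : B → ℝ) (wA' : A' → ℝ) (wB' : B' → ℝ)
    (hb : ∀ x, Sum.elim wA' (fun y => wB' y.2) (b x) = Sum.elim (fun y => wA y.2) wB x) :
    ∃ e : ((Fin p → (A →₀ ℕ)) × (B →₀ ℕ)) ≃ ((A' →₀ ℕ) × (Fin p → (B' →₀ ℕ))),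
      ∀ x, wt wA' (e x).1 + ∑ k, wt wB' ((e x).2 k) = ∑ k, wt wA (x.1 k) + wt wB x.2 := by
  let e₁ := ((piFinsuppEquiv p A).prodCongr (Equiv.refl (B →₀ ℕ))).trans
    Finsupp.sumFinsuppEquivProdFinsupp.symm
  let e₂ := (Finsupp.sumFinsuppEquivProdFinsupp (α := A') (β := Fin p × B') (γ := ℕ)).trans
    ((Equiv.refl (A' →₀ ℕ)).prodCongr (piFinsuppEquiv p B').symm)
  have h₁ : ∀ x, wt (Sum.elim (fun y => wA y.2) wB) (e₁ x) = ∑ k, wt wA (x.1 k) + wt wB x.2 := by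
    intro x
    rw [wt_sumElim, ← wt_piFinsuppEquiv]
    simp [e₁]
  have h₂ : ∀ y, wt wA' (e₂ y).1 + ∑ k, wt wB' ((e₂ y).2 k) =
      wt (Sum.elim wA' (fun y => wB' y.2)) y := by
    intro y
    rw [wt_sumElim, ← wt_piFinsuppEquiv]
    simp [e₂]
  refine ⟨e₁.trans ((Finsupp.equivCongrLeft b).trans e₂), fun x => ?_⟩
  rw [← h₁, Equiv.trans_apply, Equiv.trans_apply, h₂]
  change wt _ (Finsupp.equivMapDomain b (e₁ x)) = _
  rw [wt_equiv]
  simp only [hb]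

lemma exists_prime_equiv {p : ℕ} [NeZero p] {PL PE : Type*} (wL : PL → ℝ) (wE : PE → ℝ)
    (below : PE → PL) (U : Set PL) (hS : ∀ v ∉ U, Nat.card {P // below P = v} = p)
    (hSw : ∀ P, below P ∉ U → wE P = wL (below P)) :
    ∃ b : (Fin p × U) ⊕ PE ≃ {P // below P ∈ U} ⊕ (Fin p × PL),
      ∀ x, Sum.elim (fun P : {P // below P ∈ U} => wE P) (fun y => wL y.2) (b x) =
        Sum.elim (fun y : Fin p × U => wL y.2) wE x := by
  classical
  have hF : ∃ F : PE → Fin p, ∀ v ∉ U, ∀ k, ∃! P, below P = v ∧ F P = k := by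
    have : ∀ v : {v // v ∉ U}, Nonempty ({P // below P = v.1} ≃ Fin p) := fun v =>
      ⟨Nat.equivFinOfCardPos (by rw [hS _ v.2]; exact NeZero.ne p) |>.trans (finCongr (hS _ v.2))⟩
    let ev := fun v => (this v).some
    refine ⟨fun P => if h : below P ∈ U then 0 else ev ⟨below P, h⟩ ⟨P, rfl⟩, fun v hv k => ?_⟩
    have key : ∀ P (hP : below P = v), (if h : below P ∈ U then 0 else ev ⟨below P, h⟩ ⟨P, rfl⟩) =
        ev ⟨v, hv⟩ ⟨P, hP⟩ := by
      rintro P rfl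
      rw [dif_neg hv]
    refine ⟨((ev ⟨v, hv⟩).symm k).1, ⟨((ev ⟨v, hv⟩).symm k).2, ?_⟩, ?_⟩
    · refine (key _ ((ev ⟨v, hv⟩).symm k).2).trans ?_
      simp
    · rintro P ⟨hP, hk⟩
      have : (⟨P, hP⟩ : {P // below P = v}) = (ev ⟨v, hv⟩).symm k := by
        rw [Equiv.eq_symm_apply, ← hk]
        exact (key P hP).symm
      exact congrArg Subtype.val this
  obtain ⟨F, hF⟩ := hF
  let g : (Fin p × U) ⊕ PE → {P // below P ∈ U} ⊕ (Fin p × PL) :=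
    Sum.elim (fun x => Sum.inr (x.1, x.2.1))
      (fun P => if h : below P ∈ U then Sum.inl ⟨P, h⟩ else Sum.inr (F P, below P))
  have g1 : ∀ x, g (Sum.inl x) = Sum.inr (x.1, x.2.1) := fun _ => rfl
  have g2 : ∀ P (h : below P ∈ U), g (Sum.inr P) = Sum.inl ⟨P, h⟩ := fun P h => dif_pos h
  have g3 : ∀ P, below P ∉ U → g (Sum.inr P) = Sum.inr (F P, below P) := fun P h => dif_neg h
  refine ⟨Equiv.ofBijective g ⟨?_, ?_⟩, ?_⟩
  · rintro (⟨k, v⟩ | P) (⟨k', v'⟩ | P') h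
    · rw [g1, g1, Sum.inr.injEq, Prod.mk.injEq] at h
      exact congrArg Sum.inl (Prod.ext h.1 (Subtype.ext h.2))
    · by_cases hP : below P' ∈ U
      · rw [g1, g2 _ hP] at h; simp at h
      · rw [g1, g3 _ hP, Sum.inr.injEq, Prod.mk.injEq] at h
        exact absurd (h.2 ▸ v.2) hP
    · by_cases hP : below P ∈ U
      · rw [g1, g2 _ hP] at h; simp at h
      · rw [g1, g3 _ hP, Sum.inr.injEq, Prod.mk.injEq] at h
        exact absurd (h.2 ▸ v'.2) hP
    · by_cases hP : below P ∈ U <;> by_cases hP' : below P' ∈ U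
      · rw [g2 _ hP, g2 _ hP', Sum.inl.injEq, Subtype.mk.injEq] at h
        rw [h]
      · rw [g2 _ hP, g3 _ hP'] at h; simp at h
      · rw [g3 _ hP, g2 _ hP'] at h; simp at h
      · rw [g3 _ hP, g3 _ hP', Sum.inr.injEq, Prod.mk.injEq] at h
        rw [(hF _ hP' (F P')).unique ⟨h.2, h.1⟩ ⟨rfl, rfl⟩]
  · rintro (⟨P, hP⟩ | ⟨k, v⟩)
    · exact ⟨Sum.inr P, g2 P hP⟩
    · by_cases hv : v ∈ U
      · exact ⟨Sum.inl (k, ⟨v, hv⟩), rfl⟩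
      · obtain ⟨P, ⟨h1, h2⟩, -⟩ := hF v hv k
        refine ⟨Sum.inr P, ?_⟩
        rw [g3 _ (h1 ▸ hv), h1, h2]
  · rintro (x | P)
    · rfl
    · change Sum.elim _ _ (g (Sum.inr P)) = _
      by_cases hP : below P ∈ U
      · rw [g2 _ hP]; rfl
      · rw [g3 _ hP]
        exact (hSw P hP).symm

lemma LogSystem.comp_injective {I J : Type*} {lam : I → ℝ} (hl : LogSystem lam) {f : J → I}
    (hf : Function.Injective f) : LogSystem (fun j => lam (f j)) where
  nonneg _ := hl.nonneg _
  fin X := (hl.fin X).preimage hf.injOn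

/-- The comparison theorem for an extension of prime degree `p = m + 1`. -/
theorem beurling_primes {θ : ℝ} (hθ : 0 < θ) (hθ1 : θ ≤ 1) (m : ℕ) (hm : 1 ≤ m) (rL rE : ℕ) :
    ∃ C : ℝ, 0 < C ∧ ∀ (PL PE : Type) (wL : PL → ℝ) (wE : PE → ℝ)
      (_ : LogSystem wL) (_ : LogSystem wE)
      (_ : ∀ v, log 2 ≤ wL v) (_ : ∀ v, log 2 ≤ wE v) (below : PE → PL) (U : Set PL)
      (_ : ∀ v ∉ U, Nat.card {P // below P = v} = m + 1)
      (_ : ∀ P, below P ∉ U → wE P = wL (below P))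
      (_ : ∀ P P', below P ∈ U → below P = below P' → P = P')
      (_ : ∀ P, wL (below P) ≤ wE P)
      (κL κE Q : ℝ) (_ : 0 < κL) (_ : 0 < κE) (_ : 1 ≤ Q)
      (_ : RieszAsymp (wt wL) rL κL Q θ) (_ : RieszAsymp (wt wE) rE κE Q θ)
      (hU : LogSystem (wt fun v : U => wL v)) (β : ℝ) (_ : 0 ≤ β),
      κL ^ (m + 1) ≤ C * Q ^ (m + 1) * exp (-(θ / 2 * β)) *
        (κL ^ (m + 1) * truncSum hU (1 - θ / 2) β +
          κE * truncSum hU (1 - θ / 2) β ^ (m + 1)) := by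
  obtain ⟨C, hC, h⟩ := beurling hθ hθ1 m hm rL rE
  refine ⟨C, hC, ?_⟩
  intro PL PE wL wE hL hE h2L h2E below U hS hSw hUinj hle κL κE Q hκL hκE hQ hSL hSE hU β hβ
  obtain ⟨b, hb⟩ := exists_prime_equiv wL wE below U hS hSw
  obtain ⟨e, he⟩ := exists_finsupp_equiv b (fun v : U => wL v) wE
    (fun P : {P // below P ∈ U} => wE P) wL hb
  have hU' : LogSystem (fun P : {P // below P ∈ U} => wE P) :=
    hE.comp_injective Subtype.val_injective
  let ι₀ : {P // below P ∈ U} → U := fun P => ⟨below P, P.2⟩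
  have hι₀ : Function.Injective ι₀ := fun P P' hPP =>
    Subtype.ext (hUinj _ _ P.2 (congrArg Subtype.val hPP))
  refine h _ _ _ _ _ _ _ _ (hL.wt h2L) (hE.wt h2E) hU (hU'.wt fun v => h2E v) κL κE Q hκL hκE hQ
    hSL hSE e he (Finsupp.mapDomain ι₀) (Finsupp.mapDomain_injective hι₀) (fun i => ?_) 0
    (wt_zero _) β hβ
  rw [wt, Finsupp.sum_mapDomain_index (by simp) (by intros; push_cast; ring)]
  exact Finset.sum_le_sum fun v _ => mul_le_mul_of_nonneg_left (hle v) (Nat.cast_nonneg _)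

end BeurlingPrimes

section TruncSumSplit

open Real

lemma truncSum_wt_le_card_mul {P : Type*} {w : P → ℝ} (pr : P → Prop) (hP : LogSystem (wt w))
    (hT : LogSystem (wt fun v : {v // pr v} => w v)) (hw : ∀ v, 0 ≤ w v) {s β B : ℝ} (hs : 0 ≤ s)
    (hB : ∀ R : Finset ({v // ¬ pr v} →₀ ℕ),
      ∑ e ∈ R, exp (-(s * wt (fun v : {v // ¬ pr v} => w v) e)) ≤ B) :
    truncSum hP s β ≤ (hT.fin β).toFinset.card * B := by
  classical
  let f : (P →₀ ℕ) ≃ ({v // pr v} →₀ ℕ) × ({v // ¬ pr v} →₀ ℕ) :=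
    (Finsupp.equivCongrLeft (Equiv.sumCompl pr).symm).trans Finsupp.sumFinsuppEquivProdFinsupp
  have hf : ∀ e, wt w e = wt (fun v : {v // pr v} => w v) (f e).1 +
      wt (fun v : {v // ¬ pr v} => w v) (f e).2 := by
    intro e
    have h1 := wt_sumElim (fun x => w (Equiv.sumCompl pr x))
      (Finsupp.equivMapDomain (Equiv.sumCompl pr).symm e)
    rw [wt_equiv] at h1
    simp only [Equiv.apply_symm_apply] at h1
    exact h1
  set T := (hT.fin β).toFinset
  set R := (hP.fin β).toFinset.image fun e => (f e).2
  have h1 : truncSum hP s β ≤ ∑ x ∈ T ×ˢ R, exp (-(s * wt (fun v : {v // ¬ pr v} => w v) x.2)) := by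
    rw [truncSum]
    calc _ ≤ ∑ e ∈ (hP.fin β).toFinset, exp (-(s * wt (fun v : {v // ¬ pr v} => w v) (f e).2)) := by
          refine Finset.sum_le_sum fun e _ => exp_le_exp.2 ?_
          have := wt_nonneg (fun v : {v // pr v} => hw v) (f e).1
          rw [hf e]
          nlinarith
      _ = ∑ x ∈ (hP.fin β).toFinset.image f,
          exp (-(s * wt (fun v : {v // ¬ pr v} => w v) x.2)) := by
          rw [Finset.sum_image f.injective.injOn]
      _ ≤ _ := by
          refine Finset.sum_le_sum_of_subset_of_nonneg (fun x hx => ?_) fun _ _ _ => (exp_pos _).le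
          obtain ⟨e, he, rfl⟩ := Finset.mem_image.1 hx
          refine Finset.mem_product.2 ⟨?_, Finset.mem_image_of_mem _ he⟩
          rw [Set.Finite.mem_toFinset] at he ⊢
          have h2 := wt_nonneg (fun v : {v // ¬ pr v} => hw v) (f e).2
          have h3 := hf e
          have h4 : wt w e ≤ β := he
          change wt _ _ ≤ β
          linarith
  refine h1.trans ?_
  rw [Finset.sum_product]
  simp only [Finset.sum_const, nsmul_eq_mul]
  exact mul_le_mul_of_nonneg_left (hB R) (Nat.cast_nonneg _)

end TruncSumSplit

section IdealFactorization

open IsDedekindDomain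

/-- The ideal with a given factorization. -/
noncomputable def idealOf {R : Type*} [CommRing R] [IsDedekindDomain R]
    (e : HeightOneSpectrum R →₀ ℕ) : Ideal R :=
  e.prod fun v n => v.asIdeal ^ n

variable {R : Type*} [CommRing R] [IsDedekindDomain R]

lemma idealOf_eq_multiset_prod (e : HeightOneSpectrum R →₀ ℕ) :
    idealOf e = ((Finsupp.toMultiset e).map HeightOneSpectrum.asIdeal).prod := by
  rw [Finsupp.toMultiset_map, Finsupp.prod_toMultiset, idealOf,
    Finsupp.prod_mapDomain_index (by simp) (by intros; rw [pow_add])]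

lemma normalizedFactors_idealOf (e : HeightOneSpectrum R →₀ ℕ) :
    UniqueFactorizationMonoid.normalizedFactors (idealOf e) =
      (Finsupp.toMultiset e).map HeightOneSpectrum.asIdeal := by
  rw [idealOf_eq_multiset_prod, UniqueFactorizationMonoid.normalizedFactors_prod_of_prime]
  intro p hp
  obtain ⟨v, -, rfl⟩ := Multiset.mem_map.1 hp
  exact v.prime

lemma idealOf_injective : Function.Injective (idealOf (R := R)) := by
  classical
  intro e f h
  have h1 := normalizedFactors_idealOf e
  rw [h, normalizedFactors_idealOf] at h1
  exact (Multiset.toFinsupp.symm.injective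
    (Multiset.map_injective (fun a b h => HeightOneSpectrum.ext h) h1)).symm

lemma idealOf_ne_bot (e : HeightOneSpectrum R →₀ ℕ) : idealOf e ≠ ⊥ := by
  rw [idealOf, Finsupp.prod, ← Ideal.zero_eq_bot]
  exact Finset.prod_ne_zero_iff.2 fun v _ => pow_ne_zero _ v.ne_bot

lemma idealOf_zero : idealOf (0 : HeightOneSpectrum R →₀ ℕ) = ⊤ := by simp [idealOf]

lemma idealOf_add (e f : HeightOneSpectrum R →₀ ℕ) : idealOf (e + f) = idealOf e * idealOf f :=
  Finsupp.prod_add_index' (by simp) (by intros; rw [pow_add])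

lemma exists_idealOf_eq {I : Ideal R} (hI : I ≠ ⊥) : ∃ e, idealOf e = I := by
  classical
  induction I using UniqueFactorizationMonoid.induction_on_prime with
  | h₁ => exact absurd rfl hI
  | h₂ x hx => exact ⟨0, by rw [idealOf_zero, ← Ideal.isUnit_iff.1 hx]⟩
  | h₃ a p ha hp ih =>
    obtain ⟨e, he⟩ := ih ha
    refine ⟨Finsupp.single ⟨p, Ideal.isPrime_of_prime hp, hp.ne_zero⟩ 1 + e, ?_⟩
    rw [idealOf_add, he]
    simp [idealOf]

/-- Nonzero ideals correspond to their factorizations. -/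
noncomputable def idealOfEquiv : (HeightOneSpectrum R →₀ ℕ) ≃ {I : Ideal R // I ≠ ⊥} :=
  Equiv.ofBijective (fun e => ⟨idealOf e, idealOf_ne_bot e⟩)
    ⟨fun _ _ h => idealOf_injective (congrArg Subtype.val h),
      fun ⟨_, hI⟩ => (exists_idealOf_eq hI).imp fun _ he => Subtype.ext he⟩

end IdealFactorization

section NumberFieldPrimes

open IsDedekindDomain NumberField Real

variable {F : Type*} [Field F]

/-- The rational prime below a prime. -/
noncomputable def ratBelow (v : HeightOneSpectrum (𝓞 F)) : ℕ :=
  Ideal.absNorm (v.asIdeal.under ℤ)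

lemma ratBelow_prime (v : HeightOneSpectrum (𝓞 F)) : (ratBelow v).Prime := by
  have := v.isPrime
  have : NeZero v.asIdeal := ⟨v.ne_bot⟩
  exact Nat.absNorm_under_prime v.asIdeal

variable [NumberField F]

/-- The logarithm of the norm of a prime. -/
noncomputable def wP (v : HeightOneSpectrum (𝓞 F)) : ℝ := log (Ideal.absNorm v.asIdeal)

lemma absNorm_pos_of_ne_bot {I : Ideal (𝓞 F)} (hI : I ≠ ⊥) : 0 < Ideal.absNorm I :=
  Nat.pos_of_ne_zero (mt Ideal.absNorm_eq_zero_iff.1 hI)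

lemma wt_wP (e : HeightOneSpectrum (𝓞 F) →₀ ℕ) :
    wt wP e = log (Ideal.absNorm (idealOf e)) := by
  rw [idealOf, Finsupp.prod, map_prod, wt, Finsupp.sum, Nat.cast_prod, log_prod]
  · refine Finset.sum_congr rfl fun v _ => ?_
    rw [map_pow, Nat.cast_pow, log_pow, wP]
  · intro v _
    have := absNorm_pos_of_ne_bot v.ne_bot
    rw [map_pow]
    positivity

lemma exp_wt_wP (e : HeightOneSpectrum (𝓞 F) →₀ ℕ) :
    exp (wt wP e) = Ideal.absNorm (idealOf e) := by
  rw [wt_wP, exp_log]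
  exact_mod_cast absNorm_pos_of_ne_bot (idealOf_ne_bot e)

lemma primeSystem_wP :
    PrimeSystem (Module.finrank ℚ F) (wP (F := F)) ratBelow where
  prime := ratBelow_prime
  le v := by
    refine log_le_log (by exact_mod_cast (ratBelow_prime v).pos) ?_
    exact_mod_cast Nat.le_of_dvd (absNorm_pos_of_ne_bot v.ne_bot)
      (Int.absNorm_under_dvd_absNorm v.asIdeal)
  card_fiber S q hS := by
    classical
    rcases S.eq_empty_or_nonempty with rfl | ⟨v₀, hv₀⟩
    · simp
    have hq : q.Prime := hS v₀ hv₀ ▸ ratBelow_prime v₀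
    have : Fact q.Prime := ⟨hq⟩
    let p : Ideal ℤ := Ideal.span {(q : ℤ)}
    have hp0 : p ≠ ⊥ := by
      rw [Ne, Ideal.span_singleton_eq_bot]
      exact_mod_cast hq.ne_zero
    have hfin : (p.primesOver (𝓞 F)).Finite := IsDedekindDomain.primesOver_finite p _
    let _ : Fintype (p.primesOver (𝓞 F)) := hfin.fintype
    have h1 := Ideal.sum_ramification_inertia_eq_finrank (R := ℤ) (S := 𝓞 F) p
    rw [RingOfIntegers.rank] at h1
    have h2 : ∀ v : S, v.1.asIdeal ∈ p.primesOver (𝓞 F) := by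
      rintro ⟨v, hv⟩
      refine ⟨v.isPrime, ?_⟩
      have := Int.liesOver_span_absNorm v.asIdeal
      have h3 : Ideal.absNorm (v.asIdeal.under ℤ) = q := hS v hv
      rwa [h3] at this
    rw [← h1]
    calc S.card = Fintype.card S := by simp
      _ ≤ Fintype.card (p.primesOver (𝓞 F)) :=
          Fintype.card_le_of_injective (fun v : S => (⟨v.1.asIdeal, h2 v⟩ : p.primesOver (𝓞 F)))
            fun a b h => Subtype.ext (HeightOneSpectrum.ext (congrArg Subtype.val h))
      _ = ∑ _ : p.primesOver (𝓞 F), 1 := by simp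
      _ ≤ _ := by
          refine Finset.sum_le_sum fun x _ => ?_
          have := x.2.1
          have := x.2.2
          refine Nat.one_le_iff_ne_zero.2 (mul_ne_zero ?_ ?_)
          · exact (x.1.ramificationIdx_pos ℤ).ne'
          · exact (x.1.inertiaDeg_pos ℤ).ne'

lemma logSystem_wt_wP : LogSystem (wt (wP (F := F))) where
  nonneg e := wt_nonneg (fun v => (primeSystem_wP.pos v).le) e
  fin X := by
    have h := Ideal.finite_setOfPred_absNorm_le (S := 𝓞 F) ⌊exp X⌋₊
    refine Set.Finite.of_finite_image (f := idealOf) (h.subset ?_) idealOf_injective.injOn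
    rintro _ ⟨e, he, rfl⟩
    refine Nat.le_floor ?_
    rw [← exp_wt_wP]
    exact exp_le_exp.2 he

end NumberFieldPrimes

section Minkowski

open NumberField NumberField.InfinitePlace Real Ideal

variable {K : Type*} [Field K] [NumberField K]

lemma exists_ne_zero_mem_lt_of_norm_mul_sqrt_lt {J : Ideal (𝓞 K)} (hJ : J ≠ ⊥)
    {y : InfinitePlace K → ℝ} (hy : ∀ w, 0 ≤ y w)
    (h : absNorm J * √|discr K| < ∏ w, y w ^ w.mult) :
    ∃ x ∈ J, x ≠ 0 ∧ ∀ w : InfinitePlace K, w (x : K) < y w := by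
  classical
  let I := FractionalIdeal.mk0 K ⟨J, mem_nonZeroDivisors_of_ne_zero hJ⟩
  have hI : FractionalIdeal.absNorm (I : FractionalIdeal (nonZeroDivisors (𝓞 K)) K) =
      absNorm J := FractionalIdeal.coeIdeal_absNorm J
  obtain ⟨a, ha, ha0, hlt⟩ := mixedEmbedding.exists_ne_zero_mem_ideal_lt (K := K)
    (f := fun w => (y w).toNNReal) I (by
      have h1 : mixedEmbedding.minkowskiBound K I = ENNReal.ofReal
          (absNorm J * √|discr K| * (2 ^ nrRealPlaces K * 2 ^ nrComplexPlaces K)) := by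
        rw [mixedEmbedding.minkowskiBound,
          mixedEmbedding.volume_fundamentalDomain_fractionalIdealLatticeBasis,
          mixedEmbedding.volume_fundamentalDomain_latticeBasis, hI, mixedEmbedding.finrank,
          ← card_add_two_mul_card_eq_rank]
        have h2 : ((NNReal.sqrt ‖discr K‖₊ : NNReal) : ENNReal) = ENNReal.ofReal √|discr K| := by
          rw [ENNReal.ofReal, ENNReal.coe_inj]
          ext
          rw [Real.coe_toNNReal _ (Real.sqrt_nonneg _)]
          simp [Real.coe_sqrt, Int.norm_eq_abs]
        have h3 : (2 : ENNReal) = ENNReal.ofReal 2 := by simp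
        rw [h2, h3, ← ENNReal.ofReal_inv_of_pos two_pos, ← ENNReal.ofReal_pow (by positivity),
          ← ENNReal.ofReal_pow (by positivity), ← ENNReal.ofReal_mul (by positivity),
          ← ENNReal.ofReal_mul (by positivity), ← ENNReal.ofReal_mul (by positivity)]
        congr 1
        rw [pow_add, mul_comm 2, pow_mul, inv_pow]
        field_simp
        push_cast
        ring
      rw [h1, mixedEmbedding.convexBodyLT_volume]
      have h4 : ((mixedEmbedding.convexBodyLTFactor K : NNReal) : ENNReal) *
          ∏ w : InfinitePlace K, ((y w).toNNReal : ENNReal) ^ w.mult =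
          ENNReal.ofReal ((2 ^ nrRealPlaces K * Real.pi ^ nrComplexPlaces K) *
            ∏ w : InfinitePlace K, y w ^ w.mult) := by
        rw [ENNReal.ofReal_mul (by positivity),
          ENNReal.ofReal_prod_of_nonneg fun w _ => pow_nonneg (hy w) _]
        congr 1
        · rw [ENNReal.ofReal, ENNReal.coe_inj, ← NNReal.coe_inj,
            Real.coe_toNNReal _ (by positivity)]
          simp
        · refine Finset.prod_congr rfl fun w _ => ?_
          rw [ENNReal.ofReal_pow (hy w), ENNReal.ofReal]
      rw [ENNReal.ofNNReal_finsetProd]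
      simp only [ENNReal.coe_pow]
      rw [h4]
      have h5 : (0 : ℝ) ≤ absNorm J * √|discr K| := by positivity
      have h6 : (2 : ℝ) ^ nrRealPlaces K * 2 ^ nrComplexPlaces K ≤
          2 ^ nrRealPlaces K * Real.pi ^ nrComplexPlaces K := by
        gcongr
        exact two_le_pi
      have h7 : (0 : ℝ) < 2 ^ nrRealPlaces K * 2 ^ nrComplexPlaces K := by positivity
      refine ENNReal.ofReal_lt_ofReal_iff_of_nonneg (by positivity) |>.2 ?_
      calc _ < (∏ w : InfinitePlace K, y w ^ w.mult) *
            (2 ^ nrRealPlaces K * 2 ^ nrComplexPlaces K) := mul_lt_mul_of_pos_right h h7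
        _ ≤ _ := by
            rw [mul_comm]
            exact mul_le_mul_of_nonneg_right h6 (h5.trans h.le))
  obtain ⟨x, hx, rfl⟩ := (FractionalIdeal.mem_coeIdeal _).1 ha
  exact ⟨x, hx, fun h0 => ha0 (by simp [h0]), fun w =>
    (hlt w).trans_eq (Real.coe_toNNReal _ (hy w))⟩

lemma prod_place_eq_absNorm (x : 𝓞 K) :
    ∏ w : InfinitePlace K, w (x : K) ^ w.mult = absNorm (span {x}) := by
  rw [prod_eq_abs_norm, absNorm_span_singleton, ← Algebra.coe_norm_int]
  simp [Nat.cast_natAbs]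

lemma one_le_two_mul_sqrt_discr : (1 : ℝ) ≤ 2 * √|discr K| := by
  have h1 : (1 : ℝ) ≤ |(discr K : ℝ)| := by
    exact_mod_cast Int.one_le_abs (discr_ne_zero K)
  have h2 := Real.one_le_sqrt.2 h1
  linarith

lemma exists_mul_eq_span_of_prod_eq {J : Ideal (𝓞 K)} (hJ : J ≠ ⊥) {y : InfinitePlace K → ℝ}
    (hy : ∀ w, 0 < y w) (h : ∏ w, y w ^ w.mult = absNorm J) :
    ∃ (x : 𝓞 K) (I : Ideal (𝓞 K)), x ≠ 0 ∧ I ≠ ⊥ ∧ span {x} = I * J ∧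
      absNorm I ≤ 2 * √|discr K| ∧
      ∀ w : InfinitePlace K, |log (w (x : K) / y w)| ≤ log (2 * √|discr K|) := by
  classical
  set T : ℝ := 2 * √|discr K| with hT
  have hT1 : 1 ≤ T := one_le_two_mul_sqrt_discr
  have hT0 : 0 < T := by linarith
  set d := Module.finrank ℚ K with hd
  have hd0 : 0 < d := Module.finrank_pos
  have hdR : (0 : ℝ) < d := by exact_mod_cast hd0
  set t : ℝ := T ^ ((d : ℝ)⁻¹) with ht
  have ht0 : 0 < t := rpow_pos_of_pos hT0 _
  have htd : t ^ d = T := rpow_inv_natCast_pow hT0.le hd0.ne'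
  have hNJ : (0 : ℝ) < absNorm J := by exact_mod_cast absNorm_pos_of_ne_bot hJ
  have hlogt : (d : ℝ) * log t = log T := by rw [← log_pow, htd]
  have hlt0 : 0 ≤ log t := by
    have := log_nonneg hT1
    rw [← hlogt] at this
    exact nonneg_of_mul_nonneg_right this hdR
  obtain ⟨x, hxJ, hx0, hx⟩ := exists_ne_zero_mem_lt_of_norm_mul_sqrt_lt hJ (y := fun w => t * y w)
    (fun w => by have := hy w; positivity) (by
      simp only [mul_pow]
      rw [Finset.prod_mul_distrib, Finset.prod_pow_eq_pow_sum, sum_mult_eq, ← hd, htd, h, mul_comm]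
      refine mul_lt_mul_of_pos_right ?_ hNJ
      rw [hT] at hT0 ⊢
      linarith)
  obtain ⟨I, hI⟩ := (Ideal.dvd_span_singleton).2 hxJ
  have hI0 : I ≠ ⊥ := by
    rintro rfl
    rw [Ideal.mul_bot, span_singleton_eq_bot] at hI
    exact hx0 hI
  have hxw : ∀ w : InfinitePlace K, 0 < w (x : K) := fun w => by
    rw [pos_iff]
    exact_mod_cast hx0
  have hle : ∀ w : InfinitePlace K, log (w (x : K) / y w) ≤ log t := fun w =>
    log_le_log (div_pos (hxw w) (hy w)) ((div_le_iff₀ (hy w)).2 (hx w).le)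
  have hNI : (1 : ℝ) ≤ absNorm I := by exact_mod_cast absNorm_pos_of_ne_bot hI0
  have hsum : ∑ w : InfinitePlace K, (w.mult : ℝ) * log (w (x : K) / y w) = log (absNorm I) := by
    have h1 : ∏ w : InfinitePlace K, (w (x : K) / y w) ^ w.mult = absNorm I := by
      simp only [div_pow]
      rw [Finset.prod_div_distrib, h, prod_place_eq_absNorm, hI, map_mul]
      push_cast
      field_simp
    rw [← h1, log_prod fun w _ => pow_ne_zero _ (div_pos (hxw w) (hy w)).ne']
    simp [log_pow]
  have hmult : ∑ w : InfinitePlace K, (w.mult : ℝ) = d := by exact_mod_cast sum_mult_eq (K := K)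
  refine ⟨x, I, hx0, hI0, by rw [hI, mul_comm], ?_, fun w => ?_⟩
  · refine (log_le_log_iff (by linarith) hT0).1 ?_
    rw [← hsum, ← hlogt, ← hmult, Finset.sum_mul]
    exact Finset.sum_le_sum fun w _ => mul_le_mul_of_nonneg_left (hle w) (Nat.cast_nonneg _)
  · have hd1 : log t ≤ log T := by
      rw [← hlogt]
      have : (1 : ℝ) ≤ d := by exact_mod_cast hd0
      nlinarith
    refine abs_le.2 ⟨?_, (hle w).trans hd1⟩
    have h2 : ∑ v ∈ Finset.univ.erase w, (v.mult : ℝ) * log (v (x : K) / y v) ≤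
        ∑ v ∈ Finset.univ.erase w, (v.mult : ℝ) * log t :=
      Finset.sum_le_sum fun v _ => mul_le_mul_of_nonneg_left (hle v) (Nat.cast_nonneg _)
    have h3 : ∑ v ∈ Finset.univ.erase w, (v.mult : ℝ) * log t ≤ log T := by
      rw [← hlogt, ← hmult, Finset.sum_mul]
      exact Finset.sum_le_sum_of_subset_of_nonneg (Finset.erase_subset _ _)
        fun v _ _ => mul_nonneg (Nat.cast_nonneg _) hlt0
    have h4 := Finset.add_sum_erase Finset.univ
      (fun v : InfinitePlace K => (v.mult : ℝ) * log (v (x : K) / y v)) (Finset.mem_univ w)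
    rw [hsum] at h4
    have h5 := log_nonneg hNI
    have h6 : (1 : ℝ) ≤ w.mult := by exact_mod_cast w.mult_pos
    by_contra! h7
    have h8 := log_nonneg hT1
    nlinarith

end Minkowski

section IdealCount

open NumberField Real Ideal

lemma exists_ideal_card_le (d : ℕ) {s : ℝ} (hs : 1 < s) : ∃ C : ℝ, 0 < C ∧
    ∀ (K : Type) [Field K] [NumberField K], Module.finrank ℚ K = d →
      ∀ (S : Finset (Ideal (𝓞 K))) (Z : ℝ), 0 < Z → (∀ J ∈ S, J ≠ ⊥ ∧ absNorm J ≤ Z) →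
        (S.card : ℝ) ≤ C * Z ^ s := by
  classical
  obtain ⟨C, hC, h⟩ := exists_prime_system_card_le d hs
  refine ⟨C, hC, fun K _ _ hK S Z hZ hS => ?_⟩
  have hinj : Function.Injective (idealOf (R := 𝓞 K)) := idealOf_injective
  have h1 := h _ wP ratBelow (hK ▸ primeSystem_wP (F := K)) (log Z)
    (S.preimage idealOf hinj.injOn) (fun e he => by
      rw [wt_wP]
      obtain ⟨h2, h3⟩ := hS _ (Finset.mem_preimage.1 he)
      exact log_le_log (by exact_mod_cast absNorm_pos_of_ne_bot h2) h3)
  rw [mul_comm s, ← rpow_def_of_pos hZ] at h1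
  rwa [Finset.card_preimage, Finset.filter_true_of_mem fun J hJ =>
    Set.mem_range.2 (exists_idealOf_eq (hS J hJ).1)] at h1

end IdealCount

section EllenbergVenkatesh

open NumberField NumberField.InfinitePlace Real Ideal

variable {K : Type*} [Field K] [NumberField K]

lemma exists_span_eq_pow_of_pow_eq_one {ℓ : ℕ} (c : ClassGroup (𝓞 K)) (hc : c ^ ℓ = 1) :
    ∃ (J : (nonZeroDivisors (Ideal (𝓞 K)))) (α : 𝓞 K), ClassGroup.mk0 J = c ∧ α ≠ 0 ∧
      (J : Ideal (𝓞 K)) ^ ℓ = span {α} := by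
  obtain ⟨J, rfl⟩ := ClassGroup.mk0_surjective c
  rw [← map_pow, ClassGroup.mk0_eq_one_iff (J ^ ℓ).2] at hc
  obtain ⟨α, hα⟩ := hc
  refine ⟨J, α, rfl, ?_, by simpa using hα⟩
  rintro rfl
  have h1 : (J : Ideal (𝓞 K)) ≠ 0 := nonZeroDivisors.coe_ne_zero J
  apply pow_ne_zero ℓ h1
  simpa using hα

/-- Two ideals `𝔞`, `𝔟` whose quotient, raised to the power `ℓ`, is generated by a number all of
whose absolute values are at most `B`, in denominator-free form. -/
def Collision (ℓ : ℕ) (B : ℝ) (𝔞 𝔟 : Ideal (𝓞 K)) : Prop :=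
  ∃ (η : 𝓞 K) (m : ℕ), m ≠ 0 ∧ span {η} * 𝔟 ^ ℓ = span {(m : 𝓞 K)} ^ ℓ * 𝔞 ^ ℓ ∧
    ∀ w : InfinitePlace K, w (η : K) ≤ B

lemma collision_of_eq {ℓ : ℕ} (hℓ : 1 ≤ ℓ) {X : ℝ} {J₁ J₂ 𝔞 𝔟 I : Ideal (𝓞 K)} {α β x y : 𝓞 K}
    (hα : α ≠ 0) (hβ : β ≠ 0) (hx : x ≠ 0) (hy : y ≠ 0)
    (h𝔞 : 𝔞 ≠ ⊥) (h𝔟 : 𝔟 ≠ ⊥) (h𝔞X : absNorm 𝔞 ≤ X) (h𝔟X : absNorm 𝔟 ≤ X)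
    (hJ₁ : J₁ ^ ℓ = span {α}) (hJ₂ : J₂ ^ ℓ = span {β})
    (hxI : span {x} = I * (J₁ * 𝔞)) (hyI : span {y} = I * (J₂ * 𝔟))
    (hw : ∀ w : InfinitePlace K,
      ⌊log (w (x : K) / (w (α : K) ^ (ℓ : ℝ)⁻¹ * (absNorm 𝔞 : ℝ) ^ (Module.finrank ℚ K : ℝ)⁻¹))⌋ =
      ⌊log (w (y : K) / (w (β : K) ^ (ℓ : ℝ)⁻¹ * (absNorm 𝔟 : ℝ) ^ (Module.finrank ℚ K : ℝ)⁻¹))⌋) :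
    Collision ℓ (exp ℓ * X ^ (2 * ℓ)) 𝔞 𝔟 := by
  set m := absNorm 𝔟 with hm
  have hmpos : 0 < m := absNorm_pos_of_ne_bot h𝔟
  have hkey : span {x ^ ℓ * β} * 𝔟 ^ ℓ = span {y ^ ℓ * α} * 𝔞 ^ ℓ := by
    rw [← span_singleton_mul_span_singleton, ← span_singleton_mul_span_singleton,
      ← span_singleton_pow, ← span_singleton_pow, ← hJ₁, ← hJ₂, hxI, hyI]
    ring
  have hmem : (m : 𝓞 K) ∈ 𝔟 := by
    have := absNorm_mem 𝔟
    exact_mod_cast this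
  have hdvd : y ^ ℓ * α ∣ x ^ ℓ * β * (m : 𝓞 K) ^ ℓ := by
    rw [← span_singleton_le_span_singleton]
    have h1 : span {(m : 𝓞 K) ^ ℓ} ≤ 𝔟 ^ ℓ :=
      (span_singleton_le_iff_mem _).2 (pow_mem_pow hmem _)
    calc span {x ^ ℓ * β * (m : 𝓞 K) ^ ℓ} = span {x ^ ℓ * β} * span {(m : 𝓞 K) ^ ℓ} :=
          (span_singleton_mul_span_singleton _ _).symm
      _ ≤ span {x ^ ℓ * β} * 𝔟 ^ ℓ := Ideal.mul_mono_right h1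
      _ = span {y ^ ℓ * α} * 𝔞 ^ ℓ := hkey
      _ ≤ _ := Ideal.mul_le_left
  obtain ⟨η, hη⟩ := hdvd
  have hne : y ^ ℓ * α ≠ 0 := mul_ne_zero (pow_ne_zero _ hy) hα
  refine ⟨η, m, hmpos.ne', ?_, fun w => ?_⟩
  · have h1 : span {y ^ ℓ * α} ≠ (0 : Ideal (𝓞 K)) := by
      rwa [Ne, Ideal.zero_eq_bot, span_singleton_eq_bot]
    refine mul_left_cancel₀ h1 ?_
    rw [← mul_assoc, span_singleton_mul_span_singleton, ← hη, ← span_singleton_mul_span_singleton,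
      span_singleton_pow, mul_right_comm, hkey]
    ring
  · have hpos : ∀ z : 𝓞 K, z ≠ 0 → 0 < w (z : K) := fun z hz => by
      rw [pos_iff]
      exact_mod_cast hz
    have h1 : w (y : K) ^ ℓ * w (α : K) * w (η : K) = w (x : K) ^ ℓ * w (β : K) * (m : ℝ) ^ ℓ := by
      have := congrArg (fun z : 𝓞 K => w (z : K)) hη
      simp only [map_mul, map_pow, map_natCast] at this
      rw [← this, ← norm_embedding_eq w ((m : ℕ) : K), map_natCast, Complex.norm_natCast]
    set A := w (α : K) ^ (ℓ : ℝ)⁻¹ with hA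
    set B := w (β : K) ^ (ℓ : ℝ)⁻¹ with hB
    have hA0 : 0 < A := rpow_pos_of_pos (hpos _ hα) _
    have hB0 : 0 < B := rpow_pos_of_pos (hpos _ hβ) _
    have hAl : A ^ ℓ = w (α : K) := rpow_inv_natCast_pow (hpos _ hα).le (by omega)
    have hBl : B ^ ℓ = w (β : K) := rpow_inv_natCast_pow (hpos _ hβ).le (by omega)
    set M := (absNorm 𝔞 : ℝ) ^ (Module.finrank ℚ K : ℝ)⁻¹ with hM
    set N := (m : ℝ) ^ (Module.finrank ℚ K : ℝ)⁻¹ with hN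
    have h𝔞1 : (1 : ℝ) ≤ absNorm 𝔞 := by exact_mod_cast absNorm_pos_of_ne_bot h𝔞
    have hm1 : (1 : ℝ) ≤ m := by exact_mod_cast hmpos
    have hd1 : (Module.finrank ℚ K : ℝ)⁻¹ ≤ 1 :=
      inv_le_one_of_one_le₀ (by exact_mod_cast Module.finrank_pos (R := ℚ) (M := K))
    have hd0 : 0 ≤ (Module.finrank ℚ K : ℝ)⁻¹ := by positivity
    have hMX : M ≤ X := ((rpow_le_rpow_of_exponent_le h𝔞1 hd1).trans_eq (rpow_one _)).trans h𝔞X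
    have hM0 : 0 < M := by positivity
    have hN1 : 1 ≤ N := one_le_rpow hm1 hd0
    set s := w (x : K) / (A * M) with hs
    set r := w (y : K) / (B * N) with hr
    have hs0 : 0 < s := by have := hpos x hx; positivity
    have hr0 : 0 < r := by have := hpos y hy; positivity
    have hsr : s ≤ exp 1 * r := by
      have h2 : log s < log r + 1 := by
        have h3 := Int.lt_floor_add_one (log s)
        have h4 := Int.floor_le (log r)
        rw [hw w] at h3
        linarith
      rw [← log_le_log_iff hs0 (by positivity), log_mul (exp_ne_zero 1) hr0.ne', log_exp]
      linarith
    have hxs : w (x : K) = s * (A * M) := by rw [hs]; field_simp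
    have hyr : w (y : K) = r * (B * N) := by rw [hr]; field_simp
    rw [hxs, hyr, ← hAl, ← hBl] at h1
    have h2 : w (η : K) = (s / r * (M / N) * m) ^ ℓ := by
      have : (r * (B * N)) ^ ℓ * A ^ ℓ ≠ 0 := by positivity
      refine mul_left_cancel₀ this ?_
      rw [h1]
      simp only [← mul_pow]
      congr 1
      field_simp
    have h3 : s / r * (M / N) * m ≤ exp 1 * X ^ 2 := by
      have h4 : s / r ≤ exp 1 := (div_le_iff₀ hr0).2 hsr
      have h5 : M / N ≤ X := (div_le_self hM0.le hN1).trans hMX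
      have h6 : 0 ≤ X := hM0.le.trans hMX
      rw [pow_two, ← mul_assoc]
      gcongr
    rw [h2, mul_comm 2, pow_mul', ← exp_one_pow, ← mul_pow, ]
    exact pow_le_pow_left₀ (by positivity) h3 _

lemma prod_rpow_mult_eq {ℓ : ℕ} (hℓ : 1 ≤ ℓ) {J 𝔞 : Ideal (𝓞 K)} {α : 𝓞 K}
    (hJ : J ^ ℓ = span {α}) :
    ∏ w : InfinitePlace K, (w (α : K) ^ (ℓ : ℝ)⁻¹ *
      (absNorm 𝔞 : ℝ) ^ (Module.finrank ℚ K : ℝ)⁻¹) ^ w.mult = absNorm (J * 𝔞) := by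
  have hd : Module.finrank ℚ K ≠ 0 := (Module.finrank_pos (R := ℚ) (M := K)).ne'
  simp only [mul_pow]
  rw [Finset.prod_mul_distrib, Finset.prod_pow_eq_pow_sum, sum_mult_eq,
    rpow_inv_natCast_pow (Nat.cast_nonneg _) hd, map_mul, Nat.cast_mul]
  congr 1
  have h1 : ∀ w : InfinitePlace K, (w (α : K) ^ (ℓ : ℝ)⁻¹) ^ w.mult =
      (w (α : K) ^ w.mult) ^ (ℓ : ℝ)⁻¹ := fun w => by
    rw [← rpow_natCast, ← rpow_natCast, ← rpow_mul (apply_nonneg _ _),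
      ← rpow_mul (apply_nonneg _ _),
      mul_comm]
  simp only [h1]
  rw [finsetProd_rpow _ _ fun w _ => pow_nonneg (apply_nonneg _ _) _, prod_place_eq_absNorm, ← hJ,
    map_pow, Nat.cast_pow, pow_rpow_inv_natCast (Nat.cast_nonneg _) (by omega)]

lemma log_le_rpow_bound {ε : ℝ} (hε : 0 < ε) {T : ℝ} (hT : 1 ≤ T) :
    2 * log T + 2 ≤ (2 / ε + 2) * T ^ ε := by
  have h1 := log_le_rpow_div (by linarith : 0 ≤ T) hε
  have h2 := one_le_rpow hT hε.le
  have h3 : T ^ ε / ε * 2 = 2 / ε * T ^ ε := by ring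
  linarith

lemma card_Icc_floor_le {L : ℝ} (hL : 0 ≤ L) : ((Finset.Icc ⌊-L⌋ ⌊L⌋).card : ℝ) ≤ 2 * L + 2 := by
  rw [Int.card_Icc]
  have h1 : ⌊-L⌋ ≤ ⌊L⌋ := Int.floor_le_floor (by linarith)
  have h2 : (((⌊L⌋ + 1 - ⌊-L⌋).toNat : ℤ) : ℝ) = ⌊L⌋ + 1 - ⌊-L⌋ := by
    rw [Int.toNat_of_nonneg (by omega)]
    push_cast
    ring
  have h3 := Int.floor_le L
  have h4 := Int.lt_floor_add_one (-L)
  have h5 : (((⌊L⌋ + 1 - ⌊-L⌋).toNat : ℕ) : ℝ) = ⌊L⌋ + 1 - ⌊-L⌋ := by exact_mod_cast h2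
  linarith

lemma mk0_mul_mk0_mul_mk0_eq_one {I J 𝔞 : nonZeroDivisors (Ideal (𝓞 K))} {x : 𝓞 K}
    (h : span {x} = I.1 * (J.1 * 𝔞.1)) :
    ClassGroup.mk0 I * ClassGroup.mk0 J * ClassGroup.mk0 𝔞 = 1 := by
  rw [mul_assoc, ← map_mul, ← map_mul]
  exact (ClassGroup.mk0_eq_one_iff (I * (J * 𝔞)).2).2 ⟨x, h.symm⟩

lemma ellTorsion_mul_card_le_of_injective {ℓ : ℕ} (hℓ : 1 ≤ ℓ) {X C s : ℝ}
    (hC : ∀ (S : Finset (Ideal (𝓞 K))) (Z : ℝ), 0 < Z → (∀ J ∈ S, J ≠ ⊥ ∧ absNorm J ≤ Z) →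
        (S.card : ℝ) ≤ C * Z ^ s) (S : Finset (Ideal (𝓞 K)))
    (hS : ∀ J ∈ S, J ≠ ⊥ ∧ absNorm J ≤ X)
    (hcol : ∀ 𝔞 ∈ S, ∀ 𝔟 ∈ S, 𝔞 ≠ 𝔟 → ¬ Collision ℓ (exp ℓ * X ^ (2 * ℓ)) 𝔞 𝔟) :
    (ellTorsion K ℓ : ℝ) * S.card ≤ C * (2 * √|discr K|) ^ s *
      (2 * log (2 * √|discr K|) + 2) ^ Module.finrank ℚ K := by
  classical
  set T : ℝ := 2 * √|discr K| with hT
  have hT1 : 1 ≤ T := one_le_two_mul_sqrt_discr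
  have hL0 : 0 ≤ log T := log_nonneg hT1
  let A := {x : ClassGroup (𝓞 K) // x ^ ℓ = 1}
  choose J α hJc hα hJα using fun c : A => exists_span_eq_pow_of_pow_eq_one c.1 c.2
  have hJ0 : ∀ c, (J c : Ideal (𝓞 K)) ≠ ⊥ := fun c => nonZeroDivisors.coe_ne_zero (J c)
  have hpos : ∀ (c : A) (𝔞 : S) (w : InfinitePlace K), 0 < w (α c : K) ^ (ℓ : ℝ)⁻¹ *
      (absNorm 𝔞.1 : ℝ) ^ (Module.finrank ℚ K : ℝ)⁻¹ := fun c 𝔞 w => by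
    refine mul_pos (rpow_pos_of_pos ?_ _) (rpow_pos_of_pos ?_ _)
    · rw [pos_iff]
      exact_mod_cast hα c
    · exact_mod_cast absNorm_pos_of_ne_bot (hS _ 𝔞.2).1
  choose x I hx0 hI0 hxI hIT hlog using fun p : A × S =>
    exists_mul_eq_span_of_prod_eq (K := K) (mul_ne_zero (hJ0 p.1) (hS _ p.2.2).1)
      (hpos p.1 p.2) (prod_rpow_mult_eq hℓ (hJα p.1))
  let f : A × S → Ideal (𝓞 K) × (InfinitePlace K → ℤ) := fun p => (I p, fun w =>
    ⌊log (w (x p : K) / (w (α p.1 : K) ^ (ℓ : ℝ)⁻¹ *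
      (absNorm p.2.1 : ℝ) ^ (Module.finrank ℚ K : ℝ)⁻¹))⌋)
  have hf : Function.Injective f := by
    rintro ⟨c, 𝔞⟩ ⟨c', 𝔟⟩ h
    obtain ⟨h1, h2⟩ := Prod.mk.inj h
    have h3 : 𝔞 = 𝔟 := by
      by_contra hne
      refine hcol _ 𝔞.2 _ 𝔟.2 (fun h => hne (Subtype.ext h)) ?_
      refine collision_of_eq hℓ (hα c) (hα c') (hx0 (c, 𝔞)) (hx0 (c', 𝔟)) (hS _ 𝔞.2).1 (hS _ 𝔟.2).1
        (hS _ 𝔞.2).2 (hS _ 𝔟.2).2 (hJα c) (hJα c') (hxI (c, 𝔞)) ?_ fun w => congrFun h2 w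
      rw [h1]
      exact hxI (c', 𝔟)
    subst h3
    refine Prod.ext (Subtype.ext ?_) rfl
    have h4 : ∀ c : A, ClassGroup.mk0 ⟨I (c, 𝔞), mem_nonZeroDivisors_of_ne_zero (hI0 _)⟩ * c.1 *
        ClassGroup.mk0 ⟨𝔞.1, mem_nonZeroDivisors_of_ne_zero (hS _ 𝔞.2).1⟩ = 1 := fun c => by
      rw [← hJc]
      exact mk0_mul_mk0_mul_mk0_eq_one (hxI (c, 𝔞))
    have h5 := (h4 c).trans (h4 c').symm
    simp only [h1] at h5
    exact mul_left_cancel (mul_right_cancel h5)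
  have hTfin : {J : Ideal (𝓞 K) | J ≠ ⊥ ∧ (absNorm J : ℝ) ≤ T}.Finite :=
    (Ideal.finite_setOfPred_absNorm_le (S := 𝓞 K) ⌊T⌋₊).subset fun J hJ => Nat.le_floor hJ.2
  set R := hTfin.toFinset with hR
  set W := Fintype.piFinset fun _ : InfinitePlace K => Finset.Icc ⌊-log T⌋ ⌊log T⌋ with hW
  have h1 : Fintype.card (A × S) ≤ (R ×ˢ W).card := by
    rw [← Finset.card_univ]
    refine Finset.card_le_card_of_injOn f (fun p _ => ?_) hf.injOn
    refine Finset.mem_coe.2 (Finset.mem_product.2 ⟨?_, ?_⟩)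
    · exact hTfin.mem_toFinset.2 ⟨hI0 p, hIT p⟩
    · refine Fintype.mem_piFinset.2 fun w => Finset.mem_Icc.2 ?_
      have := abs_le.1 (hlog p w)
      exact ⟨Int.floor_le_floor this.1, Int.floor_le_floor this.2⟩
  have h2 : ellTorsion K ℓ * S.card = Fintype.card (A × S) := by
    rw [Fintype.card_prod, Fintype.card_coe, ellTorsion, Nat.card_eq_fintype_card]
  have h3 : ((ellTorsion K ℓ * S.card : ℕ) : ℝ) ≤ R.card * W.card := by
    rw [h2]
    rw [Finset.card_product] at h1
    exact_mod_cast h1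
  push_cast at h3
  have h4 : (R.card : ℝ) ≤ C * T ^ s :=
    hC R T (by linarith) fun J hJ => hTfin.mem_toFinset.1 hJ
  have h5 : (W.card : ℝ) ≤ (2 * log T + 2) ^ Module.finrank ℚ K := by
    rw [hW, Fintype.card_piFinset, Finset.prod_const, Nat.cast_pow]
    refine (pow_le_pow_left₀ (Nat.cast_nonneg _) (card_Icc_floor_le hL0) _).trans ?_
    refine pow_le_pow_right₀ (by linarith) ?_
    rw [← sum_mult_eq (K := K), Finset.card_eq_sum_ones]
    exact Finset.sum_le_sum fun w _ => w.mult_pos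
  exact h3.trans (mul_le_mul h4 h5 (Nat.cast_nonneg _) ((Nat.cast_nonneg _).trans h4))

lemma ellTorsion_mul_card_le (d : ℕ) {ℓ : ℕ} (hℓ : 1 ≤ ℓ) {ε : ℝ} (hε : 0 < ε) : ∃ C : ℝ, 0 < C ∧
    ∀ (K : Type) [Field K] [NumberField K], Module.finrank ℚ K = d →
      ∀ (S : Finset (Ideal (𝓞 K))) (X : ℝ), (∀ J ∈ S, J ≠ ⊥ ∧ absNorm J ≤ X) →
        (∀ 𝔞 ∈ S, ∀ 𝔟 ∈ S, 𝔞 ≠ 𝔟 → ¬ Collision ℓ (exp ℓ * X ^ (2 * ℓ)) 𝔞 𝔟) →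
        (ellTorsion K ℓ : ℝ) * S.card ≤ C * (|discr K| : ℝ) ^ ((1 : ℝ) / 2 + ε) := by
  obtain ⟨C, hC, h⟩ := exists_ideal_card_le d (s := 1 + ε) (by linarith)
  set δ := ε / (d + 1) with hδ
  have hδ0 : 0 < δ := by positivity
  refine ⟨C * (2 / δ + 2) ^ d * 2 ^ (1 + 2 * ε), by positivity, fun K _ _ hK S X hS hcol => ?_⟩
  refine (ellTorsion_mul_card_le_of_injective hℓ (fun S Z => h K hK S Z) S hS hcol).trans ?_
  set D : ℝ := |(discr K : ℝ)| with hD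
  have hD1 : 1 ≤ D := by
    rw [hD]
    exact_mod_cast Int.one_le_abs (discr_ne_zero K)
  set T : ℝ := 2 * √D with hT
  have hT1 : 1 ≤ T := one_le_two_mul_sqrt_discr
  have hT0 : 0 < T := by linarith
  have h1 : (2 * log T + 2) ^ d ≤ (2 / δ + 2) ^ d * T ^ ε := by
    refine (pow_le_pow_left₀ (by have := log_nonneg hT1; positivity)
      (log_le_rpow_bound hδ0 hT1) _).trans ?_
    rw [mul_pow, ← rpow_natCast (T ^ δ), ← rpow_mul hT0.le]
    refine mul_le_mul_of_nonneg_left (rpow_le_rpow_of_exponent_le hT1 ?_) (by positivity)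
    rw [hδ, div_mul_eq_mul_div, div_le_iff₀ (by positivity)]
    nlinarith
  have h2 : T ^ (1 + 2 * ε) = 2 ^ (1 + 2 * ε) * D ^ ((1 : ℝ) / 2 + ε) := by
    rw [hT, mul_rpow two_pos.le (sqrt_nonneg _), sqrt_eq_rpow, ← rpow_mul (by linarith)]
    congr 2
    ring
  rw [hK]
  calc _ ≤ C * T ^ (1 + ε) * ((2 / δ + 2) ^ d * T ^ ε) := by gcongr
    _ = C * (2 / δ + 2) ^ d * T ^ (1 + 2 * ε) := by
        rw [show 1 + 2 * ε = (1 + ε) + ε by ring, rpow_add hT0 (1 + ε) ε]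
        ring
    _ = _ := by
        rw [h2]
        ring

end EllenbergVenkatesh

section SmallBasis

open NumberField Module

variable {K : Type*} [Field K] [NumberField K]

lemma abs_discr_le_of_linearIndependent {ι : Type*} [Fintype ι] [DecidableEq ι] {ω : ι → 𝓞 K}
    (hω : LinearIndependent ℚ fun i => (ω i : K)) (hι : Fintype.card ι = finrank ℚ K) {B : ℝ}
    (hB : ∀ i (w : InfinitePlace K), w (ω i : K) ≤ B) :
    |(discr K : ℝ)| ≤ ((finrank ℚ K).factorial * B ^ finrank ℚ K) ^ 2 := by
  have e1 : Free.ChooseBasisIndex ℤ (𝓞 K) ≃ ι :=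
    Fintype.equivOfCardEq (by rw [hι, ← RingOfIntegers.rank, finrank_eq_card_chooseBasisIndex])
  set b := (integralBasis K).reindex e1 with hb
  set P : Matrix ι ι ℤ := fun i j => (RingOfIntegers.basis K).repr (ω j) (e1.symm i) with hP
  have hP1 : b.toMatrix (fun i => (ω i : K)) = P.map (Int.castRingHom ℚ) := by
    ext i j
    rw [Basis.toMatrix_apply, hb, Basis.repr_reindex_apply, integralBasis_repr_apply]
    rfl
  have hbas : (basisOfLinearIndependentOfCardEqFinrank' _ hω hι : ι → K) = fun i => (ω i : K) :=
    coe_basisOfLinearIndependentOfCardEqFinrank' _ hω hι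
  have h0 : Algebra.discr ℚ (fun i => (ω i : K)) ≠ 0 := by
    rw [← hbas]
    exact Algebra.discr_not_zero_of_basis ℚ _
  have h1 : Algebra.discr ℚ (fun i => (ω i : K)) = (P.det : ℚ) ^ 2 * discr K := by
    have h := Algebra.discr_of_matrix_vecMul (A := ℚ) b (b.toMatrix (fun i => (ω i : K)))
    rw [Basis.toMatrix_map_vecMul] at h
    rw [h, hP1, ← RingHom.mapMatrix_apply, ← RingHom.map_det, coe_discr]
    congr 1
    rw [hb, Basis.coe_reindex, Algebra.discr_reindex]
  have hdet : P.det ≠ 0 := fun h => h0 (by rw [h1, h]; simp)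
  have e2 : ι ≃ (K →ₐ[ℚ] ℂ) :=
    Fintype.equivOfCardEq (by rw [hι, AlgHom.card])
  have h2 := Algebra.discr_eq_det_embeddingsMatrixReindex_pow_two ℚ ℂ (fun i => (ω i : K)) e2
  have h3 : ‖(Algebra.embeddingsMatrixReindex ℚ ℂ (fun i => (ω i : K)) e2).det‖ ≤
      (finrank ℚ K).factorial * B ^ finrank ℚ K := by
    have := Matrix.det_le (A := Algebra.embeddingsMatrixReindex ℚ ℂ (fun i => (ω i : K)) e2)
      (abv := NormedField.toAbsoluteValue ℂ) (x := B) fun i j =>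
        (hB i (InfinitePlace.mk (e2 j : K →+* ℂ)))
    rw [hι, nsmul_eq_mul] at this
    exact this
  have h4 : (discr K : ℝ) * (P.det : ℝ) ^ 2 =
      ((Algebra.discr ℚ fun i => (ω i : K) : ℚ) : ℝ) := by
    rw [h1, Rat.cast_mul, Rat.cast_pow, Rat.cast_intCast, Rat.cast_intCast, mul_comm]
  have h5 : |((Algebra.discr ℚ fun i => (ω i : K) : ℚ) : ℝ)| ≤
      ((finrank ℚ K).factorial * B ^ finrank ℚ K) ^ 2 := by
    have : |((Algebra.discr ℚ fun i => (ω i : K) : ℚ) : ℝ)| =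
        ‖algebraMap ℚ ℂ (Algebra.discr ℚ fun i => (ω i : K))‖ := by simp
    rw [this, h2, norm_pow]
    gcongr
  refine le_trans ?_ h5
  rw [← h4, abs_mul]
  refine le_mul_of_one_le_right (abs_nonneg _) ?_
  rw [abs_of_nonneg (sq_nonneg _)]
  have : (1 : ℤ) ≤ P.det ^ 2 := Int.add_one_le_iff.2 (sq_pos_of_ne_zero hdet)
  exact_mod_cast this

end SmallBasis

section LatticeCount

open MeasureTheory
open scoped ENNReal

variable {E : Type*} [AddCommGroup E] [MeasurableSpace E] [MeasurableAdd E]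
  {L : Submodule ℤ E} {μ : Measure E} [μ.IsAddLeftInvariant] {F : Set E}

lemma vaddInvariantMeasure_submodule : VAddInvariantMeasure L E μ where
  measure_preimage_vadd c s _ := measure_preimage_add μ (c : E) s

variable [Countable L] [MeasurableConstVAdd L E]

lemma tsum_indicator_mul_measure_le (hF : IsAddFundamentalDomain L F μ) {S T : Set E}
    (hT : MeasurableSet T) (h : ∀ z, ∃ l : L, ∀ a : L, (a : E) ∈ S → (a : E) + (l + z) ∈ T) :
    (∑' a : L, S.indicator (1 : E → ℝ≥0∞) a) * μ F ≤ μ T := by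
  have hm : ∀ a : L, Measurable fun z : E => T.indicator (1 : E → ℝ≥0∞) (a + z) := fun a =>
    (measurable_one.indicator hT).comp (measurable_const_add (a : E))
  have := vaddInvariantMeasure_submodule (L := L) (μ := μ)
  have hv : ∀ (a : L) (z : E), a +ᵥ z = (a : E) + z := fun _ _ => rfl
  rw [← lintegral_indicator_one hT, hF.lintegral_eq_tsum'']
  simp only [hv]
  rw [← lintegral_tsum fun a => (hm a).aemeasurable, ← setLIntegral_const]
  refine lintegral_mono fun z => ?_
  obtain ⟨l, hl⟩ := h z
  rw [← (Equiv.addRight l).tsum_eq fun a : L => T.indicator (1 : E → ℝ≥0∞) (a + z)]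
  refine ENNReal.tsum_le_tsum fun a => ?_
  by_cases ha : (a : E) ∈ S
  · have := hl a ha
    rw [← add_assoc] at this
    simp [ha, this]
  · simp [ha]

lemma measure_le_tsum_indicator_mul (hF : IsAddFundamentalDomain L F μ) {S T : Set E}
    (hT : MeasurableSet T) (h : ∀ z, ∃ l : L, ∀ a : L, (a : E) + (l + z) ∈ T → (a : E) ∈ S) :
    μ T ≤ (∑' a : L, S.indicator (1 : E → ℝ≥0∞) a) * μ F := by
  have hm : ∀ a : L, Measurable fun z : E => T.indicator (1 : E → ℝ≥0∞) (a + z) := fun a =>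
    (measurable_one.indicator hT).comp (measurable_const_add (a : E))
  have := vaddInvariantMeasure_submodule (L := L) (μ := μ)
  have hv : ∀ (a : L) (z : E), a +ᵥ z = (a : E) + z := fun _ _ => rfl
  rw [← lintegral_indicator_one hT, hF.lintegral_eq_tsum'']
  simp only [hv]
  rw [← lintegral_tsum fun a => (hm a).aemeasurable, ← setLIntegral_const]
  refine lintegral_mono fun z => ?_
  obtain ⟨l, hl⟩ := h z
  rw [← (Equiv.addRight l).tsum_eq fun a : L => T.indicator (1 : E → ℝ≥0∞) (a + z)]
  refine ENNReal.tsum_le_tsum fun a => ?_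
  by_cases ha : (a : E) + (l + z) ∈ T
  · have := hl a ha
    rw [← add_assoc] at ha
    simp [ha, this]
  · rw [← add_assoc] at ha
    simp [ha]

end LatticeCount

section BoxCount

open NumberField mixedEmbedding MeasureTheory Module InfinitePlace Real
open scoped ENNReal Classical

lemma mem_convexBodyLT_iff {K : Type*} [Field K] {f : InfinitePlace K → NNReal} {z : mixedSpace K} :
    z ∈ convexBodyLT K f ↔ ∀ w, normAtPlace w z < f w := by
  simp only [Set.mem_prod, Set.mem_univ_pi, mem_ball_zero_iff, Subtype.forall]
  constructor
  · rintro ⟨h1, h2⟩ w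
    by_cases hw : IsReal w
    · rw [normAtPlace_apply_of_isReal hw]
      exact h1 w hw
    · rw [normAtPlace_apply_of_isComplex (not_isReal_iff_isComplex.1 hw)]
      exact h2 w (not_isReal_iff_isComplex.1 hw)
  · refine fun h => ⟨fun w hw => ?_, fun w hw => ?_⟩
    · rw [← normAtPlace_apply_of_isReal hw]
      exact h w
    · rw [← normAtPlace_apply_of_isComplex hw]
      exact h w

variable {K : Type*} [Field K] [NumberField K]

lemma span_mixedEmbedding_eq_top {ι : Type*} {v : ι → K} (hv : Submodule.span ℚ (Set.range v) = ⊤) :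
    Submodule.span ℝ (Set.range fun i => mixedEmbedding K (v i)) = ⊤ := by
  have h : ∀ x : K, mixedEmbedding K x ∈
      Submodule.span ℝ (Set.range fun i => mixedEmbedding K (v i)) := fun x => by
    have hx : x ∈ Submodule.span ℚ (Set.range v) := hv ▸ Submodule.mem_top
    induction hx using Submodule.span_induction with
    | mem x hx =>
      obtain ⟨i, rfl⟩ := hx
      exact Submodule.subset_span ⟨i, rfl⟩
    | zero => simp
    | add x y _ _ hx hy =>
      rw [map_add]
      exact Submodule.add_mem _ hx hy
    | smul a x _ hx =>
      have : mixedEmbedding K (a • x) = (a : ℝ) • mixedEmbedding K x := by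
        rw [Algebra.smul_def, map_mul]
        ext <;> simp
      rw [this]
      exact Submodule.smul_mem _ _ hx
  refine top_unique ((latticeBasis K).span_eq ▸ Submodule.span_le.2 ?_)
  rintro _ ⟨i, rfl⟩
  rw [latticeBasis_apply]
  exact h _

lemma span_mul_eq_top {ι : Type*} {v : ι → K} (hv : Submodule.span ℚ (Set.range v) = ⊤) {x : K}
    (hx : x ≠ 0) : Submodule.span ℚ (Set.range fun i => x * v i) = ⊤ := by
  have : (Set.range fun i => x * v i) = LinearMap.mulLeft ℚ x '' Set.range v := by
    rw [← Set.range_comp]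
    rfl
  rw [this, Submodule.span_image, hv, Submodule.map_top, LinearMap.range_eq_top]
  exact fun y => ⟨x⁻¹ * y, by simp [hx]⟩

/-- Every point is close to a lattice generated by small vectors. -/
lemma exists_normAtPlace_add_le {ι : Type*} [Fintype ι] {v : ι → K}
    (hv : Submodule.span ℚ (Set.range v) = ⊤) (z : mixedSpace K) :
    ∃ m : ι → ℤ, ∀ w, normAtPlace w (mixedEmbedding K (∑ i, m i • v i) + z) ≤ ∑ i, w (v i) := by
  have hz : z ∈ Submodule.span ℝ (Set.range fun i => mixedEmbedding K (v i)) :=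
    span_mixedEmbedding_eq_top hv ▸ Submodule.mem_top
  obtain ⟨r, rfl⟩ := (Submodule.mem_span_range_iff_exists_fun ℝ).1 hz
  refine ⟨fun i => -⌊r i⌋, fun w => ?_⟩
  have h1 : mixedEmbedding K (∑ i, -⌊r i⌋ • v i) + ∑ i, r i • mixedEmbedding K (v i) =
      ∑ i, Int.fract (r i) • mixedEmbedding K (v i) := by
    rw [map_sum, ← Finset.sum_add_distrib]
    refine Finset.sum_congr rfl fun i _ => ?_
    rw [map_zsmul, ← Int.cast_smul_eq_zsmul ℝ, ← add_smul, Int.fract]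
    congr 1
    push_cast
    ring
  have h2 : ∀ (s : Finset ι) (f : ι → mixedSpace K),
      normAtPlace w (∑ i ∈ s, f i) ≤ ∑ i ∈ s, normAtPlace w (f i) := fun s f =>
    Finset.le_sum_of_subadditive _ (map_zero (normAtPlace w)).le (normAtPlace_add_le w) s f
  rw [h1]
  refine (h2 _ _).trans (Finset.sum_le_sum fun i _ => ?_)
  rw [normAtPlace_smul, normAtPlace_apply, abs_of_nonneg (Int.fract_nonneg _)]
  exact mul_le_of_le_one_left (apply_nonneg _ _) (Int.fract_lt_one _).le

/-- The number of nonzero elements of `𝔟` in the box of shape `y`. -/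
noncomputable def boxCount (𝔟 : Ideal (𝓞 K)) (y : InfinitePlace K → ℝ) : ℝ≥0∞ :=
  ∑' α : {α : 𝓞 K // α ∈ 𝔟 ∧ α ≠ 0}, if ∀ w, w (α.1 : K) ≤ y w then 1 else 0

variable (K) in
/-- The density of a lattice given by an ideal relative to its norm. -/
noncomputable def boxDensity : ℝ :=
  convexBodyLTFactor K * 2 ^ nrComplexPlaces K / √|(discr K : ℝ)|

lemma tsum_idealLattice_eq {𝔟 : Ideal (𝓞 K)} (h𝔟 : 𝔟 ≠ ⊥) {y : InfinitePlace K → ℝ}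
    (hy : ∀ w, 0 ≤ y w) :
    ∑' a : idealLattice K (FractionalIdeal.mk0 K ⟨𝔟, mem_nonZeroDivisors_of_ne_zero h𝔟⟩),
      {z : mixedSpace K | ∀ w, normAtPlace w z ≤ y w}.indicator (1 : mixedSpace K → ℝ≥0∞) a =
      boxCount 𝔟 y + 1 := by
  set I := FractionalIdeal.mk0 K ⟨𝔟, mem_nonZeroDivisors_of_ne_zero h𝔟⟩ with hI
  have hmem : ∀ α : 𝓞 K, α ∈ 𝔟 → mixedEmbedding K α ∈ idealLattice K I := fun α hα =>
    (mem_idealLattice K I).2 ⟨α, by simpa [hI] using hα, rfl⟩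
  let g : {α : 𝓞 K // α ∈ 𝔟} → idealLattice K I := fun α => ⟨_, hmem α.1 α.2⟩
  have hg : Function.Bijective g := by
    refine ⟨fun a b h => ?_, fun z => ?_⟩
    · exact Subtype.ext (RingOfIntegers.ext
        (mixedEmbedding_injective K (congrArg Subtype.val h)))
    · obtain ⟨x, hx, hxz⟩ := (mem_idealLattice K I).1 z.2
      have : x ∈ ((𝔟 : FractionalIdeal (nonZeroDivisors (𝓞 K)) K)) := by simpa [hI] using hx
      obtain ⟨α, hα, rfl⟩ := (FractionalIdeal.mem_coeIdeal _).1 this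
      exact ⟨⟨α, hα⟩, Subtype.ext hxz⟩
  rw [← (Equiv.ofBijective g hg).tsum_eq]
  have h1 : ∀ α : {α : 𝓞 K // α ∈ 𝔟},
      {z : mixedSpace K | ∀ w, normAtPlace w z ≤ y w}.indicator (1 : mixedSpace K → ℝ≥0∞)
        (Equiv.ofBijective g hg α) = if ∀ w, w (α.1 : K) ≤ y w then 1 else 0 := fun α => by
    simp only [Set.indicator_apply, Set.mem_ofPred_eq, Equiv.ofBijective_apply, g,
      normAtPlace_apply,
      Pi.one_apply]
  simp only [h1]
  have h2 := tsum_subtype {α : 𝓞 K | α ∈ 𝔟}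
    fun α => if ∀ w : InfinitePlace K, w (α : K) ≤ y w then (1 : ℝ≥0∞) else 0
  have h3 := tsum_subtype {α : 𝓞 K | α ∈ 𝔟 ∧ α ≠ 0}
    fun α => if ∀ w : InfinitePlace K, w (α : K) ≤ y w then (1 : ℝ≥0∞) else 0
  refine h2.trans ?_
  rw [boxCount, ENNReal.tsum_eq_add_tsum_ite 0, add_comm]
  congr 1
  · refine (tsum_congr fun α => ?_).trans h3.symm
    by_cases hα : α = 0 <;> simp [Set.indicator_apply, hα]
  · rw [Set.indicator_of_mem (show (0 : 𝓞 K) ∈ {α : 𝓞 K | α ∈ 𝔟} from 𝔟.zero_mem), if_pos]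
    simpa using hy

lemma boxCount_add_one_bounds {ι : Type*} [Fintype ι] {ω : ι → 𝓞 K}
    (hω : Submodule.span ℚ (Set.range fun i => (ω i : K)) = ⊤) {B : ℝ}
    (hB : ∀ i (w : InfinitePlace K), w (ω i : K) ≤ B) {𝔟 : Ideal (𝓞 K)} (h𝔟 : 𝔟 ≠ ⊥) {x : 𝓞 K}
    (hx : x ∈ 𝔟) (hx0 : x ≠ 0) {y : InfinitePlace K → ℝ} (hy : ∀ w, 0 < y w) {δ : ℝ}
    (hδ : ∀ w : InfinitePlace K, w (x : K) * (Fintype.card ι * B) < δ * y w) {V : ℝ}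
    (hV : ∏ w, y w ^ w.mult = V * Ideal.absNorm 𝔟) :
    boxCount 𝔟 y + 1 ≤ ENNReal.ofReal (boxDensity K * V * (1 + δ) ^ finrank ℚ K) ∧
      (δ ≤ 1 → ENNReal.ofReal (boxDensity K * V * (1 - δ) ^ finrank ℚ K) ≤ boxCount 𝔟 y + 1) := by
  set I := FractionalIdeal.mk0 K ⟨𝔟, mem_nonZeroDivisors_of_ne_zero h𝔟⟩ with hI
  set F := ZSpan.fundamentalDomain (fractionalIdealLatticeBasis K I) with hF
  have hFd := fundamentalDomain_idealLattice K I
  have hD : 0 < √|(discr K : ℝ)| := sqrt_pos.2 (abs_pos.2 (Int.cast_ne_zero.2 (discr_ne_zero K)))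
  have hN : (0 : ℝ) < Ideal.absNorm 𝔟 := by
    exact_mod_cast Nat.pos_of_ne_zero fun h => h𝔟 (Ideal.absNorm_eq_zero_iff.1 h)
  have hFv : volume F = ENNReal.ofReal (Ideal.absNorm 𝔟 * 2⁻¹ ^ nrComplexPlaces K *
      √|(discr K : ℝ)|) := by
    have h1 := ZLattice.covolume_eq_measure_fundamentalDomain (idealLattice K I) volume hFd
    rw [covolume_idealLattice] at h1
    have h2 : ((FractionalIdeal.absNorm (I : FractionalIdeal (nonZeroDivisors (𝓞 K)) K) : ℚ) : ℝ) =
        Ideal.absNorm 𝔟 := by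
      simp [hI, FractionalIdeal.coeIdeal_absNorm]
    rw [h2] at h1
    rw [h1, Measure.real, ENNReal.ofReal_toReal]
    exact (ZSpan.fundamentalDomain_isBounded _).measure_lt_top.ne
  have hF0 : volume F ≠ 0 := by
    rw [hFv]
    exact (ENNReal.ofReal_pos.2 (by positivity)).ne'
  have hFt : volume F ≠ ⊤ := hFv ▸ ENNReal.ofReal_ne_top
  have hvol : ∀ t : ℝ, 0 ≤ t → volume (convexBodyLT K fun w => (t * y w).toNNReal) =
      ENNReal.ofReal (boxDensity K * V * t ^ finrank ℚ K) * volume F := fun t ht => by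
    have h1 : ((∏ w, (t * y w).toNNReal ^ w.mult : NNReal) : ℝ) =
        t ^ finrank ℚ K * (V * Ideal.absNorm 𝔟) := by
      push_cast
      simp only [Real.coe_toNNReal _ (mul_nonneg ht (hy _).le), mul_pow]
      rw [Finset.prod_mul_distrib, hV, Finset.prod_pow_eq_pow_sum, sum_mult_eq]
    rw [convexBodyLT_volume, hFv, ← ENNReal.ofReal_mul' (by positivity), ← ENNReal.coe_mul,
      ← ENNReal.ofReal_coe_nnreal, NNReal.coe_mul, h1, boxDensity]
    congr 1
    field_simp
    rw [mul_assoc (t ^ _ * V), ← mul_pow]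
    norm_num
  have hmT : ∀ f, MeasurableSet (convexBodyLT K f) := fun f =>
    ((isOpen_set_pi Set.finite_univ fun _ _ => Metric.isOpen_ball).prod
      (isOpen_set_pi Set.finite_univ fun _ _ => Metric.isOpen_ball)).measurableSet
  have hcov : ∀ z : mixedSpace K, ∃ l : idealLattice K I, ∀ w,
      normAtPlace w ((l : mixedSpace K) + z) < δ * y w := fun z => by
    obtain ⟨m, hm⟩ := exists_normAtPlace_add_le
      (span_mul_eq_top hω (x := (x : K)) (by simpa using hx0)) z
    refine ⟨⟨_, (mem_idealLattice K I).2 ⟨_, ?_, rfl⟩⟩, fun w => (hm w).trans_lt ?_⟩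
    · have h1 : (x * ∑ i, m i • ω i : 𝓞 K) ∈ 𝔟 := Ideal.mul_mem_right _ _ hx
      have h2 : ∑ i, m i • ((x : K) * ω i) = ((x * ∑ i, m i • ω i : 𝓞 K) : K) := by
        simp [Finset.mul_sum, map_sum, mul_left_comm]
      rw [h2, hI, FractionalIdeal.coe_mk0]
      exact (FractionalIdeal.mem_coeIdeal _).2 ⟨_, h1, rfl⟩
    · refine lt_of_le_of_lt ?_ (hδ w)
      calc ∑ i, w ((x : K) * ω i) ≤ ∑ _i : ι, w (x : K) * B := Finset.sum_le_sum fun i _ => by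
            rw [map_mul]
            exact mul_le_mul_of_nonneg_left (hB i w) (apply_nonneg _ _)
        _ = _ := by
            rw [Finset.sum_const, Finset.card_univ, nsmul_eq_mul]
            ring
  have hδ0 : 0 ≤ δ := by
    obtain ⟨l, hl⟩ := hcov 0
    let w : InfinitePlace K := Classical.arbitrary _
    exact (pos_of_mul_pos_left ((normAtPlace_nonneg w _).trans_lt (hl w)) (hy w).le).le
  rw [← tsum_idealLattice_eq h𝔟 fun w => (hy w).le]
  constructor
  · rw [← ENNReal.mul_le_mul_iff_left hF0 hFt, ← hvol _ (by linarith)]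
    refine tsum_indicator_mul_measure_le hFd (hmT _) fun z => ?_
    obtain ⟨l, hl⟩ := hcov z
    refine ⟨l, fun a ha => mem_convexBodyLT_iff.2 fun w => ?_⟩
    rw [Real.coe_toNNReal _ (mul_nonneg (by linarith) (hy w).le)]
    have h1 := normAtPlace_add_le w a (l + z)
    have h2 : normAtPlace w (a : mixedSpace K) ≤ y w := ha w
    linarith [hl w]
  · intro hδ1
    rw [← ENNReal.mul_le_mul_iff_left hF0 hFt, ← hvol _ (by linarith)]
    refine measure_le_tsum_indicator_mul hFd (hmT _) fun z => ?_
    obtain ⟨l, hl⟩ := hcov z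
    refine ⟨l, fun a ha w => ?_⟩
    have h3 := mem_convexBodyLT_iff.1 ha w
    rw [Real.coe_toNNReal _ (mul_nonneg (by linarith) (hy w).le)] at h3
    have h1 := normAtPlace_add_le w (a + (l + z)) (-(l + z))
    rw [normAtPlace_neg, add_neg_cancel_right] at h1
    linarith [hl w]

lemma one_add_div_pow_le {x s : ℝ} (hx : 0 ≤ x) (hs : 1 ≤ s) (d : ℕ) :
    (1 + x / s) ^ d ≤ 1 + ((1 + x) ^ d - 1) / s := by
  have hs0 : 0 < s := by linarith
  induction d with
  | zero => simp
  | succ d ih =>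
    set A := (1 + x) ^ d - 1 with hA
    have hA0 : 0 ≤ A := sub_nonneg.2 (one_le_pow₀ (by linarith))
    have h1 : (1 + x) ^ (d + 1) - 1 = x + A + A * x := by
      rw [hA, pow_succ]
      ring
    have h2 : A * x / s / s ≤ A * x / s := div_le_self (by positivity) hs
    rw [pow_succ, h1]
    calc (1 + x / s) ^ d * (1 + x / s) ≤ (1 + A / s) * (1 + x / s) := by gcongr
      _ = 1 + x / s + A / s + A * x / s / s := by
        field_simp
        ring
      _ ≤ 1 + x / s + A / s + A * x / s := by linarith
      _ = _ := by ring

variable (K) in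
lemma boxDensity_pos : 0 < boxDensity K := by
  have hD : 0 < √|(discr K : ℝ)| := sqrt_pos.2 (abs_pos.2 (Int.cast_ne_zero.2 (discr_ne_zero K)))
  have : (0 : ℝ) < convexBodyLTFactor K :=
    zero_lt_one.trans_le (by exact_mod_cast one_le_convexBodyLTFactor K)
  rw [boxDensity]
  positivity

variable (K) in
lemma one_le_boxDensity_mul : 1 ≤ boxDensity K * √|(discr K : ℝ)| := by
  have hD : 0 < √|(discr K : ℝ)| := sqrt_pos.2 (abs_pos.2 (Int.cast_ne_zero.2 (discr_ne_zero K)))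
  have h1 : (1 : ℝ) ≤ convexBodyLTFactor K := by exact_mod_cast one_le_convexBodyLTFactor K
  rw [boxDensity, div_mul_cancel₀ _ hD.ne']
  exact one_le_mul_of_one_le_of_one_le h1 (one_le_pow₀ one_le_two)

lemma boxCount_eq_zero {𝔟 : Ideal (𝓞 K)} {y : InfinitePlace K → ℝ}
    (hV : ∏ w, y w ^ w.mult < Ideal.absNorm 𝔟) : boxCount 𝔟 y = 0 := by
  refine ENNReal.tsum_eq_zero.2 fun α => if_neg fun h => hV.not_ge ?_
  have h1 : Ideal.absNorm 𝔟 ≤ Ideal.absNorm (Ideal.span {α.1}) :=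
    Nat.le_of_dvd (Nat.pos_of_ne_zero fun h => α.2.2
      (Ideal.span_singleton_eq_bot.1 (Ideal.absNorm_eq_zero_iff.1 h)))
      (Ideal.absNorm_dvd_absNorm_of_le ((Ideal.span_singleton_le_iff_mem _).2 α.2.1))
  calc (Ideal.absNorm 𝔟 : ℝ) ≤ Ideal.absNorm (Ideal.span {α.1}) := by exact_mod_cast h1
    _ = ∏ w : InfinitePlace K, w (α.1 : K) ^ w.mult := (prod_place_eq_absNorm _).symm
    _ ≤ _ := Finset.prod_le_prod (fun w _ => by positivity) fun w _ =>
      pow_le_pow_left₀ (apply_nonneg _ _) (h w) _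

variable (K) in
/-- The constant controlling the error term in the box count. -/
noncomputable def boxErr (B : ℝ) : ℝ :=
  (1 + 2 * √|(discr K : ℝ)| * (finrank ℚ K * B)) ^ finrank ℚ K + √|(discr K : ℝ)|

theorem boxCount_bounds {ι : Type*} [Fintype ι] {ω : ι → 𝓞 K}
    (hω : Submodule.span ℚ (Set.range fun i => (ω i : K)) = ⊤) (hι : Fintype.card ι = finrank ℚ K)
    {B : ℝ} (hB1 : 0 < B) (hB : ∀ i (w : InfinitePlace K), w (ω i : K) ≤ B)
    {𝔟 : Ideal (𝓞 K)} (h𝔟 : 𝔟 ≠ ⊥) {y : InfinitePlace K → ℝ} (hy : ∀ w, 0 < y w) {u : ℝ}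
    (hV : ∏ w, y w ^ w.mult = exp u * Ideal.absNorm 𝔟) :
    ENNReal.ofReal (boxDensity K * exp u -
      boxDensity K * boxErr K B * exp ((1 - 1 / finrank ℚ K) * u)) ≤ boxCount 𝔟 y ∧
    boxCount 𝔟 y ≤ ENNReal.ofReal (boxDensity K * exp u +
      boxDensity K * boxErr K B * exp ((1 - 1 / finrank ℚ K) * u)) := by
  set d := finrank ℚ K with hd
  have hd0 : 0 < d := finrank_pos
  have hd1 : (1 : ℝ) ≤ d := by exact_mod_cast hd0
  set c := boxDensity K with hc
  have hc0 : 0 < c := boxDensity_pos K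
  set R := √|(discr K : ℝ)| with hR
  have hcR : 1 ≤ c * R := one_le_boxDensity_mul K
  have hR1 : 1 ≤ 2 * R := one_le_two_mul_sqrt_discr
  have hR0 : 0 < R := by linarith
  set x₁ := 2 * R * (d * B) with hx₁
  have hx₁0 : 0 < x₁ := by positivity
  have hQ : boxErr K B = (1 + x₁) ^ d + R := rfl
  set s := exp (u / d) with hs
  have hs0 : 0 < s := exp_pos _
  have hsd : s ^ d = exp u := by
    rw [hs, ← exp_nat_mul]
    congr 1
    field_simp
  have hE : exp ((1 - 1 / d) * u) = exp u / s := by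
    rw [hs, ← exp_sub]
    congr 1
    field_simp
  have hN : (0 : ℝ) < Ideal.absNorm 𝔟 := by
    exact_mod_cast Nat.pos_of_ne_zero fun h => h𝔟 (Ideal.absNorm_eq_zero_iff.1 h)
  rw [hE, hQ]
  have hp1 : 1 ≤ (1 + x₁) ^ d := one_le_pow₀ (by linarith)
  rcases lt_or_ge u 0 with hu | hu
  · have h1 : boxCount 𝔟 y = 0 := boxCount_eq_zero (by
      rw [hV]
      exact mul_lt_of_lt_one_left hN (exp_lt_one_iff.2 hu))
    have hs1 : s ≤ 1 := exp_le_one_iff.2 (div_nonpos_of_nonpos_of_nonneg hu.le (by linarith))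
    rw [h1]
    refine ⟨(ENNReal.ofReal_eq_zero.2 ?_).le, zero_le⟩
    have h2 : exp u ≤ exp u / s := by
      rw [le_div_iff₀ hs0]
      exact mul_le_of_le_one_right (exp_pos _).le hs1
    have h3 : exp u / s ≤ ((1 + x₁) ^ d + R) * (exp u / s) :=
      le_mul_of_one_le_left (by positivity) (by linarith)
    nlinarith
  have hs1 : 1 ≤ s := one_le_exp (by positivity)
  set δ := x₁ / s with hδ
  have hδ0 : 0 < δ := by positivity
  obtain ⟨x, hx𝔟, hx0, hx⟩ := exists_ne_zero_mem_lt_of_norm_mul_sqrt_lt h𝔟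
    (y := fun w => 2 * R / s * y w) (fun w => by have := hy w; positivity) (by
      simp only [mul_pow, Finset.prod_mul_distrib]
      rw [hV, Finset.prod_pow_eq_pow_sum, sum_mult_eq, ← hd, div_pow, hsd, ← hR]
      have h1 : R < (2 * R) ^ d := lt_of_lt_of_le (by linarith) (le_self_pow₀ hR1 hd0.ne')
      have := exp_pos u
      field_simp
      rwa [mul_comm R 2])
  obtain ⟨h1, h2⟩ := boxCount_add_one_bounds hω hB h𝔟 hx𝔟 hx0 hy (δ := δ) (V := exp u) (fun w => by
    rw [hι]
    calc w (x : K) * (d * B) < 2 * R / s * y w * (d * B) :=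
          mul_lt_mul_of_pos_right (hx w) (by positivity)
      _ = _ := by
          rw [hδ, hx₁]
          ring) hV
  have hes : 1 ≤ exp u / s := by
    rw [le_div_iff₀ hs0, one_mul, ← hsd]
    exact le_self_pow₀ hs1 hd0.ne'
  have hceu : 0 < c * exp u := by positivity
  constructor
  · rcases le_or_gt δ 1 with hδ1 | hδ1
    · have h3 := h2 hδ1
      have h4 : 1 - d * δ ≤ (1 - δ) ^ d := by
        have := one_add_mul_le_pow (a := -δ) (by linarith) d
        rw [sub_eq_add_neg 1 δ]
        linarith
      have h5 : 1 + d * x₁ ≤ (1 + x₁) ^ d := by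
        have := one_add_mul_le_pow (a := x₁) (by linarith) d
        linarith
      have h6 : c * exp u - c * ((1 + x₁) ^ d + R) * (exp u / s) + 1 ≤ c * exp u * (1 - δ) ^ d := by
        have h7 : c * exp u * (1 - d * δ) ≤ c * exp u * (1 - δ) ^ d := by gcongr
        have h8 : c * exp u * (1 - d * δ) = c * exp u - c * (d * x₁) * (exp u / s) := by
          rw [hδ]
          field_simp
        have h9 : c * (d * x₁) * (exp u / s) ≤ c * (1 + x₁) ^ d * (exp u / s) := by
          gcongr
          linarith
        have h10 : 1 ≤ c * R * (exp u / s) := one_le_mul_of_one_le_of_one_le hcR hes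
        linarith
      have h11 : ENNReal.ofReal (c * exp u - c * ((1 + x₁) ^ d + R) * (exp u / s)) + 1 ≤
          boxCount 𝔟 y + 1 ∨ c * exp u - c * ((1 + x₁) ^ d + R) * (exp u / s) ≤ 0 := by
        rcases le_total (c * exp u - c * ((1 + x₁) ^ d + R) * (exp u / s)) 0 with h | h
        · exact Or.inr h
        · refine Or.inl (le_trans ?_ h3)
          rw [← ENNReal.ofReal_one, ← ENNReal.ofReal_add h zero_le_one]
          exact ENNReal.ofReal_le_ofReal h6
      rcases h11 with h | h
      · exact (ENNReal.add_le_add_iff_right ENNReal.one_ne_top).1 h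
      · rw [ENNReal.ofReal_eq_zero.2 h]
        exact zero_le
    · have hxs : s < x₁ := by rwa [hδ, lt_div_iff₀ hs0, one_mul] at hδ1
      have h3 : s ≤ (1 + x₁) ^ d + R := by
        have : 1 + x₁ ≤ (1 + x₁) ^ d := le_self_pow₀ (by linarith) hd0.ne'
        linarith
      rw [ENNReal.ofReal_eq_zero.2]
      · exact zero_le
      · have : c * exp u = c * s * (exp u / s) := by field_simp
        rw [this, sub_nonpos]
        gcongr
  · refine (self_le_add_right _ _).trans (h1.trans (ENNReal.ofReal_le_ofReal ?_))
    calc c * exp u * (1 + δ) ^ d ≤ c * exp u * (1 + ((1 + x₁) ^ d - 1) / s) := by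
          gcongr
          exact one_add_div_pow_le hx₁0.le hs1 d
      _ = c * exp u + c * ((1 + x₁) ^ d - 1) * (exp u / s) := by field_simp
      _ ≤ _ := by
          gcongr
          linarith

end BoxCount

section RieszVolume

open MeasureTheory Module Real
open scoped ENNReal Nat Pointwise

/-- The standard simplex with vertex at the origin. -/
def cornerSimplex (ι : Type*) [Fintype ι] (R : ℝ) : Set (ι → ℝ) :=
  {s | (∀ i, 0 ≤ s i) ∧ ∑ i, s i ≤ R}

variable {ι : Type*} [Fintype ι]

lemma cornerSimplex_eq_smul {R : ℝ} (hR : 0 ≤ R) :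
    cornerSimplex ι R = R • cornerSimplex ι 1 := by
  rcases hR.eq_or_lt with rfl | hR
  · rw [Set.zero_smul_set ⟨0, by simp [cornerSimplex]⟩]
    refine Set.eq_singleton_iff_unique_mem.2 ⟨by simp [cornerSimplex], fun s hs => ?_⟩
    have h := (Finset.sum_eq_zero_iff_of_nonneg fun i _ => hs.1 i).1
      (le_antisymm hs.2 (Finset.sum_nonneg fun i _ => hs.1 i))
    exact funext fun i => h i (Finset.mem_univ i)
  · ext s
    rw [Set.mem_smul_set_iff_inv_smul_mem₀ hR.ne']
    simp only [cornerSimplex, Set.mem_ofPred_eq, Pi.smul_apply, smul_eq_mul, ← Finset.mul_sum,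
      inv_mul_le_one₀ hR]
    simp only [inv_pos.2 hR, mul_nonneg_iff_of_pos_left]

variable (ι) in
/-- The constant relating volumes of simplices to the Riesz kernel. -/
noncomputable def simplexConst : ℝ≥0∞ := (Fintype.card ι)! * volume (cornerSimplex ι 1)

lemma simplexConst_ne_top : simplexConst ι ≠ ⊤ := by
  refine ENNReal.mul_ne_top (by simp) ?_
  refine (measure_mono (t := Metric.closedBall 0 1) fun s hs => ?_).trans_lt
    measure_closedBall_lt_top |>.ne
  rw [mem_closedBall_zero_iff, pi_norm_le_iff_of_nonneg zero_le_one]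
  intro i
  rw [norm_of_nonneg (hs.1 i)]
  exact (Finset.single_le_sum (fun i _ => hs.1 i) (Finset.mem_univ i)).trans hs.2

lemma simplexConst_ne_zero : simplexConst ι ≠ 0 := by
  refine mul_ne_zero (by simp [Nat.factorial_ne_zero]) ?_
  have hδ : (0 : ℝ) < 1 / (Fintype.card ι + 1) := by positivity
  have h : (0 : ℝ≥0∞) <
      volume (Set.univ.pi fun _ : ι => Set.Icc (0 : ℝ) (1 / (Fintype.card ι + 1))) := by
    rw [volume_pi_pi]
    refine pos_iff_ne_zero.2 (Finset.prod_ne_zero_iff.2 fun i _ => ?_)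
    simp [Real.volume_Icc]
    positivity
  refine (h.trans_le (measure_mono fun s hs => show s ∈ cornerSimplex ι 1 from
    ⟨fun i => (hs i trivial).1, ?_⟩)).ne'
  calc ∑ i, s i ≤ ∑ _i : ι, 1 / ((Fintype.card ι : ℝ) + 1) :=
    Finset.sum_le_sum fun i _ => (hs i trivial).2
    _ = Fintype.card ι / (Fintype.card ι + 1) := by simp [div_eq_mul_inv]
    _ ≤ 1 := by
      rw [div_le_one (by positivity)]
      linarith

lemma volume_setOf_le_and_sum_le (A : ι → ℝ) (a : ℝ) :
    volume {t : ι → ℝ | (∀ i, A i ≤ t i) ∧ a ≤ -∑ i, t i} =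
      ENNReal.ofReal (rieszKer (Fintype.card ι) (-(∑ i, A i + a))) * simplexConst ι := by
  have h1 : {t : ι → ℝ | (∀ i, A i ≤ t i) ∧ a ≤ -∑ i, t i} =
      (fun t => t + -A) ⁻¹' cornerSimplex ι (-(∑ i, A i + a)) := by
    ext t
    simp only [cornerSimplex, Set.mem_ofPred_eq, Set.mem_preimage, ← sub_eq_add_neg, Pi.sub_apply,
      Finset.sum_sub_distrib, sub_nonneg]
    refine and_congr_right fun _ => ?_
    constructor <;> intro h <;> linarith
  rw [h1, measure_preimage_add_right]
  set R := -(∑ i, A i + a)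
  rw [rieszKer]
  split_ifs with hR
  · rw [cornerSimplex_eq_smul hR, Measure.addHaar_smul, finrank_pi, simplexConst,
      abs_of_nonneg (by positivity),
      ← mul_assoc, ENNReal.ofReal_div_of_pos (by positivity)]
    congr 1
    rw [ENNReal.ofReal_natCast, ENNReal.div_mul_cancel (by simp [Nat.factorial_ne_zero]) (by simp)]
  · rw [ENNReal.ofReal_zero, zero_mul]
    convert measure_empty (μ := (volume : Measure (ι → ℝ)))
    exact Set.eq_empty_of_forall_notMem fun s hs =>
      hR ((Finset.sum_nonneg fun i _ => hs.1 i).trans hs.2)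

lemma tsum_comp_addMonoidHom {A B : Type*} [AddGroup A] [AddGroup B] (q : A →+ B)
    (hq : Function.Surjective q) (f : B → ℝ≥0∞) [Finite q.ker] :
    ∑' a, f (q a) = Nat.card q.ker * ∑' b, f b := by
  rw [← (Equiv.sigmaFiberEquiv q).tsum_eq, ENNReal.tsum_sigma', ← ENNReal.tsum_mul_left]
  refine tsum_congr fun b => ?_
  obtain ⟨a, rfl⟩ := hq b
  let e : q.ker ≃ {x // q x = q a} :=
    { toFun := fun x => ⟨x.1 + a, by simp [(AddMonoidHom.mem_ker).1 x.2]⟩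
      invFun := fun x => ⟨x.1 - a, by simp [AddMonoidHom.mem_ker, x.2]⟩
      left_inv := fun x => by simp
      right_inv := fun x => by simp }
  have h : ∀ x : {x // q x = q a}, f (q (Equiv.sigmaFiberEquiv q ⟨q a, x⟩)) = f (q a) := fun x =>
    congrArg f x.2
  simp only [h]
  rw [← e.tsum_eq]
  have := Fintype.ofFinite q.ker
  rw [tsum_fintype, Finset.sum_const, Finset.card_univ, nsmul_eq_mul, Nat.card_eq_fintype_card]

end RieszVolume

section UnitIntegral

open NumberField MeasureTheory Module InfinitePlace Real NumberField.Units
  NumberField.Units.dirichletUnitTheorem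
open scoped ENNReal Classical

variable {K : Type*} [Field K] [NumberField K]

/-- Extension of a vector in `logSpace K` to all places with vanishing sum. -/
noncomputable def logExt (t : logSpace K) (w : InfinitePlace K) : ℝ :=
  if h : w ≠ w₀ then t ⟨w, h⟩ else -∑ v, t v

lemma logExt_ne (t : logSpace K) (w : {w : InfinitePlace K // w ≠ w₀}) : logExt t w = t w :=
  dif_pos w.2

lemma logExt_w₀ (t : logSpace K) : logExt t w₀ = -∑ v, t v := dif_neg (by simp)

lemma sum_logExt (t : logSpace K) : ∑ w, logExt t w = 0 := by
  rw [Fintype.sum_eq_add_sum_subtype_ne _ w₀, logExt_w₀]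
  simp [logExt_ne]

lemma logExt_sub (s t : logSpace K) (w : InfinitePlace K) :
    logExt (s - t) w = logExt s w - logExt t w := by
  unfold logExt
  split_ifs
  · rfl
  · simp only [Pi.sub_apply, Finset.sum_sub_distrib]
    ring

lemma logExt_logEmbedding (x : (𝓞 K)ˣ) (w : InfinitePlace K) :
    logExt (logEmbedding K (Additive.ofMul x)) w = w.mult * log (w (x : K)) := by
  by_cases hw : w = w₀
  · rw [hw, logExt_w₀, sum_logEmbedding_component]
    ring
  · exact logExt_ne _ ⟨w, hw⟩

lemma forall_le_logExt_iff (A : InfinitePlace K → ℝ) (t : logSpace K) :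
    (∀ w, A w ≤ logExt t w) ↔
      (∀ w : {w : InfinitePlace K // w ≠ w₀}, A w ≤ t w) ∧ A w₀ ≤ -∑ v, t v := by
  refine ⟨fun h => ⟨fun w => logExt_ne t w ▸ h w, logExt_w₀ t ▸ h w₀⟩, fun h w => ?_⟩
  by_cases hw : w = w₀
  · rw [hw, logExt_w₀]
    exact h.2
  · exact (h.1 ⟨w, hw⟩).trans_eq (logExt_ne t ⟨w, hw⟩).symm

lemma measurable_logExt (w : InfinitePlace K) : Measurable fun t : logSpace K => logExt t w := by
  unfold logExt
  split_ifs <;> fun_prop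

lemma measurableSet_logExt (A : InfinitePlace K → ℝ) :
    MeasurableSet {t : logSpace K | ∀ w, A w ≤ logExt t w} := by
  rw [Set.ofPred_forall]
  exact MeasurableSet.iInter fun w => measurableSet_le measurable_const (measurable_logExt w)

variable (K) in
/-- The rank of the unit group, as the dimension of the logarithmic space. -/
noncomputable def logRank : ℕ := Fintype.card {w : InfinitePlace K // w ≠ w₀}

variable (K) in
/-- The normalized volume of a simplex in the logarithmic space. -/
noncomputable def logConst : ℝ≥0∞ := simplexConst {w : InfinitePlace K // w ≠ w₀}

lemma volume_setOf_le_logExt (A : InfinitePlace K → ℝ) :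
    volume {t : logSpace K | ∀ w, A w ≤ logExt t w} =
      ENNReal.ofReal (rieszKer (logRank K) (-∑ w, A w)) * logConst K := by
  simp only [forall_le_logExt_iff]
  rw [volume_setOf_le_and_sum_le (fun w : {w : InfinitePlace K // w ≠ w₀} => A w),
    Fintype.sum_eq_add_sum_subtype_ne A w₀, add_comm (A w₀)]
  rfl

variable (K) in
/-- A fundamental domain for the unit lattice. -/
noncomputable def unitDomain : Set (logSpace K) :=
  ZSpan.fundamentalDomain
    ((Module.Free.chooseBasis ℤ (unitLattice K)).ofZLatticeBasis ℝ (unitLattice K))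

lemma isAddFundamentalDomain_unitDomain :
    IsAddFundamentalDomain (unitLattice K) (unitDomain K) volume :=
  ZLattice.isAddFundamentalDomain _ _

lemma volume_unitDomain_ne_top : volume (unitDomain K) ≠ ⊤ :=
  (ZSpan.fundamentalDomain_isBounded _).measure_lt_top.ne

lemma volume_unitDomain_ne_zero : volume (unitDomain K) ≠ 0 :=
  ZSpan.measure_fundamentalDomain_ne_zero _

lemma tsum_units_lintegral {S : Set (logSpace K)} (hS : MeasurableSet S) :
    ∑' x : (𝓞 K)ˣ, ∫⁻ t in unitDomain K,
      S.indicator (1 : logSpace K → ℝ≥0∞) (t - logEmbedding K (Additive.ofMul x)) =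
      Nat.card (torsion K) * volume S := by
  let q : Additive (𝓞 K)ˣ →+ unitLattice K :=
    (logEmbedding K).codRestrict (unitLattice K).toAddSubgroup fun x =>
      Submodule.mem_map_of_mem (f := (logEmbedding K).toIntLinearMap) Submodule.mem_top
  have hq : Function.Surjective q := by
    rintro ⟨_, x, -, rfl⟩
    exact ⟨x, rfl⟩
  have hker : q.ker = (torsion K).toAddSubgroup := by
    rw [← logEmbedding_ker]
    ext x
    simp only [AddMonoidHom.mem_ker]
    exact Subtype.ext_iff
  have hcard : Nat.card q.ker = Nat.card (torsion K) := by
    rw [hker]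
    rfl
  have : Finite q.ker := by
    rw [hker]
    exact inferInstanceAs (Finite (torsion K))
  have := vaddInvariantMeasure_submodule (L := unitLattice K) (μ := volume)
  rw [← hcard, ← lintegral_indicator_one hS, isAddFundamentalDomain_unitDomain.lintegral_eq_tsum',
    ← tsum_comp_addMonoidHom q hq]
  refine (Additive.ofMul.tsum_eq fun x : Additive (𝓞 K)ˣ => ∫⁻ t in unitDomain K,
    S.indicator (1 : logSpace K → ℝ≥0∞) (t - logEmbedding K x)).trans (tsum_congr fun x => ?_)
  refine lintegral_congr fun t => congrArg _ ?_
  rw [sub_eq_neg_add]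
  rfl

/-- The box attached to a point of the logarithmic space. -/
noncomputable def logBox (U : ℝ) (t : logSpace K) (w : InfinitePlace K) : ℝ :=
  exp (logExt t w / w.mult + U / finrank ℚ K)

lemma prod_logBox (U : ℝ) (t : logSpace K) : ∏ w, logBox U t w ^ w.mult = exp U := by
  have hd : (finrank ℚ K : ℝ) ≠ 0 := by exact_mod_cast (finrank_pos (R := ℚ) (M := K)).ne'
  have h : ∀ w : InfinitePlace K, logBox U t w ^ w.mult =
      exp (logExt t w + w.mult * (U / finrank ℚ K)) := fun w => by
    rw [logBox, ← exp_nat_mul]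
    congr 1
    have : (w.mult : ℝ) ≠ 0 := mult_coe_ne_zero
    field_simp
  simp only [h]
  rw [← exp_sum, Finset.sum_add_distrib, sum_logExt, ← Finset.sum_mul, ← Nat.cast_sum, sum_mult_eq]
  congr 1
  field_simp
  ring

/-- The logarithmic heights of an algebraic integer relative to a box. -/
noncomputable def logHeight (U : ℝ) (α : 𝓞 K) (w : InfinitePlace K) : ℝ :=
  w.mult * (log (w (α : K)) - U / finrank ℚ K)

lemma le_logBox_iff {U : ℝ} {α : 𝓞 K} (hα : α ≠ 0) (t : logSpace K) (w : InfinitePlace K) :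
    w (α : K) ≤ logBox U t w ↔ logHeight U α w ≤ logExt t w := by
  have hw : 0 < w (α : K) := w.pos_iff.2 (by simpa using hα)
  have hm : (0 : ℝ) < w.mult := by exact_mod_cast w.mult_pos
  rw [logBox, ← log_le_iff_le_exp hw, logHeight, ← sub_le_iff_le_add, le_div_iff₀ hm, mul_comm]

lemma sum_logHeight {U : ℝ} {α : 𝓞 K} (hα : α ≠ 0) :
    ∑ w, logHeight U α w = log (Ideal.absNorm (Ideal.span {α})) - U := by
  have hd : (finrank ℚ K : ℝ) ≠ 0 := by exact_mod_cast (finrank_pos (R := ℚ) (M := K)).ne'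
  rw [← prod_place_eq_absNorm,
    log_prod fun w _ => pow_ne_zero _ (w.pos_iff.2 (by simpa using hα)).ne']
  simp only [logHeight, log_pow, mul_sub, Finset.sum_sub_distrib]
  rw [← Finset.sum_mul, ← Nat.cast_sum, sum_mult_eq]
  field_simp

lemma logHeight_units_mul {U : ℝ} {α : 𝓞 K} (hα : α ≠ 0) (x : (𝓞 K)ˣ) (w : InfinitePlace K) :
    logHeight U ((x : 𝓞 K) * α) w =
      logHeight U α w + logExt (logEmbedding K (Additive.ofMul x)) w := by
  have hw : w (α : K) ≠ 0 := (w.pos_iff.2 (by simpa using hα)).ne'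
  have hx : w (x : K) ≠ 0 := (w.pos_iff.2 (by simp)).ne'
  have : w ((x * α : 𝓞 K) : K) = w (x : K) * w (α : K) := by simp
  rw [logExt_logEmbedding, logHeight, logHeight, this, log_mul hx hw]
  ring

/-- Ideals in the class inverse to that of `𝔟`, up to units, are elements of `𝔟`. -/
lemma exists_equiv_units_prod {𝔟 : Ideal (𝓞 K)} (h𝔟 : 𝔟 ≠ ⊥) :
    ∃ g : {I : Ideal (𝓞 K) // I ≠ ⊥ ∧ (I * 𝔟).IsPrincipal} → 𝓞 K,
      (∀ I, Ideal.span {g I} = I.1 * 𝔟) ∧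
      ∃ e : {I : Ideal (𝓞 K) // I ≠ ⊥ ∧ (I * 𝔟).IsPrincipal} × (𝓞 K)ˣ ≃ {α : 𝓞 K // α ∈ 𝔟 ∧ α ≠ 0},
        ∀ I x, (e (I, x) : 𝓞 K) = x * g I := by
  have hg : ∀ I : {I : Ideal (𝓞 K) // I ≠ ⊥ ∧ (I * 𝔟).IsPrincipal}, ∃ a, Ideal.span {a} = I.1 * 𝔟 :=
    fun I => by
      obtain ⟨a, ha⟩ := I.2.2
      exact ⟨a, ha.symm⟩
  choose g hg using hg
  have hg0 : ∀ I, g I ≠ 0 := fun I h => by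
    have := hg I
    rw [h, Ideal.span_singleton_eq_bot.2 rfl, eq_comm, Ideal.mul_eq_bot] at this
    exact this.elim I.2.1 h𝔟
  have hspan : ∀ I (x : (𝓞 K)ˣ), Ideal.span {(x : 𝓞 K) * g I} = I.1 * 𝔟 := fun I x => by
    rw [← hg, Ideal.span_singleton_eq_span_singleton]
    exact ⟨x⁻¹, by rw [mul_comm (x : 𝓞 K), mul_assoc, Units.mul_inv, mul_one]⟩
  have hmem : ∀ I (x : (𝓞 K)ˣ), (x : 𝓞 K) * g I ∈ 𝔟 ∧ (x : 𝓞 K) * g I ≠ 0 := fun I x => by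
    refine ⟨?_, mul_ne_zero x.ne_zero (hg0 I)⟩
    rw [← Ideal.span_singleton_le_iff_mem, hspan]
    exact Ideal.mul_le_right
  refine ⟨g, hg, Equiv.ofBijective (fun p => ⟨p.2 * g p.1, hmem p.1 p.2⟩) ⟨?_, ?_⟩, fun _ _ => rfl⟩
  · rintro ⟨I, x⟩ ⟨J, y⟩ h
    have h1 : x * g I = y * g J := congrArg Subtype.val h
    have h2 : I = J := by
      refine Subtype.ext (mul_right_cancel₀ h𝔟 ?_)
      rw [← hspan I x, h1, hspan]
    subst h2
    rw [Units.ext (mul_right_cancel₀ (hg0 I) h1)]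
  · rintro ⟨α, hα, hα0⟩
    obtain ⟨I, hI⟩ := Ideal.dvd_iff_le.2 ((Ideal.span_singleton_le_iff_mem _).2 hα)
    rw [mul_comm] at hI
    have hI0 : I ≠ ⊥ := by
      rintro rfl
      rw [Ideal.bot_mul, Ideal.span_singleton_eq_bot] at hI
      exact hα0 hI
    let J : {I : Ideal (𝓞 K) // I ≠ ⊥ ∧ (I * 𝔟).IsPrincipal} := ⟨I, hI0, ⟨α, hI.symm⟩⟩
    obtain ⟨x, hx⟩ := Ideal.span_singleton_eq_span_singleton.1 ((hg J).trans hI.symm)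
    exact ⟨(J, x), Subtype.ext ((mul_comm _ _).trans hx)⟩

lemma lintegral_boxCount {𝔟 : Ideal (𝓞 K)} (h𝔟 : 𝔟 ≠ ⊥) (u : ℝ) :
    ∫⁻ t in unitDomain K, boxCount 𝔟 (logBox (u + log (Ideal.absNorm 𝔟)) t) =
      Nat.card (torsion K) * logConst K * ∑' I : {I : Ideal (𝓞 K) // I ≠ ⊥ ∧ (I * 𝔟).IsPrincipal},
        ENNReal.ofReal (rieszKer (logRank K) (u - log (Ideal.absNorm I.1))) := by
  obtain ⟨g, hg, e, he⟩ := exists_equiv_units_prod h𝔟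
  set U := u + log (Ideal.absNorm 𝔟) with hU
  have hg0 : ∀ I, g I ≠ 0 := fun I h => (e (I, 1)).2.2 (by rw [he, h, mul_zero])
  have h1 : ∀ (α : {α : 𝓞 K // α ∈ 𝔟 ∧ α ≠ 0}) (t : logSpace K),
      (if ∀ w : InfinitePlace K, w (α.1 : K) ≤ logBox U t w then (1 : ℝ≥0∞) else 0) =
        {t : logSpace K | ∀ w, logHeight U α.1 w ≤ logExt t w}.indicator 1 t := fun α t => by
    simp only [le_logBox_iff α.2.2, Set.indicator_apply, Set.mem_ofPred_eq, Pi.one_apply]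
  simp only [boxCount, h1]
  have := (Module.Free.chooseBasis ℤ (𝓞 K)).equivFun.injective.countable
  rw [lintegral_tsum fun α => (measurable_one.indicator (measurableSet_logExt _)).aemeasurable,
    ← e.tsum_eq, ENNReal.tsum_prod', ← ENNReal.tsum_mul_left]
  refine tsum_congr fun I => ?_
  have h2 : ∀ (x : (𝓞 K)ˣ) (t : logSpace K),
      {t : logSpace K | ∀ w, logHeight U (e (I, x)).1 w ≤ logExt t w}.indicator
        (1 : logSpace K → ℝ≥0∞) t =
      {t : logSpace K | ∀ w, logHeight U (g I) w ≤ logExt t w}.indicator 1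
        (t - logEmbedding K (Additive.ofMul x)) := fun x t => by
    simp only [Set.indicator_apply, Set.mem_ofPred_eq, he, logHeight_units_mul (hg0 I), logExt_sub,
      le_sub_iff_add_le, Pi.one_apply]
  simp only [h2]
  have hI : (Ideal.absNorm I.1 : ℝ) ≠ 0 := by
    exact_mod_cast fun h => I.2.1 (Ideal.absNorm_eq_zero_iff.1 h)
  have hb : (Ideal.absNorm 𝔟 : ℝ) ≠ 0 := by
    exact_mod_cast fun h => h𝔟 (Ideal.absNorm_eq_zero_iff.1 h)
  rw [tsum_units_lintegral (measurableSet_logExt _), volume_setOf_le_logExt, sum_logHeight (hg0 I),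
    hg,
    map_mul, Nat.cast_mul, log_mul hI hb, hU]
  have : -(log (Ideal.absNorm I.1) + log (Ideal.absNorm 𝔟) - (u + log (Ideal.absNorm 𝔟))) =
      u - log (Ideal.absNorm I.1) := by ring
  rw [this]
  ring

end UnitIntegral

section IdealRiesz

open NumberField MeasureTheory Module InfinitePlace Real NumberField.Units IsDedekindDomain
open scoped ENNReal Classical

lemma LogSystem.summable_rieszKer {I : Type*} {lam : I → ℝ} (hl : LogSystem lam) (r : ℕ) (u : ℝ) :
    Summable fun i => rieszKer r (u - lam i) :=
  summable_of_ne_finset_zero (s := (hl.fin u).toFinset) fun i hi => if_neg (by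
    simpa using hi)

lemma rieszKer_nonneg (r : ℕ) (t : ℝ) : 0 ≤ rieszKer r t := by
  rw [rieszKer]
  split_ifs <;> positivity

lemma RieszAsymp.of_ofReal {I : Type*} {lam : I → ℝ} (hl : LogSystem lam) {r : ℕ} {κ Q θ : ℝ}
    (hκ : 0 < κ) (hQ : 0 ≤ Q)
    (h1 : ∀ u, ENNReal.ofReal (κ * (exp u - Q * exp ((1 - θ) * u))) ≤
      ∑' i, ENNReal.ofReal (rieszKer r (u - lam i)))
    (h2 : ∀ u, ∑' i, ENNReal.ofReal (rieszKer r (u - lam i)) ≤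
      ENNReal.ofReal (κ * (exp u + Q * exp ((1 - θ) * u)))) : RieszAsymp lam r κ Q θ := by
  intro u
  have h3 := h1 u
  have h4 := h2 u
  rw [← ENNReal.ofReal_tsum_of_nonneg (fun i => rieszKer_nonneg _ _)
    (hl.summable_rieszKer r u)] at h3 h4
  have h5 : 0 ≤ rieszSum lam r u := tsum_nonneg fun i => rieszKer_nonneg _ _
  change _ ≤ ENNReal.ofReal (rieszSum lam r u) at h3
  change ENNReal.ofReal (rieszSum lam r u) ≤ _ at h4
  rw [ENNReal.ofReal_le_ofReal_iff h5] at h3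
  rw [ENNReal.ofReal_le_ofReal_iff (by positivity)] at h4
  rw [abs_le]
  constructor
  · linarith
  · linarith

variable {K : Type*} [Field K] [NumberField K]

/-- An integral representative of the inverse of an ideal class. -/
lemma exists_isPrincipal_mul_iff (c : ClassGroup (𝓞 K)) : ∃ 𝔟 : Ideal (𝓞 K), 𝔟 ≠ ⊥ ∧
    ∀ (I : Ideal (𝓞 K)) (hI : I ≠ ⊥), (I * 𝔟).IsPrincipal ↔
      ClassGroup.mk0 ⟨I, mem_nonZeroDivisors_of_ne_zero hI⟩ = c := by
  obtain ⟨𝔟, h𝔟⟩ := ClassGroup.mk0_surjective c⁻¹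
  refine ⟨𝔟, nonZeroDivisors.ne_zero 𝔟.2, fun I hI => ?_⟩
  rw [← mul_inv_eq_one, ← h𝔟, ← map_mul, ClassGroup.mk0_eq_one_iff]
  rfl

lemma tsum_ideals_eq_sum {b : ClassGroup (𝓞 K) → Ideal (𝓞 K)}
    (hb : ∀ c (I : Ideal (𝓞 K)) (hI : I ≠ ⊥), (I * b c).IsPrincipal ↔
      ClassGroup.mk0 ⟨I, mem_nonZeroDivisors_of_ne_zero hI⟩ = c) (f : Ideal (𝓞 K) → ℝ≥0∞) :
    ∑' I : {I : Ideal (𝓞 K) // I ≠ ⊥}, f I =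
      ∑ c, ∑' I : {I : Ideal (𝓞 K) // I ≠ ⊥ ∧ (I * b c).IsPrincipal}, f I := by
  let q : {I : Ideal (𝓞 K) // I ≠ ⊥} → ClassGroup (𝓞 K) := fun I =>
    ClassGroup.mk0 ⟨I.1, mem_nonZeroDivisors_of_ne_zero I.2⟩
  rw [← (Equiv.sigmaFiberEquiv q).tsum_eq, ENNReal.tsum_sigma', tsum_fintype]
  refine Finset.sum_congr rfl fun c _ => ?_
  let e : {I : Ideal (𝓞 K) // I ≠ ⊥ ∧ (I * b c).IsPrincipal} ≃ {I // q I = c} :=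
    { toFun := fun I => ⟨⟨I.1, I.2.1⟩, (hb c I.1 I.2.1).1 I.2.2⟩
      invFun := fun I => ⟨I.1.1, I.1.2, (hb c I.1.1 I.1.2).2 I.2⟩
      left_inv := fun _ => rfl
      right_inv := fun _ => rfl }
  rw [← e.tsum_eq]
  rfl

theorem exists_rieszAsymp_wP {ι : Type*} [Fintype ι] {ω : ι → 𝓞 K}
    (hω : Submodule.span ℚ (Set.range fun i => (ω i : K)) = ⊤) (hι : Fintype.card ι = finrank ℚ K)
    {B : ℝ} (hB1 : 0 < B) (hB : ∀ i (w : InfinitePlace K), w (ω i : K) ≤ B) :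
    ∃ κ > 0, RieszAsymp (wt (wP (F := K))) (logRank K) κ (boxErr K B) (1 / finrank ℚ K) := by
  choose b hb0 hb using exists_isPrincipal_mul_iff (K := K)
  set W := Nat.card (torsion K) * logConst K with hW
  have hW0 : W ≠ 0 := mul_ne_zero
    (by exact_mod_cast Nat.card_pos.ne') simplexConst_ne_zero
  have hWt : W ≠ ⊤ := ENNReal.mul_ne_top (by simp) simplexConst_ne_top
  set V := Fintype.card (ClassGroup (𝓞 K)) * volume (unitDomain K) with hV
  have hV0 : V ≠ 0 := mul_ne_zero (by simp) volume_unitDomain_ne_zero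
  have hVt : V ≠ ⊤ := ENNReal.mul_ne_top (by simp) volume_unitDomain_ne_top
  have hVW0 : V / W ≠ 0 := ENNReal.div_ne_zero.2 ⟨hV0, hWt⟩
  have hVWt : V / W ≠ ⊤ := ENNReal.div_ne_top hVt hW0
  have hsum : ∀ u, W * ∑' e, ENNReal.ofReal (rieszKer (logRank K) (u - wt (wP (F := K)) e)) =
      ∑ c, ∫⁻ t in unitDomain K, boxCount (b c) (logBox (u + log (Ideal.absNorm (b c))) t) :=
    fun u => by
    simp only [wt_wP]
    have h := idealOfEquiv.tsum_eq (fun I : {I : Ideal (𝓞 K) // I ≠ ⊥} =>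
      ENNReal.ofReal (rieszKer (logRank K) (u - log (Ideal.absNorm I.1))))
    refine (congrArg (W * ·) h).trans ?_
    rw [tsum_ideals_eq_sum hb fun I =>
      ENNReal.ofReal (rieszKer (logRank K) (u - log (Ideal.absNorm I))),
      Finset.mul_sum]
    exact Finset.sum_congr rfl fun c _ => (lintegral_boxCount (hb0 c) u).symm
  have hbox := fun (c : ClassGroup (𝓞 K)) (u : ℝ) (t : Units.dirichletUnitTheorem.logSpace K) =>
    boxCount_bounds hω hι hB1 hB (hb0 c) (y := logBox (u + log (Ideal.absNorm (b c))) t)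
      (fun w => exp_pos _) (u := u) (by
        rw [prod_logBox, exp_add, exp_log]
        exact_mod_cast absNorm_pos_of_ne_bot (hb0 c))
  have hconst : ∀ x : ℝ≥0∞, ∑ _c : ClassGroup (𝓞 K), ∫⁻ _t in unitDomain K, x = V * x := fun x => by
    rw [setLIntegral_const, Finset.sum_const, Finset.card_univ, nsmul_eq_mul, hV]
    ring
  have hmul : ∀ x : ℝ, V / W * ENNReal.ofReal x = ENNReal.ofReal ((V / W).toReal * x) := fun x => by
    rw [ENNReal.ofReal_mul ENNReal.toReal_nonneg, ENNReal.ofReal_toReal hVWt]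
  have hκ : 0 < (V / W).toReal := ENNReal.toReal_pos hVW0 hVWt
  have hc := boxDensity_pos K
  have hQ : 0 ≤ boxErr K B := by
    rw [boxErr]
    positivity
  refine ⟨(V / W).toReal * boxDensity K, by positivity,
    .of_ofReal logSystem_wt_wP (by positivity) hQ
    (fun u => ?_) fun u => ?_⟩
  · rw [show (V / W).toReal * boxDensity K *
          (exp u - boxErr K B * exp ((1 - 1 / finrank ℚ K) * u)) =
      (V / W).toReal * (boxDensity K * exp u -
        boxDensity K * boxErr K B * exp ((1 - 1 / finrank ℚ K) * u)) by ring, ← hmul, mul_comm,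
      ← mul_div_assoc, ENNReal.div_le_iff hW0 hWt, mul_comm, ← hconst, mul_comm _ W, hsum]
    exact Finset.sum_le_sum fun c _ => lintegral_mono fun t => (hbox c u t).1
  · rw [show (V / W).toReal * boxDensity K *
          (exp u + boxErr K B * exp ((1 - 1 / finrank ℚ K) * u)) =
      (V / W).toReal * (boxDensity K * exp u +
        boxDensity K * boxErr K B * exp ((1 - 1 / finrank ℚ K) * u)) by ring, ← hmul,
          mul_comm (V / W),
      ← mul_div_assoc, ENNReal.le_div_iff_mul_le (Or.inl hW0) (Or.inl hWt), mul_comm _ V, ← hconst,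
      mul_comm _ W, hsum]
    exact Finset.sum_le_sum fun c _ => lintegral_mono fun t => (hbox c u t).2

/-- The constant in an asymptotic formula for Riesz sums is controlled by the error term. -/
lemma RieszAsymp.exists_const_bounds {θ : ℝ} (hθ : 0 < θ) (r : ℕ) {C : ℝ} (hC : 0 < C) :
    ∃ C' > 0, ∀ (I : Type) (lam : I → ℝ), LogSystem lam → (∃ i, lam i = 0) →
      (∀ u, ∀ T : Finset I, (∀ i ∈ T, lam i ≤ u) → (T.card : ℝ) ≤ C * exp (2 * u)) →
      ∀ κ Q : ℝ, 0 < κ → 1 ≤ Q → RieszAsymp lam r κ Q θ →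
        κ ≤ C' * Q ^ (2 / θ) ∧ κ⁻¹ ≤ C' * Q ^ (1 / θ) := by
  set A := exp 1 * 2 ^ (1 / θ) with hA
  have hA0 : 0 < A := by positivity
  refine ⟨2 * r.factorial * A + 2 * C * A ^ 2, by positivity, ?_⟩
  intro I lam hl ⟨i₀, hi₀⟩ hcard κ Q hκ hQ h
  have hQ0 : 0 < Q := by linarith
  set u := 1 + log (2 * Q) / θ with hu
  have hlog : 0 ≤ log (2 * Q) := log_nonneg (by linarith)
  have hu1 : 1 ≤ u := le_add_of_nonneg_right (by positivity)
  have hexp : exp u = A * Q ^ (1 / θ) := by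
    rw [hu, exp_add, hA, mul_assoc, ← mul_rpow zero_le_two hQ0.le, rpow_def_of_pos (by positivity)]
    congr 2
    ring
  have hexp2 : exp u ^ 2 = A ^ 2 * Q ^ (2 / θ) := by
    rw [hexp, mul_pow, ← rpow_natCast (Q ^ (1 / θ)), ← rpow_mul hQ0.le]
    congr 2
    push_cast
    ring
  have herr : κ * Q * exp ((1 - θ) * u) ≤ κ * (exp u / 2) := by
    have h1 : exp (-(θ * u)) ≤ 1 / (2 * Q) := by
      have : -(θ * u) = -θ - log (2 * Q) := by
        rw [hu]
        field_simp
        ring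
      rw [this, exp_sub, exp_log (by linarith)]
      gcongr
      exact exp_le_one_iff.2 (by linarith)
    rw [show (1 - θ) * u = u + -(θ * u) by ring, exp_add, mul_assoc]
    refine mul_le_mul_of_nonneg_left ?_ hκ.le
    calc Q * (exp u * exp (-(θ * u))) ≤ Q * (exp u * (1 / (2 * Q))) := by gcongr
      _ = _ := by field_simp
  have h2 := abs_le.1 (h u)
  have hsupp : rieszSum lam r u = ∑ i ∈ (hl.fin u).toFinset, rieszKer r (u - lam i) :=
    tsum_eq_sum fun i hi => if_neg (by simpa using hi)
  have hup : rieszSum lam r u ≤ C * exp (2 * u) * exp u := by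
    rw [hsupp]
    calc ∑ i ∈ (hl.fin u).toFinset, rieszKer r (u - lam i)
        ≤ ∑ _i ∈ (hl.fin u).toFinset, exp u := Finset.sum_le_sum fun i _ => by
          rw [rieszKer]
          split_ifs with h
          · exact (pow_div_factorial_le_exp _ h r).trans (exp_le_exp.2 (by linarith [hl.nonneg i]))
          · positivity
      _ = (hl.fin u).toFinset.card * exp u := by rw [Finset.sum_const, nsmul_eq_mul]
      _ ≤ _ := by
        gcongr
        exact hcard u _ fun i hi => by simpa using hi
  have hlow : 1 / (r.factorial : ℝ) ≤ rieszSum lam r u := by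
    refine le_trans ?_ ((hl.summable_rieszKer r u).le_tsum i₀ fun i _ => rieszKer_nonneg _ _)
    rw [hi₀, sub_zero, rieszKer, if_pos (by linarith)]
    gcongr
    exact one_le_pow₀ hu1
  have hf : (0 : ℝ) < r.factorial := by positivity
  have he := exp_pos u
  constructor
  · have h3 : κ * exp u ≤ 2 * C * exp u ^ 2 * exp u := by
      rw [show exp u ^ 2 = exp (2 * u) by rw [← exp_nat_mul]; norm_num]
      nlinarith
    calc κ ≤ 2 * C * exp u ^ 2 := le_of_mul_le_mul_right h3 he
      _ = 2 * C * A ^ 2 * Q ^ (2 / θ) := by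
        rw [hexp2]
        ring
      _ ≤ _ := by
        gcongr
        exact le_add_of_nonneg_left (by positivity)
  · have h3 : κ⁻¹ ≤ 2 * r.factorial * exp u := by
      rw [inv_le_iff_one_le_mul₀ hκ]
      have : 1 / (r.factorial : ℝ) ≤ 2 * κ * exp u := by nlinarith
      rw [div_le_iff₀ hf] at this
      linarith
    calc κ⁻¹ ≤ 2 * r.factorial * A * Q ^ (1 / θ) := by
          rw [hexp] at h3
          linarith
      _ ≤ _ := by
        gcongr
        exact le_add_of_nonneg_right (by positivity)

end IdealRiesz

section BelowPrimes

open IsDedekindDomain NumberField Real Ideal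

variable {L E : Type*} [Field L] [Field E] [Algebra L E]

instance (P : HeightOneSpectrum (𝓞 E)) :
    P.asIdeal.LiesOver (P.under (𝓞 L)).asIdeal := ⟨rfl⟩

lemma under_eq_iff_liesOver (P : HeightOneSpectrum (𝓞 E)) (v : HeightOneSpectrum (𝓞 L)) :
    P.under (𝓞 L) = v ↔ P.asIdeal.LiesOver v.asIdeal := by
  rw [HeightOneSpectrum.ext_iff, HeightOneSpectrum.under_asIdeal]
  exact ⟨fun h => ⟨h.symm⟩, fun h => h.over.symm⟩

lemma ratBelow_under (P : HeightOneSpectrum (𝓞 E)) : ratBelow (P.under (𝓞 L)) = ratBelow P := by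
  rw [ratBelow, ratBelow, HeightOneSpectrum.under_asIdeal, under_under]

variable [NumberField L] [NumberField E]

lemma card_under_eq (v : HeightOneSpectrum (𝓞 L)) :
    Nat.card {P : HeightOneSpectrum (𝓞 E) // P.under (𝓞 L) = v} =
      (v.asIdeal.primesOver (𝓞 E)).ncard := by
  rw [← Nat.card_coe_set_eq]
  refine Nat.card_congr ((Equiv.subtypeEquivRight fun P => ?_).trans
    (HeightOneSpectrum.equivPrimesOver (𝓞 E) (p := v.asIdeal) v.ne_bot))
  rw [under_eq_iff_liesOver, liesOver_iff_dvd_map P.isPrime.ne_top]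

lemma absNorm_eq_absNorm_under_pow (P : HeightOneSpectrum (𝓞 E)) :
    absNorm P.asIdeal =
      absNorm (P.under (𝓞 L)).asIdeal ^ P.asIdeal.inertiaDeg (𝓞 L) := by
  have := (P.under (𝓞 L)).isMaximal
  rw [absNorm_eq_pow_inertiaDeg'_of_liesOver P.asIdeal (P.under (𝓞 L)).asIdeal
    (P.under (𝓞 L)).isPrime (P.under (𝓞 L)).ne_bot, inertiaDeg'_eq_inertiaDeg]

lemma wP_eq_inertiaDeg_mul_wP_under (P : HeightOneSpectrum (𝓞 E)) :
    wP P = P.asIdeal.inertiaDeg (𝓞 L) * wP (P.under (𝓞 L)) := by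
  rw [wP, absNorm_eq_absNorm_under_pow (L := L), Nat.cast_pow, log_pow, wP]

lemma wP_under_le (P : HeightOneSpectrum (𝓞 E)) : wP (P.under (𝓞 L)) ≤ wP P := by
  have h1 := primeSystem_wP.pos (P.under (𝓞 L))
  rw [wP_eq_inertiaDeg_mul_wP_under (L := L) P]
  have : 1 ≤ P.asIdeal.inertiaDeg (𝓞 L) := P.asIdeal.inertiaDeg_pos (𝓞 L)
  have : (1 : ℝ) ≤ P.asIdeal.inertiaDeg (𝓞 L) := by exact_mod_cast this
  nlinarith

variable [IsGalois L E]

lemma ncard_mul_eq_finrank (v : HeightOneSpectrum (𝓞 L)) :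
    (v.asIdeal.primesOver (𝓞 E)).ncard *
      (v.asIdeal.ramificationIdxIn (𝓞 E) * v.asIdeal.inertiaDegIn (𝓞 E)) =
        Module.finrank L E := by
  have := v.isPrime
  rw [ncard_primesOver_mul_ramificationIdxIn_mul_inertiaDegIn v.asIdeal (𝓞 E) Gal(E/L),
    IsGaloisGroup.card_eq_finrank Gal(E/L) L E]

lemma wP_eq_wP_under_of_card (P : HeightOneSpectrum (𝓞 E))
    (h : Nat.card {P' : HeightOneSpectrum (𝓞 E) // P'.under (𝓞 L) = P.under (𝓞 L)} =
      Module.finrank L E) : wP P = wP (P.under (𝓞 L)) := by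
  have := P.isPrime
  have := (P.under (𝓞 L)).isPrime
  have h1 := ncard_mul_eq_finrank (E := E) (P.under (𝓞 L))
  rw [← card_under_eq, h] at h1
  have h2 := Nat.eq_one_of_mul_eq_one_left
    (Nat.eq_of_mul_eq_mul_left Module.finrank_pos (h1.trans (mul_one _).symm))
  rw [inertiaDegIn_eq_inertiaDeg _ P.asIdeal Gal(E/L)] at h2
  rw [wP_eq_inertiaDeg_mul_wP_under (L := L) P, h2, Nat.cast_one, one_mul]

lemma eq_of_under_eq_of_card_ne (hp : (Module.finrank L E).Prime) {P P' : HeightOneSpectrum (𝓞 E)}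
    (h : P.under (𝓞 L) = P'.under (𝓞 L))
    (hc : Nat.card {Q : HeightOneSpectrum (𝓞 E) // Q.under (𝓞 L) = P.under (𝓞 L)} ≠
      Module.finrank L E) : P = P' := by
  have h1 := ncard_mul_eq_finrank (E := E) (P.under (𝓞 L))
  rw [← card_under_eq] at h1
  have h2 := ((Nat.dvd_prime hp).1 (Dvd.intro _ h1)).resolve_right hc
  have := (Nat.card_eq_one_iff_unique.1 h2).1
  exact congrArg Subtype.val (Subsingleton.elim
    (⟨P, rfl⟩ : {Q : HeightOneSpectrum (𝓞 E) // Q.under (𝓞 L) = P.under (𝓞 L)}) ⟨P', h.symm⟩)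

end BelowPrimes

section Decomposition

open IsDedekindDomain NumberField Real Ideal
open scoped Pointwise

variable {K : Type*} [Field K] [NumberField K]

/-- Decomposition groups of unramified primes are cyclic. -/
lemma isCyclic_stabilizer [IsGalois ℚ K] (P : HeightOneSpectrum (𝓞 K))
    (h : ¬ (ratBelow P : ℤ) ∣ discr K) :
    IsCyclic (MulAction.stabilizer Gal(K/ℚ) P.asIdeal) := by
  have hPp := P.isPrime
  have hPne : NeZero P.asIdeal := ⟨P.ne_bot⟩
  have hq : Prime (ratBelow P : ℤ) := Nat.prime_iff_prime_int.1 (ratBelow_prime P)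
  have hu : P.asIdeal.under ℤ ≠ ⊥ := IsDedekindDomain.HeightOneSpectrum.ne_bot (P.under ℤ)
  have hmem : ((ratBelow P : ℤ) : 𝓞 K) ∈ P.asIdeal := by
    have : ((ratBelow P : ℕ) : ℤ) ∈ P.asIdeal.under ℤ := absNorm_mem _
    simpa [mem_comap] using this
  have hun := (not_dvd_discr_iff_forall_mem K (𝓞 K) hq).1 h P.asIdeal hPp hmem
  have : Finite (ℤ ⧸ P.asIdeal.under ℤ) := Ring.HasFiniteQuotients.finiteQuotient hu
  have : (P.asIdeal.under ℤ).IsMaximal := (P.under ℤ).isMaximal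
  have : P.asIdeal.IsMaximal := P.isMaximal
  have : Finite (𝓞 K ⧸ P.asIdeal) := Ring.HasFiniteQuotients.finiteQuotient P.ne_bot
  have hin : Nat.card (P.asIdeal.inertia Gal(K/ℚ)) = 1 := by
    rw [card_inertia_eq_ramificationIdxIn (P.asIdeal.under ℤ) P.asIdeal,
      ramificationIdxIn_eq_ramificationIdx _ P.asIdeal Gal(K/ℚ)]
    exact ramificationIdx_eq_one_of_isUnramifiedAt
  let _ := Ideal.Quotient.field (P.asIdeal.under ℤ)
  let _ := Ideal.Quotient.field P.asIdeal
  let f := Ideal.Quotient.stabilizerHom P.asIdeal (P.asIdeal.under ℤ) Gal(K/ℚ)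
  have hf : Function.Injective f := by
    rw [← MonoidHom.ker_eq_bot_iff, Ideal.Quotient.ker_stabilizerHom]
    rw [Subgroup.card_eq_one] at hin
    refine (AddSubgroup.subgroupOf_inertia _ _).symm.trans ?_
    exact (congrArg (Subgroup.subgroupOf · _) hin).trans (Subgroup.bot_subgroupOf _)
  exact isCyclic_of_injective f hf

variable {L E : Type*} [Field L] [NumberField L] [Field E] [NumberField E] [Algebra L E]
  [Algebra E K] [Algebra L K] [IsScalarTower L E K] [IsGalois L E]

/-- If the decomposition group of `P` meets `Gal(K/L)` in `Gal(K/E)`, the prime of `L` below `P`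
splits completely in `E`. -/
lemma card_under_eq_of_stabilizer_inf_eq (N H : Subgroup Gal(K/ℚ)) [IsGaloisGroup H L K]
    [IsGaloisGroup N E K]
    (P : HeightOneSpectrum (𝓞 K)) (hP : MulAction.stabilizer Gal(K/ℚ) P.asIdeal ⊓ H = N) :
    Nat.card {Q : HeightOneSpectrum (𝓞 E) // Q.under (𝓞 L) = P.under (𝓞 L)} =
      Module.finrank L E := by
  have := P.isPrime
  have hE := (P.under (𝓞 E)).isMaximal
  have hL := (P.under (𝓞 L)).isMaximal
  have : Finite (𝓞 E ⧸ (P.under (𝓞 E)).asIdeal) :=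
    Ring.HasFiniteQuotients.finiteQuotient (P.under (𝓞 E)).ne_bot
  have : Finite (𝓞 L ⧸ (P.under (𝓞 L)).asIdeal) :=
    Ring.HasFiniteQuotients.finiteQuotient (P.under (𝓞 L)).ne_bot
  have := IsGaloisGroup.of_isFractionRing H (𝓞 L) (𝓞 K) L K
  have := IsGaloisGroup.of_isFractionRing N (𝓞 E) (𝓞 K) E K
  have h1 := card_stabilizer_eq (G := H) (P.under (𝓞 L)).asIdeal P.asIdeal
  have h2 := card_stabilizer_eq (G := N) (P.under (𝓞 E)).asIdeal P.asIdeal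
  have hcard (M : Subgroup Gal(K/ℚ)) : Nat.card (MulAction.stabilizer M P.asIdeal) =
      Nat.card (MulAction.stabilizer Gal(K/ℚ) P.asIdeal ⊓ M : Subgroup Gal(K/ℚ)) := by
    rw [← Subgroup.subgroupOf_map_subtype, Subgroup.card_map_of_injective M.subtype_injective]
    rfl
  replace h1 := (hcard H).symm.trans h1
  replace h2 := (hcard N).symm.trans h2
  rw [hP] at h1
  rw [inf_eq_right.2 (hP ▸ inf_le_left)] at h2
  have hEL : (P.under (𝓞 E)).asIdeal.LiesOver (P.under (𝓞 L)).asIdeal := by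
    rw [← under_eq_iff_liesOver]
    ext1
    simp [under_under]
  have r := ramificationIdxIn_mul_ramificationIdxIn (p := (P.under (𝓞 L)).asIdeal)
    (P.under (𝓞 E)).asIdeal Gal(E/L) (𝓞 K) H N
  have f := inertiaDegIn_mul_inertiaDegIn (P.under (𝓞 L)).asIdeal (P.under (𝓞 E)).asIdeal
    Gal(E/L) (𝓞 K) H N
  have hE0 : 0 < Nat.card N := Nat.card_pos
  rw [h2] at hE0 h1
  rw [← r, ← f] at h1
  have h3 : (P.under (𝓞 L)).asIdeal.ramificationIdxIn (𝓞 E) *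
      (P.under (𝓞 L)).asIdeal.inertiaDegIn (𝓞 E) = 1 := by
    refine Nat.eq_of_mul_eq_mul_right hE0 ?_
    rw [one_mul]
    refine Eq.trans ?_ h1.symm
    ring
  rw [card_under_eq, ← ncard_mul_eq_finrank (E := E) (P.under (𝓞 L)), h3, mul_one]

/-- If `N` is cyclic and every cyclic subgroup between `N` and `H` is `N`, then a
prime of `L`, not totally split in `E` and unramified over `ℚ`, has a prime above it in `K` which
is moved by `N`. -/
lemma exists_smul_ne_of_card_ne [IsGalois ℚ K] (N H : Subgroup Gal(K/ℚ)) [IsGaloisGroup H L K]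
    [IsGaloisGroup N E K] (hNH : N ≤ H)
    (hcyc : ∀ D : Subgroup Gal(K/ℚ), IsCyclic D → D ≤ H → N ≤ D → D = N)
    (P : HeightOneSpectrum (𝓞 K)) (hP : ¬ (ratBelow P : ℤ) ∣ discr K)
    (hc : Nat.card {Q : HeightOneSpectrum (𝓞 E) // Q.under (𝓞 L) = P.under (𝓞 L)} ≠
      Module.finrank L E) : ∃ σ ∈ N, σ • P.asIdeal ≠ P.asIdeal := by
  by_contra! h
  refine hc (card_under_eq_of_stabilizer_inf_eq N H P (hcyc _ ?_ inf_le_right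
    (le_inf (fun σ hσ => h σ hσ) hNH)))
  have := isCyclic_stabilizer P hP
  exact isCyclic_of_injective (Subgroup.inclusion inf_le_left)
    (Subgroup.inclusion_injective (inf_le_left (b := H)))

end Decomposition

section BoundedGenerators

open NumberField Module Submodule

/-- `F` is spanned over `ℚ` by algebraic integers all of whose conjugates are at most `B`. -/
def BoundedGen (F : Type*) [Field F] [NumberField F] (B : ℝ) : Prop :=
  span ℚ {x : F | IsIntegral ℤ x ∧ ∀ w : InfinitePlace F, w x ≤ B} = ⊤

variable {F : Type*} [Field F] [NumberField F] {B : ℝ}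

lemma BoundedGen.exists_basis (h : BoundedGen F B) :
    ∃ ω : Fin (finrank ℚ F) → 𝓞 F, LinearIndependent ℚ (fun i => (ω i : F)) ∧
      span ℚ (Set.range fun i => (ω i : F)) = ⊤ ∧
      ∀ i, ∀ w : InfinitePlace F, w (ω i : F) ≤ B := by
  obtain ⟨b, hb, hspan, hli⟩ := exists_linearIndependent ℚ
    {x : F | IsIntegral ℤ x ∧ ∀ w : InfinitePlace F, w x ≤ B}
  rw [BoundedGen] at h
  rw [h] at hspan
  let v := Basis.mk hli (by simp [hspan])
  let e := v.indexEquiv (finBasis ℚ F)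
  refine ⟨fun i => ⟨(e.symm i : F), (hb (e.symm i).2).1⟩, ?_, ?_, fun i => (hb (e.symm i).2).2⟩
  · exact hli.comp _ e.symm.injective
  · rw [← hspan]
    congr 1
    ext x
    simp only [Set.mem_range]
    exact ⟨fun ⟨i, hi⟩ => hi ▸ (e.symm i).2, fun hx => ⟨e ⟨x, hx⟩, by simp⟩⟩

lemma BoundedGen.one_le (h : BoundedGen F B) : 1 ≤ B := by
  by_contra! hB
  have : {x : F | IsIntegral ℤ x ∧ ∀ w : InfinitePlace F, w x ≤ B} ⊆ {0} := by
    rintro x ⟨hx, hw⟩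
    by_contra hx0
    obtain ⟨w⟩ : Nonempty (InfinitePlace F) := inferInstance
    have := InfinitePlace.one_le_of_lt_one (w := w) (a := (⟨x, hx⟩ : 𝓞 F))
      (fun h => hx0 (congrArg Subtype.val h)) fun z _ => (hw z).trans_lt hB
    exact absurd ((this.trans (hw w))) (not_le.2 hB)
  have h1 := span_mono (R := ℚ) this
  rw [BoundedGen] at h
  rw [h, span_zero_singleton, top_le_iff] at h1
  exact bot_ne_top h1

lemma BoundedGen.abs_discr_le (h : BoundedGen F B) :
    |(discr F : ℝ)| ≤ ((finrank ℚ F).factorial * B ^ finrank ℚ F) ^ 2 := by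
  obtain ⟨ω, hli, -, hB⟩ := h.exists_basis
  exact abs_discr_le_of_linearIndependent hli (Fintype.card_fin _) hB

lemma BoundedGen.boxErr_le (h : BoundedGen F B) {n : ℕ} (hn : finrank ℚ F ≤ n) :
    boxErr F B ≤ ((1 + 2 * n.factorial * n) ^ n + n.factorial) * B ^ (n * (n + 1)) := by
  have hB := h.one_le
  have h1 : √|(discr F : ℝ)| ≤ n.factorial * B ^ n := by
    refine Real.sqrt_le_iff.2 ⟨by positivity, h.abs_discr_le.trans ?_⟩
    gcongr
  have hn0 : 1 ≤ n := finrank_pos.trans_le hn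
  rw [boxErr, add_mul]
  have hBn : 1 ≤ B ^ n := one_le_pow₀ hB
  refine add_le_add ?_ (h1.trans ?_)
  · have h2 : 1 + 2 * √|(discr F : ℝ)| * (finrank ℚ F * B) ≤
        (1 + 2 * n.factorial * n) * B ^ (n + 1) := by
      have : 2 * √|(discr F : ℝ)| * (finrank ℚ F * B) ≤
          2 * (n.factorial * B ^ n) * (n * B) := by gcongr
      have h3 : 2 * (n.factorial * B ^ n) * (n * B) = 2 * n.factorial * n * B ^ (n + 1) := by ring
      linarith [one_le_pow₀ hB (n := n + 1)]
    calc _ ≤ ((1 + 2 * n.factorial * n) * B ^ (n + 1)) ^ finrank ℚ F := by gcongr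
      _ ≤ ((1 + 2 * n.factorial * n) * B ^ (n + 1)) ^ n := by
        refine pow_le_pow_right₀ (one_le_mul_of_one_le_of_one_le ?_ (one_le_pow₀ hB)) hn
        have : (0 : ℝ) ≤ 2 * n.factorial * n := by positivity
        linarith
      _ = _ := by rw [mul_pow, ← pow_mul, mul_comm (n + 1)]
  · gcongr
    exact Nat.le_mul_of_pos_right n n.succ_pos

lemma BoundedGen.exists_rieszAsymp (h : BoundedGen F B) {n : ℕ} (hn : finrank ℚ F ≤ n) :
    ∃ κ > 0, RieszAsymp (wt (wP (F := F))) (logRank F) κ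
      (((1 + 2 * n.factorial * n) ^ n + n.factorial) * B ^ (n * (n + 1))) (1 / n) := by
  obtain ⟨ω, hli, hs, hB⟩ := h.exists_basis
  obtain ⟨κ, hκ, hr⟩ := exists_rieszAsymp_wP hs (Fintype.card_fin _) (zero_lt_one.trans_le h.one_le)
    hB
  refine ⟨κ, hκ, fun u => ?_⟩
  have hB1 := h.one_le
  have hd : (0 : ℝ) < finrank ℚ F := by exact_mod_cast finrank_pos
  have hQ : 1 ≤ boxErr F B := by
    rw [boxErr]
    have : (1 : ℝ) ≤ (1 + 2 * √|(discr F : ℝ)| * (finrank ℚ F * B)) ^ finrank ℚ F :=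
      one_le_pow₀ (by linarith [show 0 ≤ 2 * √|(discr F : ℝ)| * (finrank ℚ F * B) by positivity])
    linarith [Real.sqrt_nonneg |(discr F : ℝ)|]
  have := (hr.mono logSystem_wt_wP hκ.le hQ (θ' := 1 / n) (by positivity)
    (one_div_le_one_div_of_le hd (by exact_mod_cast hn))) u
  refine this.trans ?_
  gcongr
  exact h.boxErr_le hn

/-- Generators of a field give generators of a subfield, by taking traces. -/
lemma BoundedGen.trace {L : Type*} [Field L] [NumberField L] [Algebra L F] (h : BoundedGen F B) :
    BoundedGen L (finrank L F * B) := by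
  rw [BoundedGen, eq_top_iff]
  let T : F →ₗ[ℚ] L := (Algebra.trace L F).restrictScalars ℚ
  have hT : LinearMap.range T = ⊤ := LinearMap.range_eq_top.2 (Algebra.trace_surjective L F)
  rw [← hT, LinearMap.range_eq_map, ← (show _ = _ from h), map_span]
  refine span_mono ?_
  rintro _ ⟨x, ⟨hx, hw⟩, rfl⟩
  refine ⟨Algebra.isIntegral_trace hx, fun w => ?_⟩
  let _ : Algebra L ℂ := w.embedding.toAlgebra
  have h1 : w (Algebra.trace L F x) = ‖∑ σ : F →ₐ[L] ℂ, σ x‖ := by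
    rw [← trace_eq_sum_embeddings ℂ, ← w.norm_embedding_eq]
    rfl
  refine h1.trans_le ((norm_sum_le _ _).trans ?_)
  rw [← AlgHom.card L F ℂ, ← nsmul_eq_mul]
  refine Finset.sum_le_card_nsmul _ _ _ fun σ _ => ?_
  have := hw (InfinitePlace.mk σ.toRingHom)
  exact this

/-- Bounded elements of an ambient field that span a subfield. -/
lemma BoundedGen.of_intermediateField {K : Type*} [Field K] [NumberField K]
    (E : IntermediateField ℚ K)
    (h : (E : Set K) ⊆ span ℚ {x : K | x ∈ E ∧ IsIntegral ℤ x ∧ ∀ w : InfinitePlace K, w x ≤ B}) :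
    BoundedGen E B := by
  rw [BoundedGen, eq_top_iff]
  rintro x -
  have hx := h x.2
  have key : {x : K | x ∈ E ∧ IsIntegral ℤ x ∧ ∀ w : InfinitePlace K, w x ≤ B} ⊆
      E.val.toLinearMap '' {x : E | IsIntegral ℤ x ∧ ∀ w : InfinitePlace E, w x ≤ B} := by
    rintro y ⟨hyE, hyi, hy⟩
    refine ⟨⟨y, hyE⟩, ⟨?_, fun w => ?_⟩, rfl⟩
    · exact (isIntegral_algHom_iff (E.val.restrictScalars ℤ) E.val.injective).1 hyi
    · obtain ⟨w', rfl⟩ := InfinitePlace.comap_surjective (K := K) w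
      exact hy w'
  have := span_mono (R := ℚ) key hx
  rw [← map_span] at this
  obtain ⟨y, hy, hyx⟩ := this
  rwa [← Subtype.ext hyx]

end BoundedGenerators

section NoCollision

open IsDedekindDomain NumberField Ideal
open scoped Pointwise

lemma idealOf_apply_eq_zero {R : Type*} [CommRing R] [IsDedekindDomain R]
    {e : HeightOneSpectrum R →₀ ℕ} {v : HeightOneSpectrum R} (h : ¬ idealOf e ≤ v.asIdeal) :
    e v = 0 := by
  by_contra h0
  refine h ?_
  rw [← Ideal.dvd_iff_le, idealOf]
  exact (dvd_pow_self _ h0).trans (Finset.dvd_prod_of_mem (fun v => v.asIdeal ^ e v)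
    (Finsupp.mem_support_iff.2 h0))

lemma exists_mem_support_le_of_idealOf_le {R : Type*} [CommRing R] [IsDedekindDomain R]
    {e : HeightOneSpectrum R →₀ ℕ} {𝔭 : Ideal R} [h𝔭 : 𝔭.IsPrime] (h : idealOf e ≤ 𝔭) :
    ∃ v ∈ e.support, v.asIdeal ≤ 𝔭 := by
  rw [idealOf, Finsupp.prod, h𝔭.prod_le] at h
  obtain ⟨v, hv, hle⟩ := h
  exact ⟨v, hv, h𝔭.le_of_pow_le hle⟩

variable {K : Type*} [Field K] [NumberField K]

lemma smul_span_singleton (σ : Gal(K/ℚ)) (x : 𝓞 K) : σ • span {x} = span {σ • x} := by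
  rw [pointwise_smul_def, map_span, Set.image_singleton]
  rfl

/-- Ideals built from primes that are moved by automorphisms fixing all small integers do not
collide. -/
lemma not_collision {N : Subgroup Gal(K/ℚ)} {B : ℝ}
    (hfix : ∀ η : 𝓞 K, (∀ w : InfinitePlace K, w (η : K) ≤ B) → ∀ σ ∈ N, σ • η = η)
    {T : Type*} {P : T → HeightOneSpectrum (𝓞 K)} (hP : Function.Injective P)
    {σ : T → Gal(K/ℚ)} (hσ : ∀ q, σ q ∈ N) (hσP : ∀ q r, σ q • (P q).asIdeal ≠ (P r).asIdeal)
    {c c' : T →₀ ℕ} (hc : c ≠ c') {ℓ : ℕ} (hℓ : ℓ ≠ 0) :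
    ¬ Collision ℓ B (idealOf (c.mapDomain P)) (idealOf (c'.mapDomain P)) := by
  rintro ⟨η, m, hm, heq, hw⟩
  classical
  refine hc (Finsupp.ext fun q => ?_)
  set 𝔞 := idealOf (c.mapDomain P) with h𝔞
  set 𝔟 := idealOf (c'.mapDomain P) with h𝔟
  have h𝔞0 : 𝔞 ≠ 0 := idealOf_ne_bot _
  have h𝔟0 : 𝔟 ≠ 0 := idealOf_ne_bot _
  have hm0 : span {(m : 𝓞 K)} ^ ℓ ≠ 0 :=
    pow_ne_zero _ (by simpa [Ideal.zero_eq_bot, span_singleton_eq_bot] using hm)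
  have hη0 : span {η} ≠ 0 := by
    intro h
    rw [h, zero_mul] at heq
    exact mul_ne_zero hm0 (pow_ne_zero _ h𝔞0) heq.symm
  let τ := (σ q)⁻¹
  have heq' : span {η} * (τ • 𝔟) ^ ℓ = span {(m : 𝓞 K)} ^ ℓ * (τ • 𝔞) ^ ℓ := by
    have := congrArg (τ • ·) heq
    simp only [smul_mul', smul_pow'] at this
    rw [smul_span_singleton, smul_span_singleton, hfix η hw τ (N.inv_mem (hσ q))] at this
    rwa [show τ • (m : 𝓞 K) = m from map_natCast (MulSemiringAction.toRingHom Gal(K/ℚ) (𝓞 K) τ) m]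
      at this
  have hmul : 𝔟 * τ • 𝔞 = 𝔞 * τ • 𝔟 := by
    have h1 : (𝔟 * τ • 𝔞) ^ ℓ = (𝔞 * τ • 𝔟) ^ ℓ := by
      refine mul_left_cancel₀ (mul_ne_zero hη0 hm0) ?_
      rw [mul_pow, mul_pow]
      calc _ = (span {η} * 𝔟 ^ ℓ) * (span {(m : 𝓞 K)} ^ ℓ * (τ • 𝔞) ^ ℓ) := by ring
        _ = (span {(m : 𝓞 K)} ^ ℓ * 𝔞 ^ ℓ) * (span {η} * (τ • 𝔟) ^ ℓ) := by rw [heq, heq']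
        _ = _ := by ring
    exact pow_left_injective hℓ h1
  have hτ : ∀ d : T →₀ ℕ, ∃ s, idealOf s = τ • idealOf (d.mapDomain P) ∧ s (P q) = 0 := by
    intro d
    obtain ⟨s, hs⟩ := exists_idealOf_eq (I := τ • idealOf (d.mapDomain P)) (by
      rw [← Ideal.zero_eq_bot]
      exact (smul_ne_zero_iff_ne τ).2 (idealOf_ne_bot _))
    refine ⟨s, hs, idealOf_apply_eq_zero fun hle => ?_⟩
    rw [hs, pointwise_smul_subset_iff, inv_inv] at hle
    have := (P q).isPrime
    obtain ⟨v, hv, hvle⟩ := exists_mem_support_le_of_idealOf_le hle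
    obtain ⟨r, -, rfl⟩ := Finset.mem_image.1 (Finsupp.mapDomain_support hv)
    exact hσP q r ((P r).isMaximal.eq_of_le (IsPrime.ne_top inferInstance) hvle).symm
  obtain ⟨s, hs, hs0⟩ := hτ c
  obtain ⟨s', hs', hs0'⟩ := hτ c'
  rw [← hs, ← hs', h𝔞, h𝔟, ← idealOf_add, ← idealOf_add] at hmul
  have := DFunLike.congr_fun (idealOf_injective hmul) (P q)
  rw [Finsupp.add_apply, Finsupp.add_apply, hs0, hs0', Finsupp.mapDomain_apply hP,
    Finsupp.mapDomain_apply hP, add_zero, add_zero] at this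
  exact this.symm

end NoCollision

section StableSubfield

open NumberField Module Submodule

variable {K : Type*} [Field K] [NumberField K]

/-- The rational span of the algebraic integers all of whose conjugates are at most `B`. -/
def boundedSpan (K : Type*) [Field K] [NumberField K] (B : ℝ) : Submodule ℚ K :=
  span ℚ {x : K | IsIntegral ℤ x ∧ ∀ w : InfinitePlace K, w x ≤ B}

lemma boundedSpan_mono : Monotone (boundedSpan K) := fun _ _ h =>
  span_mono fun _ hx => ⟨hx.1, fun w => (hx.2 w).trans h⟩

lemma one_mem_boundedSpan {B : ℝ} (hB : 1 ≤ B) : (1 : K) ∈ boundedSpan K B :=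
  subset_span ⟨isIntegral_one, fun w => by simpa⟩

lemma mul_mem_boundedSpan {B : ℝ} {x y : K} (hx : x ∈ boundedSpan K B)
    (hy : y ∈ boundedSpan K B) : x * y ∈ boundedSpan K (B ^ 2) := by
  have h := mul_mem_mul hx hy
  rw [boundedSpan, span_mul_span] at h
  refine span_mono ?_ h
  rintro _ ⟨a, ha, b, hb, rfl⟩
  refine ⟨ha.1.mul hb.1, fun w => ?_⟩
  simp only [map_mul, sq]
  exact mul_le_mul (ha.2 w) (hb.2 w) (apply_nonneg _ _) ((apply_nonneg w a).trans (ha.2 w))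

lemma map_mem_boundedSpan {B : ℝ} (σ : Gal(K/ℚ)) {x : K} (hx : x ∈ boundedSpan K B) :
    σ x ∈ boundedSpan K B := by
  have h := mem_map_of_mem (f := σ.toLinearMap) hx
  rw [boundedSpan, map_span] at h
  refine span_mono ?_ h
  rintro _ ⟨a, ha, rfl⟩
  exact ⟨ha.1.map (σ.restrictScalars ℤ), fun w => ha.2 (w.comap (σ : K →+* K))⟩

lemma exists_boundedSpan_eq {B : ℕ → ℝ} (h1 : ∀ i, 1 ≤ B i) (hB : ∀ i, B i ^ 2 ≤ B (i + 1)) :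
    ∃ i < finrank ℚ K, boundedSpan K (B i) = boundedSpan K (B (i + 1)) := by
  have hle : ∀ i, boundedSpan K (B i) ≤ boundedSpan K (B (i + 1)) := fun i =>
    boundedSpan_mono ((le_self_pow₀ (h1 i) two_ne_zero).trans (hB i))
  by_contra! h
  have key : ∀ i ≤ finrank ℚ K, i + 1 ≤ finrank ℚ (boundedSpan K (B i)) := by
    intro i
    induction i with
    | zero =>
      intro _
      have : boundedSpan K (B 0) ≠ ⊥ := fun h0 => by
        have := one_mem_boundedSpan (K := K) (h1 0)
        simp [h0] at this
      simpa [Nat.one_le_iff_ne_zero] using this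
    | succ i ih =>
      intro hi
      exact (ih (by omega)).trans_lt (finrank_lt_finrank_of_lt ((hle i).lt_of_ne (h i hi)))
  exact absurd (key _ le_rfl) (not_le.2 (Nat.lt_succ_of_le (finrank_le _)))

/-- In a sequence of bounds growing at least quadratically, the small integers generate a normal
subfield that contains all integers up to the following bound. -/
lemma exists_normal_fixing [IsGalois ℚ K] {B : ℕ → ℝ} (h1 : ∀ i, 1 ≤ B i)
    (hB : ∀ i, B i ^ 2 ≤ B (i + 1)) :
    ∃ i < finrank ℚ K, ∃ N : Subgroup Gal(K/ℚ), N.Normal ∧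
      (∀ η : 𝓞 K, (∀ w : InfinitePlace K, w (η : K) ≤ B (i + 1)) → ∀ σ ∈ N, σ • η = η) ∧
      BoundedGen (IntermediateField.fixedField N) (B i) := by
  obtain ⟨i, hi, heq⟩ := exists_boundedSpan_eq (K := K) h1 hB
  let A : Subalgebra ℚ K := (boundedSpan K (B i)).toSubalgebra (one_mem_boundedSpan (h1 i))
    fun x y hx hy => heq ▸ boundedSpan_mono (hB i) (mul_mem_boundedSpan hx hy)
  let E : IntermediateField ℚ K := A.toIntermediateField fun x hx =>
    A.inv_mem_of_algebraic (x := ⟨x, hx⟩) (Algebra.IsAlgebraic.isAlgebraic _)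
  have hE : ∀ x, x ∈ E ↔ x ∈ boundedSpan K (B i) := fun _ => Iff.rfl
  refine ⟨i, hi, E.fixingSubgroup, ⟨fun n hn g => ?_⟩, fun η hη σ hσ => ?_, ?_⟩
  · rw [IntermediateField.mem_fixingSubgroup_iff] at hn ⊢
    intro x hx
    have := hn (g⁻¹ x) ((hE _).2 (map_mem_boundedSpan _ ((hE _).1 hx)))
    simp only [AlgEquiv.mul_apply, this]
    exact g.apply_symm_apply x
  · refine RingOfIntegers.ext ?_
    refine (IntermediateField.mem_fixingSubgroup_iff _ _).1 hσ η ((hE _).2 ?_)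
    rw [heq]
    exact subset_span ⟨η.isIntegral_coe, hη⟩
  · refine BoundedGen.of_intermediateField _ ?_
    rw [IsGalois.fixedField_fixingSubgroup]
    intro x hx
    refine span_mono ?_ ((hE x).1 hx)
    exact fun y hy => ⟨(hE y).2 (subset_span hy), hy⟩

end StableSubfield

section TruncSumLower

open Real NumberField IsDedekindDomain Module

lemma exp_le_of_beurling_bound {n p : ℕ} (hpn : p ≤ n) {C C' κL κE Q Θ x : ℝ}
    (hC : 0 < C) (hC' : 1 ≤ C') (hκL : 0 < κL) (hκE : 0 < κE) (hQ : 1 ≤ Q) (hΘ : 1 ≤ Θ)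
    (hE : κE ≤ C' * Q ^ (2 * n)) (hL : κL⁻¹ ≤ C' * Q ^ n)
    (h : κL ^ p ≤ C * Q ^ p * exp (-x) * (κL ^ p * Θ + κE * Θ ^ p)) (hp : 1 ≤ p) :
    exp x ≤ C * (1 + C' ^ (n + 1)) * Q ^ (n * (n + 3)) * Θ ^ n := by
  have hκp : 0 < κL ^ p := pow_pos hκL p
  have h1 : exp x ≤ C * Q ^ p * (Θ + κE * (κL⁻¹) ^ p * Θ ^ p) := by
    have h2 := mul_le_mul_of_nonneg_right h (mul_pos (exp_pos x) (inv_pos.2 hκp)).le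
    have h3 : κL ^ p * (exp x * (κL ^ p)⁻¹) = exp x := by field_simp
    have h4 : C * Q ^ p * exp (-x) * (κL ^ p * Θ + κE * Θ ^ p) * (exp x * (κL ^ p)⁻¹) =
        C * Q ^ p * (Θ + κE * (κL⁻¹) ^ p * Θ ^ p) := by
      rw [exp_neg, inv_pow]
      field_simp
    rwa [h3, h4] at h2
  have hΘp : Θ ^ p ≤ Θ ^ n := pow_le_pow_right₀ hΘ hpn
  have hΘ1 : Θ ≤ Θ ^ n := le_self_pow₀ hΘ (by omega)
  have hQp : Q ^ p ≤ Q ^ n := pow_le_pow_right₀ hQ hpn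
  have hQ1 : 1 ≤ Q ^ (n * (n + 2)) := one_le_pow₀ hQ
  have h5 : κE * (κL⁻¹) ^ p ≤ C' ^ (n + 1) * Q ^ (n * (n + 2)) := by
    have h6 : (κL⁻¹) ^ p ≤ (C' * Q ^ n) ^ n := by
      refine (pow_le_pow_left₀ (inv_nonneg.2 hκL.le) hL p).trans (pow_le_pow_right₀ ?_ hpn)
      exact one_le_mul_of_one_le_of_one_le hC' (one_le_pow₀ hQ)
    calc κE * (κL⁻¹) ^ p ≤ (C' * Q ^ (2 * n)) * (C' * Q ^ n) ^ n := by gcongr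
      _ = _ := by rw [mul_pow, ← pow_mul]; ring
  calc exp x ≤ C * Q ^ p * (Θ + κE * (κL⁻¹) ^ p * Θ ^ p) := h1
    _ ≤ C * Q ^ n * (Q ^ (n * (n + 2)) * Θ ^ n + C' ^ (n + 1) * Q ^ (n * (n + 2)) * Θ ^ n) := by
      gcongr
      exact hΘ1.trans (le_mul_of_one_le_left (by positivity) hQ1)
    _ = _ := by ring

lemma one_le_truncSum_wt {P : Type*} {w : P → ℝ} (h : LogSystem (wt w)) (s : ℝ) {β : ℝ}
    (hβ : 0 ≤ β) : 1 ≤ truncSum h s β := by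
  have : (0 : P →₀ ℕ) ∈ (h.fin β).toFinset := by
    rw [Set.Finite.mem_toFinset]
    exact (wt_zero w).trans_le hβ
  refine le_of_eq_of_le ?_ (Finset.single_le_sum (fun i _ => (exp_pos (-(s * wt w i))).le) this)
  simp [wt_zero]

lemma logRank_le {K : Type*} [Field K] [NumberField K] : logRank K ≤ finrank ℚ K := by
  classical
  refine (Fintype.card_subtype_le _).trans ?_
  rw [InfinitePlace.card_eq_nrRealPlaces_add_nrComplexPlaces,
    ← InfinitePlace.card_add_two_mul_card_eq_rank K]
  omega

lemma BoundedGen.mono {F : Type*} [Field F] [NumberField F] {B B' : ℝ} (h : BoundedGen F B)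
    (hB : B ≤ B') : BoundedGen F B' :=
  top_le_iff.1 (h.symm.le.trans (Submodule.span_mono fun _ hx =>
    ⟨hx.1, fun w => (hx.2 w).trans hB⟩))

lemma LogSystem.of_wt {P : Type*} {w : P → ℝ} (h : LogSystem (_root_.wt w)) : LogSystem w := by
  have := h.comp_injective (Finsupp.single_left_injective (α := P) one_ne_zero)
  simpa [Function.comp_def, _root_.wt] using this

/-- The primes of `L` that do not split completely in an extension `E` of prime degree. -/
def nonsplitPrimes (L E : Type*) [Field L] [Field E] [NumberField L] [NumberField E] [Algebra L E] :
    Set (HeightOneSpectrum (𝓞 L)) :=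
  {v | Nat.card {P : HeightOneSpectrum (𝓞 E) // P.under (𝓞 L) = v} ≠ finrank L E}

lemma exists_exp_le_truncSum_of_degree (n m rL rE : ℕ) : ∃ C : ℝ, 0 < C ∧
    ∀ (L E : Type) [Field L] [Field E] [NumberField L] [NumberField E] [Algebra L E]
      [IsGalois L E], finrank L E = m + 1 → logRank L = rL → logRank E = rE →
      finrank ℚ E ≤ n → (finrank L E).Prime → ∀ b, BoundedGen E b →
      ∀ (hU : LogSystem (wt fun v : nonsplitPrimes L E => wP v.1)) (β : ℝ), 0 ≤ β →
        exp (1 / (n : ℝ) / 2 * β) ≤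
          C * b ^ (n * (n + 1) * (n * (n + 3))) * truncSum hU (1 - 1 / (n : ℝ) / 2) β ^ n := by
  rcases Nat.eq_zero_or_pos n with rfl | hn
  · refine ⟨1, one_pos, fun L E => ?_⟩
    intro _ _ _ _ _ _ _ _ _ h
    exact absurd h (not_le.2 finrank_pos)
  rcases Nat.eq_zero_or_pos m with rfl | hm
  · refine ⟨1, one_pos, fun L E => ?_⟩
    intro _ _ _ _ _ _ h _ _ _ hp
    exact absurd (h ▸ hp) (by norm_num)
  have hn0 : (0 : ℝ) < n := by exact_mod_cast hn
  have hn1 : (1 : ℝ) ≤ n := by exact_mod_cast hn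
  have hθ : 0 < 1 / (n : ℝ) := by positivity
  have hθ1 : 1 / (n : ℝ) ≤ 1 := (div_le_one hn0).2 hn1
  obtain ⟨C, hC, hbe⟩ := beurling_primes hθ hθ1 m hm rL rE
  obtain ⟨C₀, hC₀, hcard⟩ := exists_prime_system_card_le n one_lt_two
  obtain ⟨CL, hCL, hL⟩ := RieszAsymp.exists_const_bounds hθ rL hC₀
  obtain ⟨CE, hCE, hE⟩ := RieszAsymp.exists_const_bounds hθ rE hC₀
  set C' := 1 + CL + CE with hC'
  set c : ℝ := ((1 + 2 * n.factorial * n) ^ n + n.factorial) with hc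
  have hc1 : 1 ≤ c := by
    have : (1 : ℝ) ≤ (1 + 2 * n.factorial * n) ^ n :=
      one_le_pow₀ (by linarith [show (0 : ℝ) ≤ 2 * n.factorial * n by positivity])
    linarith [show (0 : ℝ) ≤ n.factorial by positivity]
  refine ⟨C * (1 + C' ^ (n + 1)) * (c * n ^ (n * (n + 1))) ^ (n * (n + 3)), by positivity, ?_⟩
  intro L E _ _ _ _ _ _ hm' hrL hrE hEn hp b hb hU β hβ
  have hb1 := hb.one_le
  have htower : finrank ℚ L * finrank L E = finrank ℚ E := finrank_mul_finrank ℚ L E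
  have hLE : finrank L E ≤ n := (Nat.le_of_dvd finrank_pos (Dvd.intro_left _ htower)).trans hEn
  have hLn : finrank ℚ L ≤ n := (Nat.le_of_dvd finrank_pos (Dvd.intro _ htower)).trans hEn
  set B := n * b with hB
  have hB1 : 1 ≤ B := one_le_mul_of_one_le_of_one_le hn1 hb1
  have hBL : BoundedGen L B := hb.trace.mono (by rw [hB]; gcongr)
  have hBE : BoundedGen E B := hb.mono (le_mul_of_one_le_left (by linarith) hn1)
  obtain ⟨κL, hκL, hRL⟩ := hBL.exists_rieszAsymp hLn
  obtain ⟨κE, hκE, hRE⟩ := hBE.exists_rieszAsymp hEn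
  rw [hrL] at hRL
  rw [hrE] at hRE
  set Q := c * B ^ (n * (n + 1)) with hQ
  have hQ1 : 1 ≤ Q := one_le_mul_of_one_le_of_one_le hc1 (one_le_pow₀ hB1)
  have hps : ∀ (F : Type) [Field F] [NumberField F], finrank ℚ F ≤ n →
      PrimeSystem n (wP (F := F)) ratBelow := fun F _ _ hF =>
    ⟨primeSystem_wP.prime, primeSystem_wP.le,
      fun S q hS => (primeSystem_wP.card_fiber S q hS).trans hF⟩
  have h1 := (hL _ _ logSystem_wt_wP ⟨0, wt_zero _⟩
    (fun u T hT => hcard _ _ _ (hps L hLn) u T hT) κL Q hκL hQ1 hRL).2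
  have h2 := (hE _ _ logSystem_wt_wP ⟨0, wt_zero _⟩
    (fun u T hT => hcard _ _ _ (hps E hEn) u T hT) κE Q hκE hQ1 hRE).1
  have h3 := hbe _ _ (wP (F := L)) (wP (F := E)) (logSystem_wt_wP.of_wt) (logSystem_wt_wP.of_wt)
    (primeSystem_wP.log_two_le) (primeSystem_wP.log_two_le) (HeightOneSpectrum.under (𝓞 L))
    (nonsplitPrimes L E) (fun v hv => hm' ▸ not_not.1 hv)
    (fun P hP => wP_eq_wP_under_of_card P (not_not.1 hP))
    (fun P P' hP h => eq_of_under_eq_of_card_ne hp h hP) (fun P => wP_under_le P)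
    κL κE Q hκL hκE hQ1 hRL hRE hU β hβ
  refine (exp_le_of_beurling_bound (hm' ▸ hLE) hC (by linarith) hκL hκE hQ1
    (one_le_truncSum_wt hU _ hβ) (C' := C') ?_ ?_ h3 (by omega)).trans_eq ?_
  · refine h2.trans ?_
    rw [show (2 : ℝ) / (1 / n) = (2 * n : ℕ) by push_cast; field_simp, rpow_natCast]
    gcongr
    linarith
  · refine h1.trans ?_
    rw [show (1 : ℝ) / (1 / n) = (n : ℕ) by field_simp, rpow_natCast]
    gcongr
    linarith
  · rw [hQ, hB, mul_pow (n : ℝ), ← mul_assoc c, mul_pow (c * n ^ (n * (n + 1))), ← pow_mul b]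
    ring

end TruncSumLower

section MovedPrimes

open Real NumberField IsDedekindDomain Module Ideal
open scoped Pointwise

lemma exists_exp_le_truncSum (n : ℕ) : ∃ C : ℝ, 0 < C ∧
    ∀ (L E : Type) [Field L] [Field E] [NumberField L] [NumberField E] [Algebra L E]
      [IsGalois L E], finrank ℚ E ≤ n → (finrank L E).Prime → ∀ b, BoundedGen E b →
      ∀ (hU : LogSystem (wt fun v : nonsplitPrimes L E => wP v.1)) (β : ℝ), 0 ≤ β →
        exp (1 / (n : ℝ) / 2 * β) ≤
          C * b ^ (n * (n + 1) * (n * (n + 3))) * truncSum hU (1 - 1 / (n : ℝ) / 2) β ^ n := by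
  choose C hC h using fun x : ℕ × ℕ × ℕ => exists_exp_le_truncSum_of_degree n x.1 x.2.1 x.2.2
  let S := Finset.range n ×ˢ Finset.range (n + 1) ×ˢ Finset.range (n + 1)
  refine ⟨1 + ∑ x ∈ S, C x, ?_, ?_⟩
  · have := Finset.sum_nonneg fun x (_ : x ∈ S) => (hC x).le
    linarith
  intro L E _ _ _ _ _ _ hEn hp b hb hU β hβ
  have hb1 := hb.one_le
  have htower : finrank ℚ L * finrank L E = finrank ℚ E := finrank_mul_finrank ℚ L E
  have hLE : finrank L E ≤ n := (Nat.le_of_dvd finrank_pos (Dvd.intro_left _ htower)).trans hEn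
  have hLn : finrank ℚ L ≤ n := (Nat.le_of_dvd finrank_pos (Dvd.intro _ htower)).trans hEn
  have hm : finrank L E - 1 + 1 = finrank L E := Nat.sub_add_cancel hp.one_le
  have hx : (finrank L E - 1, logRank L, logRank E) ∈ S := by
    simp only [S, Finset.mem_product, Finset.mem_range, Nat.lt_succ_iff]
    exact ⟨by omega, logRank_le.trans hLn, logRank_le.trans hEn⟩
  refine (h (finrank L E - 1, logRank L, logRank E) L E hm.symm rfl rfl hEn hp b hb hU β hβ).trans
    ?_
  have h1 := Finset.single_le_sum (fun x (_ : x ∈ S) => (hC x).le) hx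
  have h2 := one_le_truncSum_wt hU (1 - 1 / (n : ℝ) / 2) hβ
  gcongr
  linarith

lemma exp_wt_wP_of_idealOf_eq_span_natCast {L : Type*} [Field L] [NumberField L]
    (hL : finrank ℚ L = 1) {m : ℕ} {e : HeightOneSpectrum (𝓞 L) →₀ ℕ}
    (he : idealOf e = span {(m : 𝓞 L)}) : exp (wt wP e) = m := by
  rw [exp_wt_wP, he, absNorm_span_natCast, RingOfIntegers.rank, hL, pow_one]

/-- Lower bound over a field of degree one, where all primes are taken. -/
lemma exp_le_truncSum_of_finrank_eq_one {n : ℕ} (hn : 1 ≤ n) {L : Type*} [Field L] [NumberField L]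
    (hL : finrank ℚ L = 1)
    (hU : LogSystem (wt fun v : (Set.univ : Set (HeightOneSpectrum (𝓞 L))) => wP v.1)) {β : ℝ}
    (hβ : 0 ≤ β) :
    exp (1 / (n : ℝ) / 2 * β) ≤ 2 * truncSum hU (1 - 1 / (n : ℝ) / 2) β ^ n := by
  classical
  have hn1 : (1 : ℝ) ≤ n := by exact_mod_cast hn
  set s := 1 - 1 / (n : ℝ) / 2 with hs
  have hs0 : 0 ≤ s := by
    have : 1 / (n : ℝ) ≤ 1 := (div_le_one (by linarith)).2 hn1
    rw [hs]; linarith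
  have hΘ := one_le_truncSum_wt hU s hβ
  have h1 : truncSum (logSystem_wt_wP (F := L)) s β ≤ truncSum hU s β := by
    refine truncSum_le_of_injective _ _
      (Finsupp.equivCongrLeft (Equiv.Set.univ (HeightOneSpectrum (𝓞 L))).symm).injective
      (fun e => ?_) hs0 β
    exact (wt_equiv (Equiv.Set.univ _).symm (fun v : Set.univ => wP v.1) e).le
  have hsp : ∀ m : ℕ, m ≠ 0 → ∃ e, idealOf e = span {(m : 𝓞 L)} := fun m hm =>
    exists_idealOf_eq (by simpa [span_singleton_eq_bot] using hm)
  choose! g hg using hsp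
  have hgw : ∀ m : ℕ, m ≠ 0 → exp (wt wP (g m)) = m := fun m hm =>
    exp_wt_wP_of_idealOf_eq_span_natCast hL (hg m hm)
  set M := ⌊exp β⌋₊ with hM
  have hβ1 : 1 ≤ exp β := one_le_exp hβ
  have hcard : (M : ℝ) * exp (-(s * β)) ≤ truncSum (logSystem_wt_wP (F := L)) s β := by
    have hinj : Set.InjOn g (Finset.Icc 1 M) := fun a ha b hb hab => by
      have ha' : a ≠ 0 := by have := Finset.mem_Icc.1 ha; omega
      have hb' : b ≠ 0 := by have := Finset.mem_Icc.1 hb; omega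
      have := hgw a ha'
      rw [hab, hgw b hb'] at this
      exact_mod_cast this.symm
    have hmem : ∀ m ∈ Finset.Icc 1 M, wt wP (g m) ≤ β := fun m hm => by
      obtain ⟨hm1, hm2⟩ := Finset.mem_Icc.1 hm
      rw [← exp_le_exp, hgw m (by omega)]
      exact (Nat.cast_le.2 hm2).trans (Nat.floor_le (exp_pos β).le)
    calc (M : ℝ) * exp (-(s * β)) = ∑ e ∈ (Finset.Icc 1 M).image g, exp (-(s * β)) := by
          rw [Finset.sum_const, Finset.card_image_of_injOn hinj, Nat.card_Icc, nsmul_eq_mul,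
            Nat.add_sub_cancel]
      _ ≤ ∑ e ∈ (Finset.Icc 1 M).image g, exp (-(s * wt wP e)) := by
          refine Finset.sum_le_sum fun e he => exp_le_exp.2 ?_
          obtain ⟨m, hm, rfl⟩ := Finset.mem_image.1 he
          have := hmem m hm
          nlinarith
      _ ≤ _ := by
          refine Finset.sum_le_sum_of_subset_of_nonneg (fun e he => ?_) fun _ _ _ => (exp_pos _).le
          obtain ⟨m, hm, rfl⟩ := Finset.mem_image.1 he
          rw [Set.Finite.mem_toFinset]
          exact hmem m hm
  have hM2 : exp β ≤ 2 * M := by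
    have h2 := Nat.lt_floor_add_one (exp β)
    have h3 : (1 : ℝ) ≤ M := by
      exact_mod_cast (Nat.one_le_floor_iff _).2 hβ1
    rw [← hM] at h2
    linarith
  calc exp (1 / (n : ℝ) / 2 * β) = exp β * exp (-(s * β)) := by
        rw [← exp_add, hs]; ring_nf
    _ ≤ 2 * M * exp (-(s * β)) := by gcongr
    _ ≤ 2 * truncSum hU s β := by linarith
    _ ≤ _ := by
        gcongr
        exact le_self_pow₀ hΘ (by omega)

lemma exists_under_eq {L K : Type*} [Field L] [Field K] [NumberField L] [NumberField K]
    [Algebra L K] (v : HeightOneSpectrum (𝓞 L)) :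
    ∃ P : HeightOneSpectrum (𝓞 K), P.under (𝓞 L) = v := by
  have := v.isPrime
  obtain ⟨⟨P, hP, hPv⟩⟩ := v.asIdeal.nonempty_primesOver (S := 𝓞 K)
  refine ⟨⟨P, hP, ne_bot_of_liesOver_of_ne_bot v.ne_bot P⟩, ?_⟩
  exact HeightOneSpectrum.ext hPv.over.symm

lemma under_eq_of_smul_eq {L K : Type*} [Field L] [Field K] [NumberField L] [NumberField K]
    [Algebra L K] {σ : Gal(K/ℚ)} (hσ : ∀ x : L, σ (algebraMap L K x) = algebraMap L K x)
    {P P' : HeightOneSpectrum (𝓞 K)} (h : σ • P.asIdeal = P'.asIdeal) :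
    P.under (𝓞 L) = P'.under (𝓞 L) := by
  have hσ' : ∀ x : 𝓞 L, σ • algebraMap (𝓞 L) (𝓞 K) x = algebraMap (𝓞 L) (𝓞 K) x := fun x =>
    RingOfIntegers.ext (hσ x)
  refine HeightOneSpectrum.ext (Ideal.ext fun x => ?_)
  change algebraMap (𝓞 L) (𝓞 K) x ∈ P.asIdeal ↔ algebraMap (𝓞 L) (𝓞 K) x ∈ P'.asIdeal
  rw [← h, ← hσ' x, smul_mem_pointwise_smul_iff, hσ' x]

/-- If `N` is cyclic and `N ≤ H` with prime index, and no other cyclic subgroup lies between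
them, then a prime of the fixed field of `H`, not split in the fixed field of `N` and unramified,
lies under a prime moved by `N`. -/
lemma exists_galois_tower {K : Type} [Field K] [NumberField K] [IsGalois ℚ K]
    (N : Subgroup Gal(K/ℚ)) [N.Normal] {p : ℕ} (hp : p.Prime) {c : Gal(K/ℚ)}
    (hc : orderOf c = p) (hcN : c ∉ N) (hpN : p ∣ Nat.card N) :
    ∃ (L : IntermediateField ℚ K) (_ : Algebra L (IntermediateField.fixedField N)),
      IsGalois L (IntermediateField.fixedField N) ∧
      finrank L (IntermediateField.fixedField N) = p ∧
      ∀ v ∈ nonsplitPrimes L (IntermediateField.fixedField N), ¬ (ratBelow v : ℤ) ∣ discr K →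
        ∃ P : HeightOneSpectrum (𝓞 K), P.under (𝓞 L) = v ∧
          ∃ σ ∈ N, (∀ x : L, σ x = x) ∧ σ • P.asIdeal ≠ P.asIdeal := by
  let H := Subgroup.zpowers c ⊔ N
  have hNH : N ≤ H := le_sup_right
  let L := IntermediateField.fixedField H
  let E := IntermediateField.fixedField N
  have hLE : L ≤ E := IntermediateField.fixedField_antitone hNH
  let _ : Algebra L E := (IntermediateField.inclusion hLE).toAlgebra
  have : IsScalarTower L E K := IsScalarTower.of_algebraMap_eq fun _ => rfl
  have : IsScalarTower ℚ L E := IsScalarTower.of_algebraMap_eq fun _ => rfl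
  have : IsGalois ℚ E := IsGalois.of_fixedField_normal_subgroup N
  have : IsGalois L E := IsGalois.tower_top_of_isGalois ℚ L E
  have hH : IsGaloisGroup H L K := IsGaloisGroup.subgroup Gal(K/ℚ) ℚ K H
  have hN : IsGaloisGroup N E K := IsGaloisGroup.subgroup Gal(K/ℚ) ℚ K N
  have hdeg : finrank L E = p := by
    have h1 := finrank_mul_finrank L E K
    rw [← IsGaloisGroup.card_eq_finrank N E K, ← IsGaloisGroup.card_eq_finrank H L K] at h1
    have h2 := Subgroup.relIndex_mul_relIndex ⊥ N H bot_le hNH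
    rw [relIndex_sup_zpowers N hp hc hcN, Subgroup.relIndex_bot_left,
      Subgroup.relIndex_bot_left] at h2
    exact Nat.eq_of_mul_eq_mul_right Nat.card_pos (h1.trans (h2.symm.trans (mul_comm _ _)))
  refine ⟨L, inferInstance, this, hdeg, fun v hv hram => ?_⟩
  obtain ⟨P, rfl⟩ := exists_under_eq (K := K) v
  rw [ratBelow_under] at hram
  obtain ⟨σ, hσ, hσP⟩ := exists_smul_ne_of_card_ne (L := L) (E := E) N H hNH
    (fun D hD hDH hND => eq_of_isCyclic_of_le_sup N hp hc hcN hpN D hDH hND) P hram hv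
  exact ⟨P, rfl, σ, hσ, fun x => x.2 ⟨σ, hNH hσ⟩, hσP⟩

/-- Under the hypothesis on Sylow subgroups, each nontrivial normal subgroup `N` moves primes over
many primes of some subfield, quantitatively in terms of generators of the fixed field of `N`. -/
lemma exists_moved_primes {n : ℕ} (hn : 1 ≤ n) : ∃ (C : ℝ) (A : ℕ), 1 ≤ C ∧
    ∀ (K : Type) [Field K] [NumberField K] [IsGalois ℚ K], finrank ℚ K = n →
      (∀ (p : ℕ), p.Prime → p ∣ Nat.card Gal(K/ℚ) → ∀ P : Sylow p Gal(K/ℚ),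
        ¬ IsCyclic P ∧ ∀ n : ℕ, 1 ≤ n → IsEmpty (P ≃* QuaternionGroup (2 ^ n))) →
      ∀ N : Subgroup Gal(K/ℚ), N.Normal → N ≠ ⊥ →
      ∀ b, BoundedGen (IntermediateField.fixedField N) b →
      ∃ (L : IntermediateField ℚ K) (U : Set (HeightOneSpectrum (𝓞 L))),
        (∀ v ∈ U, ¬ (ratBelow v : ℤ) ∣ discr K → ∃ P : HeightOneSpectrum (𝓞 K),
          P.under (𝓞 L) = v ∧ ∃ σ ∈ N, (∀ x : L, σ x = x) ∧ σ • P.asIdeal ≠ P.asIdeal) ∧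
        ∀ (hU : LogSystem (wt fun v : U => wP v.1)) (β : ℝ), 0 ≤ β →
          exp (1 / (n : ℝ) / 2 * β) ≤ C * b ^ A * truncSum hU (1 - 1 / (n : ℝ) / 2) β ^ n := by
  obtain ⟨C, hC, h⟩ := exists_exp_le_truncSum n
  refine ⟨C + 2, n * (n + 1) * (n * (n + 3)), by linarith, ?_⟩
  intro K _ _ _ hK hSylow N hN hN1 b hb
  have hb1 := hb.one_le
  have hbA : 1 ≤ b ^ (n * (n + 1) * (n * (n + 3))) := one_le_pow₀ hb1
  by_cases hcyc : IsCyclic N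
  · obtain ⟨p, c, hp, hpN, hc, hcN⟩ := exists_prime_order_notMem hSylow N hN1
    obtain ⟨L, alg, hgal, hdeg, hmoved⟩ := exists_galois_tower N hp hc hcN hpN
    refine ⟨L, nonsplitPrimes L (IntermediateField.fixedField N), hmoved, fun hU β hβ => ?_⟩
    refine (h L (IntermediateField.fixedField N) ?_ (hdeg ▸ hp) b hb hU β hβ).trans ?_
    · rw [← hK]
      exact Submodule.finrank_le (IntermediateField.fixedField N).toSubmodule
    · have := one_le_truncSum_wt hU (1 - 1 / (n : ℝ) / 2) hβ
      gcongr
      linarith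
  · refine ⟨⊥, Set.univ, fun v _ hv => ?_, fun hU β hβ => ?_⟩
    · obtain ⟨P, rfl⟩ := exists_under_eq (K := K) v
      rw [ratBelow_under] at hv
      refine ⟨P, rfl, ?_⟩
      by_contra! hcon
      have := isCyclic_stabilizer P hv
      have hle : N ≤ MulAction.stabilizer Gal(K/ℚ) P.asIdeal := fun σ hσ =>
        hcon σ hσ fun x => by
          obtain ⟨q, hq⟩ := IntermediateField.mem_bot.1 x.2
          rw [← hq]
          exact σ.commutes q
      exact hcyc (isCyclic_of_injective (Subgroup.inclusion hle) (Subgroup.inclusion_injective hle))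
    · have h0 : finrank ℚ (⊥ : IntermediateField ℚ K) = 1 := IntermediateField.finrank_bot
      have h1 := exp_le_truncSum_of_finrank_eq_one hn h0 hU hβ
      refine h1.trans ?_
      have := one_le_truncSum_wt hU (1 - 1 / (n : ℝ) / 2) hβ
      gcongr
      nlinarith

end MovedPrimes

section TorsionBound

open Real NumberField IsDedekindDomain Module Ideal
open scoped Pointwise

lemma wt_mapDomain {P R : Type*} (f : P → R) (w : R → ℝ) (e : P →₀ ℕ) :
    wt w (e.mapDomain f) = wt (fun v => w (f v)) e := by
  rw [wt, Finsupp.sum_mapDomain_index (by simp) (by intros; push_cast; ring), wt]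

lemma wt_le_mul_wt {P : Type*} {w w' : P → ℝ} {c : ℝ} (h : ∀ v, w v ≤ c * w' v) (e : P →₀ ℕ) :
    wt w e ≤ c * wt w' e := by
  rw [wt, wt, Finsupp.sum, Finsupp.sum, Finset.mul_sum]
  refine Finset.sum_le_sum fun v _ => ?_
  have := mul_le_mul_of_nonneg_left (h v) (Nat.cast_nonneg (α := ℝ) (e v))
  linarith

lemma PrimeSystem.comp_injective {P R : Type*} {d : ℕ} {w : R → ℝ} {ρ : R → ℕ}
    (h : PrimeSystem d w ρ) {f : P → R} (hf : Function.Injective f) :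
    PrimeSystem d (fun v => w (f v)) (fun v => ρ (f v)) where
  prime v := h.prime _
  le v := h.le _
  card_fiber S q hS := by
    have := h.card_fiber (S.map ⟨f, hf⟩) q (by simpa using hS)
    rwa [Finset.card_map] at this

lemma PrimeSystem.mono {P : Type*} {d d' : ℕ} {w : P → ℝ} {ρ : P → ℕ}
    (h : PrimeSystem d w ρ) (hd : d ≤ d') : PrimeSystem d' w ρ :=
  ⟨h.prime, h.le, fun S q hS => (h.card_fiber S q hS).trans hd⟩

lemma wP_le_finrank_mul_wP_under {L K : Type*} [Field L] [Field K] [NumberField L] [NumberField K]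
    [Algebra L K] (P : HeightOneSpectrum (𝓞 K)) :
    wP P ≤ finrank L K * wP (P.under (𝓞 L)) := by
  have := (P.under (𝓞 L)).isPrime
  let _ := Fintype.ofFinite ((P.under (𝓞 L)).asIdeal.primesOver (𝓞 K))
  have hP : P.asIdeal ∈ (P.under (𝓞 L)).asIdeal.primesOver (𝓞 K) := ⟨P.isPrime, inferInstance⟩
  have h : P.asIdeal.inertiaDeg (𝓞 L) ≤ finrank L K := by
    rw [IsFractionRing.finrank_eq (𝓞 L) L (𝓞 K) K,
      ← sum_ramification_inertia_eq_finrank (P.under (𝓞 L)).asIdeal]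
    exact (Nat.le_mul_of_pos_left _ (ramificationIdx_pos _ _)).trans
      (Finset.single_le_sum (f := fun q : (P.under (𝓞 L)).asIdeal.primesOver (𝓞 K) =>
        q.1.ramificationIdx (𝓞 L) * q.1.inertiaDeg (𝓞 L)) (fun _ _ => Nat.zero_le _)
        (Finset.mem_univ ⟨P.asIdeal, hP⟩))
  have := (primeSystem_wP.pos (P.under (𝓞 L))).le
  rw [wP_eq_inertiaDeg_mul_wP_under (L := L) P]
  gcongr

lemma logSystem_wt_wP_comp {L P : Type*} [Field L] [NumberField L]
    {f : P → HeightOneSpectrum (𝓞 L)} (hf : Function.Injective f) :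
    LogSystem (wt fun v => wP (f v)) :=
  (logSystem_wt_wP.of_wt.comp_injective hf).wt fun v => primeSystem_wP.log_two_le (f v)

/-- Torsion in the class group is small if many primes are moved by automorphisms that fix all
integers of moderate size. -/
lemma exists_ellTorsion_mul_truncSum_le (n : ℕ) {ℓ : ℕ} (hℓ : 1 ≤ ℓ) {s ε : ℝ} (hs : 0 < s)
    (hε : 0 < ε) : ∃ C : ℝ, 0 < C ∧
    ∀ (K : Type) [Field K] [NumberField K], finrank ℚ K = n →
      ∀ (N : Subgroup Gal(K/ℚ)) (L : IntermediateField ℚ K) (U : Set (HeightOneSpectrum (𝓞 L))),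
        (∀ v ∈ U, ¬ (ratBelow v : ℤ) ∣ discr K → ∃ P : HeightOneSpectrum (𝓞 K),
          P.under (𝓞 L) = v ∧ ∃ σ ∈ N, (∀ x : L, σ x = x) ∧ σ • P.asIdeal ≠ P.asIdeal) →
        ∀ β : ℝ, (∀ η : 𝓞 K, (∀ w : InfinitePlace K, w (η : K) ≤ exp ℓ * exp (n * β) ^ (2 * ℓ)) →
          ∀ σ ∈ N, σ • η = η) →
        ∀ hU : LogSystem (wt fun v : U => wP v.1),
          ellTorsion K ℓ * truncSum hU s β ≤ C * |(discr K : ℝ)| ^ ((1 : ℝ) / 2 + ε) := by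
  classical
  obtain ⟨C₁, hC₁, h₁⟩ := ellTorsion_mul_card_le n hℓ (half_pos hε)
  obtain ⟨C₂, hC₂, h₂⟩ := exists_prime_system_ramified_le n hs (half_pos hε)
  refine ⟨C₁ * C₂, by positivity, fun K _ _ hK N L U hmoved β hfix hU => ?_⟩
  have hD0 : discr K ≠ 0 := discr_ne_zero K
  have hD : 0 < |(discr K : ℝ)| := by positivity
  have htower : finrank ℚ L * finrank L K = n := hK ▸ finrank_mul_finrank ℚ L K
  have hn : n ≠ 0 := hK ▸ finrank_pos.ne'
  have hLn : finrank ℚ L ≤ n := Nat.le_of_dvd (by omega) (Dvd.intro _ htower)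
  have hKn : finrank L K ≤ n := Nat.le_of_dvd (by omega) (Dvd.intro_left _ htower)
  let pr : U → Prop := fun v => ¬ (ratBelow v.1 : ℤ) ∣ discr K
  have hT : LogSystem (wt fun v : {v // pr v} => wP v.1.1) :=
    logSystem_wt_wP_comp (Subtype.val_injective.comp Subtype.val_injective)
  have hram : ∀ R : Finset ({v // ¬ pr v} →₀ ℕ),
      ∑ e ∈ R, exp (-(s * wt (fun v : {v // ¬ pr v} => wP v.1.1) e)) ≤
        C₂ * ((discr K).natAbs : ℝ) ^ (ε / 2) := by
    refine h₂ _ _ (fun v : {v // ¬ pr v} => ratBelow v.1.1) ?_ _ (Int.natAbs_ne_zero.2 hD0) ?_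
    · exact (primeSystem_wP.mono hLn).comp_injective
        (Subtype.val_injective.comp Subtype.val_injective)
    · exact fun v => Int.natCast_dvd.1 (not_not.1 v.2)
  rw [Nat.cast_natAbs, Int.cast_abs] at hram
  have hsplit := truncSum_wt_le_card_mul pr hU hT (fun v => (primeSystem_wP.pos v.1).le) (β := β)
    hs.le hram
  choose P hP σ hσN hσL hσP using fun q : {v // pr v} => hmoved q.1.1 q.1.2 q.2
  have hPinj : Function.Injective P := fun q r h =>
    Subtype.ext (Subtype.ext ((hP q).symm.trans ((congrArg _ h).trans (hP r))))
  have hmove : ∀ q r, σ q • (P q).asIdeal ≠ (P r).asIdeal := fun q r h => by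
    have h1 := under_eq_of_smul_eq (hσL q) h
    rw [hP, hP] at h1
    obtain rfl : q = r := Subtype.ext (Subtype.ext h1)
    exact hσP q h
  let g : ({v // pr v} →₀ ℕ) → Ideal (𝓞 K) := fun c => idealOf (c.mapDomain P)
  have hg : Function.Injective g := idealOf_injective.comp (Finsupp.mapDomain_injective hPinj)
  have hcard := h₁ K hK ((hT.fin β).toFinset.image g) (exp (n * β)) ?_ ?_
  · rw [Finset.card_image_of_injective _ hg] at hcard
    calc ellTorsion K ℓ * truncSum hU s β
        ≤ ellTorsion K ℓ * ((hT.fin β).toFinset.card * (C₂ * |(discr K : ℝ)| ^ (ε / 2))) := by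
          gcongr
      _ = ellTorsion K ℓ * (hT.fin β).toFinset.card * (C₂ * |(discr K : ℝ)| ^ (ε / 2)) := by ring
      _ ≤ C₁ * |(discr K : ℝ)| ^ (1 / 2 + ε / 2) * (C₂ * |(discr K : ℝ)| ^ (ε / 2)) := by gcongr
      _ = C₁ * C₂ * (|(discr K : ℝ)| ^ (1 / 2 + ε / 2) * |(discr K : ℝ)| ^ (ε / 2)) := by ring
      _ = _ := by rw [← rpow_add hD]; ring_nf
  · intro J hJ
    obtain ⟨c, hc, rfl⟩ := Finset.mem_image.1 hJ
    refine ⟨idealOf_ne_bot _, ?_⟩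
    rw [Set.Finite.mem_toFinset, Set.mem_ofPred_eq] at hc
    rw [← exp_wt_wP, exp_le_exp, wt_mapDomain]
    refine (wt_le_mul_wt (w' := fun q : {v // pr v} => wP q.1.1) (c := n) (fun q => ?_) c).trans
      (by gcongr)
    refine (wP_le_finrank_mul_wP_under (L := L) (P q)).trans ?_
    rw [hP]
    have := (primeSystem_wP.pos q.1.1).le
    gcongr
  · intro 𝔞 h𝔞 𝔟 h𝔟 hne
    obtain ⟨c, -, rfl⟩ := Finset.mem_image.1 h𝔞
    obtain ⟨c', -, rfl⟩ := Finset.mem_image.1 h𝔟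
    exact not_collision hfix hPinj hσN hmove (fun h => hne (congrArg g h)) (by omega)

end TorsionBound

section Assembly

open Real NumberField IsDedekindDomain Module Ideal
open scoped Pointwise

/-- The sequence with initial value `x` and recursion `y ↦ c * y ^ A`. -/
def powIterate (c : ℝ) (A : ℕ) (x : ℝ) : ℕ → ℝ
  | 0 => x
  | i + 1 => c * powIterate c A x i ^ A

section PowIterate

variable {c x : ℝ} {A : ℕ}

lemma one_le_powIterate (hc : 1 ≤ c) (hx : 1 ≤ x) : ∀ i, 1 ≤ powIterate c A x i
  | 0 => hx
  | i + 1 => one_le_mul_of_one_le_of_one_le hc (one_le_pow₀ (one_le_powIterate hc hx i))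

lemma powIterate_sq_le (hc : 1 ≤ c) (hx : 1 ≤ x) (hA : 2 ≤ A) (i : ℕ) :
    powIterate c A x i ^ 2 ≤ powIterate c A x (i + 1) :=
  have h := one_le_powIterate (A := A) hc hx i
  (pow_le_pow_right₀ h hA).trans (le_mul_of_one_le_left (by positivity) hc)

lemma le_powIterate (hc : 1 ≤ c) (hx : 1 ≤ x) (hA : 2 ≤ A) : ∀ i, x ≤ powIterate c A x i
  | 0 => le_rfl
  | i + 1 => (le_powIterate hc hx hA i).trans
      ((le_self_pow₀ (one_le_powIterate hc hx i) two_ne_zero).trans (powIterate_sq_le hc hx hA i))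

lemma powIterate_le (hc : 1 ≤ c) (hx : 1 ≤ x) : ∀ i, powIterate c A x i ≤ (c * x) ^ (A + 1) ^ i
  | 0 => by simpa [powIterate] using le_mul_of_one_le_left (zero_le_one.trans hx) hc
  | i + 1 => by
    have h0 := one_le_powIterate (A := A) hc hx i
    have hcx : 1 ≤ c * x := one_le_mul_of_one_le_of_one_le hc hx
    have h1 : c ≤ (c * x) ^ (A + 1) ^ i :=
      (le_mul_of_one_le_right (by linarith) hx).trans (le_self_pow₀ hcx (by positivity))
    calc c * powIterate c A x i ^ A ≤ (c * x) ^ (A + 1) ^ i * ((c * x) ^ (A + 1) ^ i) ^ A := by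
          gcongr
          exact powIterate_le hc hx i
      _ = (c * x) ^ (A + 1) ^ (i + 1) := by rw [← pow_mul, ← pow_add]; ring_nf

end PowIterate

lemma exists_ellTorsion_le (n : ℕ) {ℓ : ℕ} (hℓ : 1 ≤ ℓ) : ∃ C : ℝ, 0 < C ∧
    ∀ (K : Type) [Field K] [NumberField K], finrank ℚ K = n →
      (ellTorsion K ℓ : ℝ) ≤ C * |(discr K : ℝ)| ^ ((3 : ℝ) / 2) := by
  obtain ⟨C, hC, h⟩ := ellTorsion_mul_card_le n hℓ one_pos
  refine ⟨C, hC, fun K _ _ hK => ?_⟩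
  have := h K hK {⊤} 1 (by simp) (by simp)
  norm_num at this ⊢
  exact this

lemma BoundedGen.abs_discr_le_of_fixedField_bot {K : Type*} [Field K] [NumberField K] {b : ℝ}
    (h : BoundedGen (IntermediateField.fixedField (⊥ : Subgroup Gal(K/ℚ))) b) :
    |(discr K : ℝ)| ≤ ((finrank ℚ K).factorial * b ^ finrank ℚ K) ^ 2 := by
  have htop : IntermediateField.fixedField (⊥ : Subgroup Gal(K/ℚ)) = ⊤ :=
    IntermediateField.fixedField_bot
  have e : IntermediateField.fixedField (⊥ : Subgroup Gal(K/ℚ)) ≃ₐ[ℚ] K :=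
    (IntermediateField.equivOfEq htop).trans IntermediateField.topEquiv
  rw [← discr_eq_discr_of_algEquiv _ e, ← e.toLinearEquiv.finrank_eq]
  exact h.abs_discr_le

lemma not_isCyclic_and_not_quaternion_congr {G H : Type*} [Group G] [Group H] [Finite H]
    (e : H ≃* G)
    (h : ∀ (p : ℕ), p.Prime → p ∣ Nat.card G → ∀ P : Sylow p G,
      ¬ IsCyclic P ∧ ∀ n : ℕ, 1 ≤ n → IsEmpty (P ≃* QuaternionGroup (2 ^ n)))
    (p : ℕ) (hp : p.Prime) (hpH : p ∣ Nat.card H) (P : Sylow p H) :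
    ¬ IsCyclic P ∧ ∀ n : ℕ, 1 ≤ n → IsEmpty (P ≃* QuaternionGroup (2 ^ n)) := by
  have := Fact.mk hp
  have he : Function.Surjective e.toMonoidHom := e.surjective
  let Q : Sylow p G := P.mapSurjective he
  have f : P ≃* Q :=
    (e.subgroupMap P).trans (MulEquiv.subgroupCongr (P.coe_mapSurjective he).symm)
  obtain ⟨h1, h2⟩ := h p hp (Nat.card_congr e.toEquiv ▸ hpH) Q
  refine ⟨fun hc => h1 (isCyclic_of_surjective f f.surjective), fun n hn => ⟨fun g => ?_⟩⟩
  exact (h2 n hn).false (f.symm.trans g)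

lemma exists_ellTorsion_le_rpow_of_ne_bot {n : ℕ} (hn : 1 ≤ n) {ℓ : ℕ} (hℓ : 1 ≤ ℓ) :
    ∃ (c : ℝ) (A : ℕ), 1 ≤ c ∧ 2 ≤ A ∧ ∀ ε : ℝ, 0 < ε → ∃ C : ℝ, 0 < C ∧
      ∀ (K : Type) [Field K] [NumberField K] [IsGalois ℚ K], finrank ℚ K = n →
        (∀ (p : ℕ), p.Prime → p ∣ Nat.card Gal(K/ℚ) → ∀ P : Sylow p Gal(K/ℚ),
          ¬ IsCyclic P ∧ ∀ n : ℕ, 1 ≤ n → IsEmpty (P ≃* QuaternionGroup (2 ^ n))) →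
        ∀ N : Subgroup Gal(K/ℚ), N.Normal → N ≠ ⊥ →
        ∀ b, BoundedGen (IntermediateField.fixedField N) b →
          (∀ η : 𝓞 K, (∀ w : InfinitePlace K, w (η : K) ≤ c * b ^ A) → ∀ σ ∈ N, σ • η = η) →
          ellTorsion K ℓ * b ≤ C * |(discr K : ℝ)| ^ ((1 : ℝ) / 2 + ε) := by
  obtain ⟨C₁, A₁, hC₁, h₁⟩ := exists_moved_primes hn
  have hn1 : (1 : ℝ) ≤ n := by exact_mod_cast hn
  have hs : 0 < 1 - 1 / (n : ℝ) / 2 := by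
    have : 1 / (n : ℝ) ≤ 1 := (div_le_one (by linarith)).2 hn1
    linarith
  refine ⟨exp ℓ * C₁ ^ (n * (2 * n) * (2 * ℓ)), (A₁ + n) * (n * (2 * n) * (2 * ℓ)), ?_, ?_, ?_⟩
  · exact one_le_mul_of_one_le_of_one_le (one_le_exp (Nat.cast_nonneg _)) (one_le_pow₀ hC₁)
  · have h1 : 1 ≤ A₁ + n := by omega
    have h2 : 2 ≤ n * (2 * n) * (2 * ℓ) :=
      (show 2 ≤ 1 * (2 * 1) * (2 * 1) by norm_num).trans (by gcongr)
    nlinarith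
  intro ε hε
  obtain ⟨C, hC, h⟩ := exists_ellTorsion_mul_truncSum_le n hℓ hs hε
  refine ⟨C, hC, fun K _ _ _ hK hSylow N hN hN1 b hb hfix => ?_⟩
  have hb1 := hb.one_le
  obtain ⟨L, U, hmoved, hlarge⟩ := h₁ K hK hSylow N hN hN1 b hb
  have hU : LogSystem (wt fun v : U => wP v.1) := logSystem_wt_wP_comp Subtype.val_injective
  set y := C₁ * b ^ (A₁ + n) with hy
  have hy1 : 1 ≤ y := one_le_mul_of_one_le_of_one_le hC₁ (one_le_pow₀ hb1)
  have hlog : 0 ≤ log y := log_nonneg hy1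
  have hexp : exp (n * (2 * n * log y)) ^ (2 * ℓ) = y ^ (n * (2 * n) * (2 * ℓ)) := by
    rw [pow_mul _ _ (2 * ℓ)]
    congr 1
    rw [← mul_assoc, mul_comm, exp_mul, exp_log (by linarith), ← rpow_natCast]
    push_cast
    rfl
  have hfix' := h K hK N L U hmoved (2 * n * log y) (fun η hη => hfix η fun w => ?_) hU
  · refine le_trans ?_ hfix'
    gcongr
    have h2 := hlarge hU (2 * n * log y) (by positivity)
    rw [show 1 / (n : ℝ) / 2 * (2 * n * log y) = log y by field_simp, exp_log (by linarith)] at h2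
    replace h2 := (show C₁ * b ^ A₁ * b ^ n = y by rw [hy, pow_add, mul_assoc]).trans_le h2
    exact le_of_pow_le_pow_left₀ (n := n) (by omega)
      (zero_le_one.trans (one_le_truncSum_wt hU _ (by positivity)))
      (le_of_mul_le_mul_left h2 (by positivity))
  · refine (hη w).trans_eq ?_
    rw [hexp, hy, mul_pow, ← pow_mul, ← mul_assoc]

lemma exists_ellTorsion_le_rpow {n : ℕ} (hn : 1 ≤ n) {ℓ : ℕ} (hℓ : 1 ≤ ℓ) :
    ∃ δ : ℝ, 0 < δ ∧ ∀ ε : ℝ, 0 < ε → ∃ C : ℝ, 0 < C ∧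
      ∀ (K : Type) [Field K] [NumberField K] [IsGalois ℚ K], finrank ℚ K = n →
        (∀ (p : ℕ), p.Prime → p ∣ Nat.card Gal(K/ℚ) → ∀ P : Sylow p Gal(K/ℚ),
          ¬ IsCyclic P ∧ ∀ n : ℕ, 1 ≤ n → IsEmpty (P ≃* QuaternionGroup (2 ^ n))) →
        (ellTorsion K ℓ : ℝ) ≤ C * |(discr K : ℝ)| ^ ((1 : ℝ) / 2 - δ + ε) := by
  obtain ⟨c, A, hc, hA, h₁⟩ := exists_ellTorsion_le_rpow_of_ne_bot hn hℓ
  obtain ⟨C₃, hC₃, h₃⟩ := exists_ellTorsion_le n hℓ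
  set E := (A + 1) ^ n with hE
  have hE0 : 1 ≤ E := Nat.one_le_pow _ _ (by omega)
  have hk : (1 : ℝ) ≤ (E * n : ℕ) := by exact_mod_cast Nat.mul_pos hE0 hn
  set k := E * n with hk_def
  set M : ℝ := (n.factorial * c ^ k) ^ 2
  refine ⟨1 / (4 * k), by positivity, fun ε hε => ?_⟩
  obtain ⟨C₁, hC₁, h₁⟩ := h₁ ε hε
  refine ⟨C₁ + C₃ * M ^ 3, by positivity, fun K _ _ _ hK hSylow => ?_⟩
  set D := |(discr K : ℝ)|
  have hD1 : 1 ≤ D := by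
    have := Int.one_le_abs (discr_ne_zero K)
    rw [show D = ((|discr K| : ℤ) : ℝ) from Int.cast_abs.symm]
    exact_mod_cast this
  have hD0 : 0 < D := by linarith
  set x := D ^ (1 / (4 * (k : ℝ))) with hx
  have hx1 : 1 ≤ x := one_le_rpow hD1 (by positivity)
  obtain ⟨i, hi, N, hN, hfix, hb⟩ := exists_normal_fixing (K := K)
    (one_le_powIterate (A := A) hc hx1) (powIterate_sq_le hc hx1 hA)
  rw [hK] at hi
  by_cases hN1 : N = ⊥
  · subst hN1
    have hM : D ^ ((1 : ℝ) / 2) ≤ M := by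
      have h4 := hb.abs_discr_le_of_fixedField_bot
      rw [hK] at h4
      have h5 : powIterate c A x i ^ n ≤ c ^ k * x ^ k := by
        rw [← mul_pow, hk_def, pow_mul]
        have := one_le_powIterate (A := A) hc hx1 i
        gcongr
        refine (powIterate_le hc hx1 i).trans (pow_le_pow_right₀ ?_ ?_)
        · exact one_le_mul_of_one_le_of_one_le hc hx1
        · exact Nat.pow_le_pow_right (by omega) hi.le
      have h6 : (x ^ k) ^ 2 = D ^ ((1 : ℝ) / 2) := by
        rw [← pow_mul, hx, ← rpow_mul_natCast hD0.le]
        congr 1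
        push_cast
        field_simp
        norm_num
      have h7 : D ≤ M * D ^ ((1 : ℝ) / 2) := by
        have := one_le_powIterate (A := A) hc hx1 i
        calc D ≤ (n.factorial * powIterate c A x i ^ n) ^ 2 := h4
          _ ≤ (n.factorial * (c ^ k * x ^ k)) ^ 2 := by gcongr
          _ = M * (x ^ k) ^ 2 := by ring
          _ = _ := by rw [h6]
      have h8 : D = D ^ ((1 : ℝ) / 2) * D ^ ((1 : ℝ) / 2) := by rw [← rpow_add hD0]; norm_num
      refine le_of_mul_le_mul_right (h8.symm.trans_le h7) (by positivity)
    have h9 : 1 ≤ D ^ ((1 : ℝ) / 2 - 1 / (4 * k) + ε) := by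
      refine one_le_rpow hD1 ?_
      have : 1 / (4 * (k : ℝ)) ≤ 1 / 4 := by gcongr; linarith
      linarith
    calc (ellTorsion K ℓ : ℝ) ≤ C₃ * D ^ ((3 : ℝ) / 2) := h₃ K hK
      _ = C₃ * (D ^ ((1 : ℝ) / 2)) ^ 3 := by rw [← rpow_mul_natCast hD0.le]; norm_num
      _ ≤ C₃ * M ^ 3 := by gcongr
      _ ≤ C₁ + C₃ * M ^ 3 := by linarith
      _ ≤ _ := le_mul_of_one_le_right (by positivity) h9
  · have h4 := h₁ K hK hSylow N hN hN1 _ hb hfix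
    have h5 := (mul_le_mul_of_nonneg_left (le_powIterate hc hx1 hA i)
      (Nat.cast_nonneg (ellTorsion K ℓ))).trans h4
    calc (ellTorsion K ℓ : ℝ) ≤ C₁ * D ^ ((1 : ℝ) / 2 + ε) / x :=
          (le_div_iff₀ (by linarith)).2 h5
      _ = C₁ * D ^ ((1 : ℝ) / 2 - 1 / (4 * k) + ε) := by
          rw [mul_div_assoc, hx, ← rpow_sub hD0]
          ring_nf
      _ ≤ _ := by gcongr; linarith [show 0 ≤ C₃ * M ^ 3 by positivity]

end Assembly

/-- Let `ℓ > 1` and let `G` be a nontrivial finite nilpotent group all of whose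
Sylow subgroups are non-cyclic and non-(generalized-)quaternion. Then there is `δ > 0` such that
for every `ε > 0` there is `C > 0` with `|Cl_F[ℓ]| ≤ C · Disc(F)^(1/2 - δ + ε)` for every Galois
number field `F/ℚ` with `Gal(F/ℚ) ≅ G`. -/
theorem pointwise_ltorsion_bound_nilpotent (ℓ : ℕ) (hℓ : 1 < ℓ)
    (G : Type) [Group G] [Finite G] (hG : Group.IsNilpotent G) (hnt : Nontrivial G)
    (hSylow : ∀ (p : ℕ), p.Prime → p ∣ Nat.card G → ∀ P : Sylow p G,
      ¬ IsCyclic P ∧ ∀ n : ℕ, 1 ≤ n → IsEmpty (P ≃* QuaternionGroup (2 ^ n))) :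
    ∃ δ : ℝ, 0 < δ ∧ ∀ ε : ℝ, 0 < ε → ∃ C : ℝ, 0 < C ∧
      ∀ (F : Type) [Field F] [NumberField F] [IsGalois ℚ F],
        Nonempty ((F ≃ₐ[ℚ] F) ≃* G) →
        (ellTorsion F ℓ : ℝ) ≤ C * (|discr F| : ℝ) ^ ((1 : ℝ) / 2 - δ + ε) := by
  obtain ⟨δ, hδ, h⟩ := exists_ellTorsion_le_rpow (n := Nat.card G) Nat.card_pos hℓ.le
  refine ⟨δ, hδ, fun ε hε => ?_⟩
  obtain ⟨C, hC, h⟩ := h ε hε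
  refine ⟨C, hC, fun F _ _ _ ⟨e⟩ => h F ?_ (not_isCyclic_and_not_quaternion_congr e hSylow)⟩
  rw [← IsGalois.card_aut_eq_finrank, Nat.card_congr e.toEquiv]
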